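/- There exist absolute constants C, c > 0 such that the following holds. Let δ > 0 and let f₁, f₂, f₃ : ℤ → ℂ be 1-bounded functions supported in [N]. Suppose that |∑_{x∈ℤ} ∑_{y∈ℕ} f₁(x) f₂(x+y) f₃(x+y²)| ≥ δ N^{3/2}. Then either N ≤ C δ^{-C}, or for each i = 1, 2, 3 there is a 1-bounded local function φᵢ of resolution Mᵢ ≥ c δ^C N^{1/2} and modulus qᵢ ≤ C δ^{-C} such that |∑_{x∈ℤ} fᵢ(x) φᵢ(x)| ≥ c δ^C N. -/

import Mathlib

/-- `φ : ℤ → ℂ` is a *local function of resolution `M` and modulus `q`*: there is a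
partition of `ℝ` (hence of `ℤ`) into intervals of length `M` (the intervals
`[r + kM, r + (k+1)M)`) such that `φ` is constant on the intersection of every such
interval with every congruence class mod `q`. -/
def IsLocalFunction (φ : ℤ → ℂ) (M : ℝ) (q : ℕ) : Prop :=
  ∃ r : ℝ, ∀ x y : ℤ,
    ⌊((x : ℝ) - r) / M⌋ = ⌊((y : ℝ) - r) / M⌋ → x % (q : ℤ) = y % (q : ℤ) → φ x = φ y

namespace NLR
open Finset
open scoped ComplexConjugate
notation:max "§" n:max => ((n : ℕ) : ℝ)
notation:max "¶" n:max => ((n : ℕ) : ZMod _)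

abbrev Bd {α : Type*} (f : α → ℂ) : Prop := ∀ y, ‖f y‖ ≤ 1

lemma sc {ι M : Type*} [AddCommMonoid M] {s : Finset ι} {f g : ι → M} (h : ∀ x ∈ s, f x = g x) : ∑ x ∈ s, f x = ∑ x ∈ s, g x := Finset.sum_congr rfl h

noncomputable def e (t : ℝ) : ℂ := Complex.exp ((2 * Real.pi * t : ℝ) * Complex.I)

lemma norm_e (t : ℝ) : ‖e t‖ = 1 := by
  unfold e; exact Complex.norm_exp_ofReal_mul_I _

lemma e_add (a b : ℝ) : e (a + b) = e a * e b := by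
  unfold e; rw [← Complex.exp_add]; congr 1; push_cast; ring

lemma e_zero : e 0 = 1 := by simp [e]

lemma e_int (n : ℤ) : e n = 1 := by
  unfold e; rw [Complex.exp_eq_one_iff]; exact ⟨n, by push_cast; ring⟩

lemma e_conj (a : ℝ) : conj (e a) = e (-a) := by
  unfold e; rw [← Complex.exp_conj]; congr 1
  rw [map_mul, Complex.conj_ofReal, Complex.conj_I]; push_cast; ring

lemma e_sub_int (a : ℝ) (n : ℤ) : e (a - n) = e a := by
  have := e_add (a - n) n
  rw [e_int, mul_one, sub_add_cancel] at this; exact this.symm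

lemma e_add_int (a : ℝ) (n : ℤ) : e (a + n) = e a := by
  rw [e_add, e_int, mul_one]

lemma e_sub_norm (a b : ℝ) : ‖e a - e b‖ ≤ 7 * |a - b| := by
  have h : e a - e b = e b * (e (a - b) - 1) := by
    rw [mul_sub, ← e_add]; simp
  rw [h, norm_mul, norm_e, one_mul]
  have := Real.norm_exp_I_mul_ofReal_sub_one_le (x := 2 * Real.pi * (a - b))
  unfold e; rw [mul_comm _ Complex.I]
  refine this.trans ?_
  rw [Real.norm_eq_abs, abs_mul, abs_of_pos (by positivity)]
  have := Real.pi_lt_d2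
  have h2 := abs_nonneg (a - b)
  nlinarith

/-! ### phases, pigeonhole, Cauchy-Schwarz -/

noncomputable def ph (z : ℂ) : ℂ := if z = 0 then 1 else conj z / ‖z‖

lemma ph_norm (z : ℂ) : ‖ph z‖ = 1 := by
  unfold ph; split_ifs with h
  · simp
  · simp [h]

lemma ph_mul (z : ℂ) : ph z * z = (‖z‖ : ℂ) := by
  unfold ph; split_ifs with h
  · simp [h]
  · have : (‖z‖ : ℂ) ≠ 0 := by simpa using h
    field_simp
    rw [mul_comm, Complex.mul_conj']

lemma bmul {a b : ℂ} (ha : ‖a‖ ≤ 1) (hb : ‖b‖ ≤ 1) : ‖a * b‖ ≤ 1 := by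
  rw [norm_mul]; exact mul_le_one₀ ha (norm_nonneg _) hb

lemma bconj {a : ℂ} (ha : ‖a‖ ≤ 1) : ‖conj a‖ ≤ 1 := by simpa using ha

lemma sum_norm_eq {ι : Type*} (s : Finset ι) (F : ι → ℂ) :
    ‖∑ i ∈ s, ph (F i) * F i‖ = ∑ i ∈ s, ‖F i‖ := by
  simp only [ph_mul]
  rw [← Complex.ofReal_sum, Complex.norm_real, Real.norm_eq_abs, abs_of_nonneg]
  exact sum_nonneg fun _ _ => norm_nonneg _

lemma norm_sum_le_card {ι : Type*} (s : Finset ι) (F : ι → ℂ) (B : ℝ)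
    (h : ∀ i ∈ s, ‖F i‖ ≤ B) : ‖∑ i ∈ s, F i‖ ≤ #s * B := by
  refine (norm_sum_le_of_le s h).trans ?_
  simp

lemma pigeon {ι : Type*} {s : Finset ι} (hs : s.Nonempty) (f : ι → ℝ) (c : ℝ)
    (h : #s * c ≤ ∑ i ∈ s, f i) : ∃ i ∈ s, c ≤ f i := by
  apply exists_le_of_sum_le hs
  simpa using h

lemma pigeonR {n : ℕ} (hn : 0 < n) (f : ℕ → ℝ) (c : ℝ)
    (h : n * c ≤ ∑ i ∈ range n, f i) : ∃ i < n, c ≤ f i := by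
  obtain ⟨i, hi, h2⟩ := pigeon (s := range n) (by simpa using hn.ne') f c (by simpa using h)
  exact ⟨i, by simpa using hi, h2⟩

open Classical in
lemma popular {ι : Type*} (s : Finset ι) (f : ι → ℝ) (η B : ℝ) (hη : 0 ≤ η) (hB : 0 < B)
    (hf : ∀ i ∈ s, f i ≤ B) (h : η * #s * B ≤ ∑ i ∈ s, f i) :
    η / 2 * #s ≤ #(s.filter fun i => η / 2 * B ≤ f i) := by
  have h1 : ∑ i ∈ s, f i ≤ ∑ i ∈ s, ((if η / 2 * B ≤ f i then B else 0) + η / 2 * B) := by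
    refine sum_le_sum fun i hi => ?_
    split_ifs with h
    · have := hf i hi
      have : 0 ≤ η / 2 * B := by positivity
      linarith [hf i hi]
    · linarith
  rw [sum_add_distrib, ← sum_filter] at h1
  simp only [sum_const, nsmul_eq_mul] at h1
  have h2 : η / 2 * #s * B ≤ #(s.filter fun i => η / 2 * B ≤ f i) * B := by linarith
  exact le_of_mul_le_mul_right h2 hB

lemma cs_norm {ι : Type*} (s : Finset ι) (F : ι → ℂ) :
    ‖∑ i ∈ s, F i‖ ^ 2 ≤ #s * ∑ i ∈ s, ‖F i‖ ^ 2 := by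
  calc ‖∑ i ∈ s, F i‖ ^ 2 ≤ (∑ i ∈ s, ‖F i‖) ^ 2 := by
        gcongr; exact norm_sum_le _ _
    _ ≤ _ := sq_sum_le_card_mul_sum_sq

lemma cs_bdd {ι : Type*} (s : Finset ι) (G F : ι → ℂ) (hG : ∀ i ∈ s, ‖G i‖ ≤ 1) :
    ‖∑ i ∈ s, G i * F i‖ ^ 2 ≤ #s * ∑ i ∈ s, ‖F i‖ ^ 2 := by
  refine (cs_norm s _).trans ?_
  gcongr with i hi
  rw [norm_mul]
  exact mul_le_of_le_one_left (norm_nonneg _) (hG i hi)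

lemma cs_mul {ι : Type*} (s : Finset ι) (G F : ι → ℂ) :
    ‖∑ i ∈ s, G i * F i‖ ^ 2 ≤ (∑ i ∈ s, ‖G i‖ ^ 2) * ∑ i ∈ s, ‖F i‖ ^ 2 := by
  calc ‖∑ i ∈ s, G i * F i‖ ^ 2 ≤ (∑ i ∈ s, ‖G i‖ * ‖F i‖) ^ 2 := by
        gcongr; refine (norm_sum_le _ _).trans (le_of_eq ?_); simp
    _ ≤ _ := sum_mul_sq_le_sq_mul_sq _ _ _

lemma nsq_sum {ι : Type*} (s : Finset ι) (F : ι → ℂ) :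
    ((‖∑ i ∈ s, F i‖ ^ 2 : ℝ) : ℂ) = ∑ i ∈ s, ∑ j ∈ s, F i * conj (F j) := by
  push_cast
  rw [← Complex.mul_conj', map_sum, sum_mul_sum]

lemma sumsq_eq {α ι : Type*} (X : Finset α) (s : Finset ι) (F : α → ι → ℂ) :
    ((∑ x ∈ X, ‖∑ i ∈ s, F x i‖ ^ 2 : ℝ) : ℂ)
      = ∑ i ∈ s, ∑ j ∈ s, ∑ x ∈ X, F x i * conj (F x j) := by
  rw [Complex.ofReal_sum]
  simp_rw [nsq_sum]
  rw [sum_comm]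
  refine sc fun i _ => ?_
  rw [sum_comm]

lemma sumsq_le {α ι : Type*} (X : Finset α) (s : Finset ι) (F : α → ι → ℂ) :
    ∑ x ∈ X, ‖∑ i ∈ s, F x i‖ ^ 2
      ≤ ∑ i ∈ s, ∑ j ∈ s, ‖∑ x ∈ X, F x i * conj (F x j)‖ := by
  have h := sumsq_eq X s F
  have h2 : ‖((∑ x ∈ X, ‖∑ i ∈ s, F x i‖ ^ 2 : ℝ) : ℂ)‖ = ∑ x ∈ X, ‖∑ i ∈ s, F x i‖ ^ 2 := by
    rw [Complex.norm_real, Real.norm_eq_abs, abs_of_nonneg]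
    positivity
  rw [← h2, h]
  refine (norm_sum_le _ _).trans (sum_le_sum fun i _ => norm_sum_le _ _)

/-! ### window shifts -/

lemma shift_bd (G : ℤ → ℂ) (hG : Bd G) (R : ℕ) (a : ℤ) :
    ‖∑ r ∈ range R, G (r + a) - ∑ r ∈ range R, G r‖ ≤ 2 * |(a : ℝ)| := by
  have step : ∀ b : ℤ, ‖∑ r ∈ range R, G (r + (b + 1)) - ∑ r ∈ range R, G (r + b)‖ ≤ 2 := by
    intro b
    rw [← sum_sub_distrib]
    have h := sum_range_sub (fun r : ℕ => G (r + b)) R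
    have h2 : ∑ r ∈ range R, (G (r + (b + 1)) - G (r + b)) = G (R + b) - G ((0 : ℕ) + b) := by
      rw [← h]; refine sc fun r _ => ?_
      congr 2; push_cast; ring
    rw [h2]
    refine (norm_sub_le _ _).trans ?_
    linarith [hG (R + b), hG ((0 : ℕ) + b)]
  have pos : ∀ n : ℕ, ∀ b : ℤ,
      ‖∑ r ∈ range R, G (r + (b + n)) - ∑ r ∈ range R, G (r + b)‖ ≤ 2 * n := by
    intro n b
    induction n with
    | zero => simp
    | succ n ih =>
      have := step (b + n)
      have h3 := norm_add_le (∑ r ∈ range R, G (r + (b + n + 1)) - ∑ r ∈ range R, G (r + (b + n)))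
        (∑ r ∈ range R, G (r + (b + n)) - ∑ r ∈ range R, G (r + b))
      rw [sub_add_sub_cancel] at h3
      push_cast
      rw [← add_assoc]
      linarith
  obtain ⟨n, rfl | rfl⟩ := a.eq_nat_or_neg
  · have := pos n 0
    simpa using this
  · have := pos n (-n)
    rw [norm_sub_rev]
    simpa using this

lemma shift_lb (G : ℤ → ℂ) (hG : Bd G) (R : ℕ) (a : ℤ) (B : ℝ) (h : |(a : ℝ)| ≤ B) :
    ‖∑ r ∈ range R, G r‖ ≤ ‖∑ r ∈ range R, G (r + a)‖ + 2 * B := by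
  have := shift_bd G hG R a
  have h2 := norm_sub_norm_le (∑ r ∈ range R, G r) (∑ r ∈ range R, G (r + a))
  rw [norm_sub_rev] at h2
  linarith

set_option maxHeartbeats 1000000 in
/-- van der Corput. -/
lemma vdc {ι : Type*} (X : Finset ι) (G : ι → ℤ → ℂ) (hG : ∀ x r, ‖G x r‖ ≤ 1)
    (δ : ℝ) (hδ : 0 < δ) (hδ1 : δ ≤ 1) (R a0 H : ℕ) (h8 : 8 * (a0 * H : ℝ) ≤ δ * R)
    (h16 : 16 ≤ δ ^ 2 * H) (hbig : δ * #X * R ≤ ∑ x ∈ X, ‖∑ r ∈ range R, G x r‖) :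
    ∃ j l : ℕ, j < H ∧ 1 ≤ l ∧ l < H ∧ δ ^ 2 / 2 * #X * R ≤
      ‖∑ x ∈ X, ∑ r ∈ range R, G x (r + (a0 * j : ℕ)) * conj (G x (r + (a0 * j : ℕ) + (a0 * l : ℕ)))‖ := by
  have hH : (16 : ℝ) ≤ H := by
    have : δ ^ 2 ≤ 1 := by nlinarith
    nlinarith [Nat.cast_nonneg (α := ℝ) H]
  have hHn : 16 ≤ H := mod_cast hH
  set P : Finset (ι × ℕ) := X ×ˢ range R with hP
  have hPc : (#P : ℝ) = #X * R := by simp [hP]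
  have h1 : ∀ x, §H * ‖∑ r ∈ range R, G x r‖ ≤
      ∑ r ∈ range R, ‖∑ j ∈ range H, G x (r + (a0 * j : ℕ))‖ + 2 * (a0 * H) * H := by
    intro x
    have hj : ∀ j ∈ range H, ‖∑ r ∈ range R, G x r - ∑ r ∈ range R, G x (r + (a0 * j : ℕ))‖
        ≤ 2 * (a0 * H) := by
      intro j hj
      rw [norm_sub_rev]
      refine (shift_bd (G x) (hG x) R (a0 * j : ℕ)).trans ?_
      simp only [mem_range] at hj
      have : §j ≤ H := mod_cast hj.le
      push_cast
      rw [abs_of_nonneg (by positivity)]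
      gcongr
    have h2 := norm_sum_le_card (range H) _ _ hj
    rw [sum_sub_distrib] at h2
    simp only [sum_const, card_range, nsmul_eq_mul] at h2
    have h3 := norm_sub_norm_le ((H : ℂ) * ∑ r ∈ range R, G x r)
      (∑ j ∈ range H, ∑ r ∈ range R, G x (r + (a0 * j : ℕ)))
    rw [norm_mul, Complex.norm_natCast] at h3
    have h4 : ‖∑ j ∈ range H, ∑ r ∈ range R, G x (r + (a0 * j : ℕ))‖ ≤
       ∑ r ∈ range R, ‖∑ j ∈ range H, G x (r + (a0 * j : ℕ))‖ := by
      rw [sum_comm]; exact norm_sum_le _ _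
    linarith
  have h2 : 3 / 4 * δ * #X * R * H ≤ ∑ p ∈ P, ‖∑ j ∈ range H, G p.1 (p.2 + (a0 * j : ℕ))‖ := by
    rw [hP, sum_product]
    have := sum_le_sum (fun x (_ : x ∈ X) => h1 x)
    rw [← mul_sum, sum_add_distrib] at this
    simp only [sum_const, nsmul_eq_mul] at this
    have h5 : (#X : ℝ) * (2 * (a0 * H) * H) ≤ 1 / 4 * δ * #X * R * H := by
      have : (0 : ℝ) ≤ #X * H := by positivity
      nlinarith
    have h6 : §H * (δ * #X * R) ≤ H * ∑ x ∈ X, ‖∑ r ∈ range R, G x r‖ := by gcongr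
    dsimp only
    linarith
  have h3 : (3 / 4 * δ * #X * R * H) ^ 2 ≤
      #P * ∑ p ∈ P, ‖∑ j ∈ range H, G p.1 (p.2 + (a0 * j : ℕ))‖ ^ 2 := by
    refine (pow_le_pow_left₀ (by positivity) h2 2).trans sq_sum_le_card_mul_sum_sq
  have h4 := sumsq_le P (range H) (fun p j => G p.1 (p.2 + (a0 * j : ℕ)))
  set S : ℕ → ℕ → ℝ := fun i j => ‖∑ p ∈ P, G p.1 (p.2 + (a0 * i : ℕ)) * conj (G p.1 (p.2 + (a0 * j : ℕ)))‖ with hS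
  have hSb : ∀ i j, S i j ≤ #X * R := by
    intro i j
    rw [← hPc]
    have := norm_sum_le_card P (fun p => G p.1 (p.2 + (a0 * i : ℕ)) * conj (G p.1 (p.2 + (a0 * j : ℕ)))) 1
      (fun p _ => bmul (hG _ _) (bconj (hG _ _)))
    simpa [hS] using this
  have hSsymm : ∀ i j, S i j = S j i := by
    intro i j
    simp only [hS]
    rw [← Complex.norm_conj, map_sum]
    congr 1
    refine sc fun p _ => ?_
    rw [map_mul, Complex.conj_conj, mul_comm]
  have h5 : ∑ i ∈ range H, ∑ j ∈ range H, S i j = ∑ p ∈ (range H).offDiag, S p.1 p.2 + ∑ i ∈ range H, S i i := by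
    rw [← sum_product', ← diag_union_offDiag, sum_union (disjoint_diag_offDiag _), add_comm]
    simp
  have hXR : (0 : ℝ) ≤ #X * R := by positivity
  have h6 : ∑ i ∈ range H, S i i ≤ H * (#X * R) := by
    refine (sum_le_sum fun i _ => hSb i i).trans ?_
    simp
  have h7 : §H ^ 2 * (δ ^ 2 / 2 * (#X * R)) ≤ ∑ p ∈ (range H).offDiag, S p.1 p.2 := by
    have h8 : 9 / 16 * δ ^ 2 * (#X * R) * H ^ 2 ≤ ∑ p ∈ P, ‖∑ j ∈ range H, G p.1 (p.2 + (a0 * j : ℕ))‖ ^ 2 := by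
      rcases hXR.eq_or_lt with h0 | h0
      · rw [← h0]; simp; positivity
      · rw [hPc] at h3
        refine le_of_mul_le_mul_left ?_ h0
        refine le_trans (le_of_eq ?_) h3
        ring
    have h9 : §H * (#X * R) ≤ 1 / 16 * δ ^ 2 * (#X * R) * H ^ 2 := by
      have : §H * 16 * (#X * R) ≤ H * (δ ^ 2 * H) * (#X * R) := by gcongr
      linarith
    have h4' : ∑ p ∈ P, ‖∑ j ∈ range H, G p.1 (p.2 + (a0 * j : ℕ))‖ ^ 2 ≤ ∑ i ∈ range H, ∑ j ∈ range H, S i j := h4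
    linarith
  have hne : ((range H).offDiag).Nonempty := ⟨(0, 1), by simp; omega⟩
  obtain ⟨p, hp, hpS⟩ := pigeon hne (fun p => S p.1 p.2) (δ ^ 2 / 2 * (#X * R)) (by
    refine le_trans ?_ h7
    gcongr
    rw [offDiag_card, card_range]
    have : H * H - H ≤ H ^ 2 := by rw [sq]; omega
    exact_mod_cast this)
  have key : ∀ i j, i < j → j < H → δ ^ 2 / 2 * (#X * R) ≤ S i j → ∃ j l : ℕ, j < H ∧ 1 ≤ l ∧ l < H ∧ δ ^ 2 / 2 * #X * R ≤
      ‖∑ x ∈ X, ∑ r ∈ range R, G x (r + (a0 * j : ℕ)) * conj (G x (r + (a0 * j : ℕ) + (a0 * l : ℕ)))‖ := by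
    intro i j hij hj h
    refine ⟨i, j - i, by omega, by omega, by omega, ?_⟩
    rw [mul_assoc]
    refine h.trans (le_of_eq ?_)
    simp only [hS, hP]
    rw [sum_product]
    congr 1
    refine sc fun x _ => sc fun r _ => ?_
    congr 3
    push_cast [hij.le]
    ring
  simp only [mem_offDiag, mem_range] at hp
  obtain ⟨a, b, c⟩ := hp
  rcases lt_or_gt_of_ne c with h | h
  · exact key _ _ h b hpS
  · refine key _ _ h a ?_
    rw [hSsymm]; exact hpS

section
section
variable {Q : ℕ} [NeZero Q]

noncomputable abbrev ch (x : ZMod Q) : ℂ := ZMod.stdAddChar x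

lemma ch_add (x y : ZMod Q) : ch (x + y) = ch x * ch y := AddChar.map_add_eq_mul _ _ _
lemma ch_conj (x : ZMod Q) : conj (ch x) = ch (-x) := (AddChar.map_neg_eq_conj _ _).symm
lemma ch_norm (x : ZMod Q) : ‖ch x‖ = 1 := by
  exact AddChar.norm_apply _ _
lemma ch_zero : ch (0 : ZMod Q) = 1 := AddChar.map_zero_eq_one _

lemma ch_e (j : ℤ) : ch (j : ZMod Q) = e (j / Q) := by
  unfold ch e; rw [ZMod.stdAddChar_coe]; congr 1; push_cast; ring

lemma ch_e_val (x : ZMod Q) (n : ℤ) : ch (x * (n : ZMod Q)) = e ((x.val : ℝ) / Q * n) := by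
  have : x * (n : ZMod Q) = ((x.val * n : ℤ) : ZMod Q) := by simp
  rw [this, ch_e]; congr 1; push_cast; ring

lemma ch_sum (b : ZMod Q) : ∑ x : ZMod Q, ch (x * b) = if b = 0 then (Q : ℂ) else 0 := by
  have := AddChar.sum_mulShift b (ZMod.isPrimitive_stdAddChar Q)
  unfold ch; rw [this]; simp

lemma pars {ι : Type*} (A : Finset ι) (τ : ι → ZMod Q) (hτ : Set.InjOn τ A) (k : ι → ℂ) :
    ∑ ξ : ZMod Q, ‖∑ a ∈ A, k a * ch (ξ * τ a)‖ ^ 2 = Q * ∑ a ∈ A, ‖k a‖ ^ 2 := by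
  have h := sumsq_eq univ A (fun (ξ : ZMod Q) a => k a * ch (ξ * τ a))
  have h2 : ∀ i ∈ A, ∑ j ∈ A, ∑ ξ : ZMod Q, k i * ch (ξ * τ i) * conj (k j * ch (ξ * τ j))
      = Q * (‖k i‖ ^ 2 : ℝ) := by
    intro i hi
    rw [sum_eq_single_of_mem i hi]
    · have : ∀ ξ : ZMod Q, k i * ch (ξ * τ i) * conj (k i * ch (ξ * τ i)) = (‖k i‖ ^ 2 : ℝ) := by
        intro ξ
        rw [Complex.mul_conj', norm_mul, ch_norm]; simp
      simp_rw [this]; simp [ZMod.card]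
    · intro j hj hij
      have : ∀ ξ : ZMod Q, k i * ch (ξ * τ i) * conj (k j * ch (ξ * τ j))
          = k i * conj (k j) * ch (ξ * (τ i - τ j)) := by
        intro ξ
        rw [map_mul, ch_conj, mul_sub, sub_eq_add_neg, ch_add]; ring
      simp_rw [this]
      rw [← mul_sum, ch_sum, if_neg, mul_zero]
      intro h
      exact hij (hτ hj hi (sub_eq_zero.mp h).symm)
  rw [sum_congr rfl h2, ← mul_sum] at h
  exact_mod_cast h

noncomputable def ft (p : ZMod Q → ℂ) (ξ : ZMod Q) : ℂ := ∑ x, p x * ch (ξ * x)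

lemma planch (p : ZMod Q → ℂ) : ∑ ξ, ‖ft p ξ‖ ^ 2 = Q * ∑ x, ‖p x‖ ^ 2 :=
  pars univ id (Function.injective_id.injOn) p

lemma sum_translate (a : ZMod Q) {E : Type*} [AddCommMonoid E] (F : ZMod Q → E) :
    ∑ x, F (x + a) = ∑ x, F x := Equiv.sum_comp (Equiv.addRight a) F

lemma ft_conv {ι : Type*} (A : Finset ι) (τ : ι → ZMod Q) (k : ι → ℂ) (p : ZMod Q → ℂ) (ξ : ZMod Q) :
    ft (fun z => ∑ a ∈ A, k a * p (z + τ a)) ξ = ft p ξ * ∑ a ∈ A, k a * ch (ξ * (-τ a)) := by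
  unfold ft
  rw [mul_sum]
  simp_rw [sum_mul]
  rw [sum_comm]
  refine sc fun a _ => ?_
  rw [← sum_translate (-τ a)]
  refine sc fun x _ => ?_
  rw [mul_add, ch_add, neg_add_cancel_right]; ring

lemma conv_planch {ι : Type*} (A : Finset ι) (τ : ι → ZMod Q) (k : ι → ℂ) (p : ZMod Q → ℂ) :
    §Q * ∑ z, ‖∑ a ∈ A, k a * p (z + τ a)‖ ^ 2
      = ∑ ξ, ‖ft p ξ‖ ^ 2 * ‖∑ a ∈ A, k a * ch (ξ * (-τ a))‖ ^ 2 := by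
  rw [← planch]
  refine sc fun ξ _ => ?_
  rw [ft_conv, norm_mul, mul_pow]

lemma klem {ι : Type*} (A : Finset ι) (τ : ι → ZMod Q) (hτ : Set.InjOn τ A) (k : ι → ℂ)
    (hk : ∀ a, ‖k a‖ ≤ 1) (p : ZMod Q → ℂ) (M : ℝ) (hM : ∀ ξ, ‖ft p ξ‖ ≤ M) :
    ∑ z, ‖∑ a ∈ A, k a * p (z + τ a)‖ ^ 2 ≤ #A * M ^ 2 := by
  have hQ : 0 < §Q := mod_cast NeZero.pos Q
  refine le_of_mul_le_mul_left ?_ hQ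
  rw [conv_planch]
  calc ∑ ξ, ‖ft p ξ‖ ^ 2 * ‖∑ a ∈ A, k a * ch (ξ * (-τ a))‖ ^ 2
      ≤ ∑ ξ, M ^ 2 * ‖∑ a ∈ A, k a * ch (ξ * (-τ a))‖ ^ 2 := by
        gcongr with ξ; exact hM ξ
    _ = M ^ 2 * (Q * ∑ a ∈ A, ‖k a‖ ^ 2) := by
        rw [← mul_sum, pars A (fun a => -τ a)]
        intro a ha b hb h
        exact hτ ha hb (neg_injective h)
    _ ≤ M ^ 2 * (Q * (#A * 1)) := by
        gcongr
        refine (sum_le_card_nsmul A _ 1 fun a _ => ?_).trans (by simp)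
        exact pow_le_one₀ (norm_nonneg _) (hk a)
    _ = _ := by ring
end

lemma cast_injOn {Q : ℕ} [NeZero Q] (T : ℕ) (h : T ≤ Q) :
    Set.InjOn (fun i : ℕ => (i : ZMod Q)) (range T : Finset ℕ) := by
  intro a ha b hb hab
  simp only [coe_range, Set.mem_Iio] at ha hb
  have := (ZMod.natCast_eq_natCast_iff' a b Q).mp hab
  rwa [Nat.mod_eq_of_lt (by omega), Nat.mod_eq_of_lt (by omega)] at this

lemma pars_range (T : ℕ) (Q : ℕ) [NeZero Q] (h : T ≤ Q) (k : ℕ → ℂ) (hk : ∀ i, ‖k i‖ ≤ 1) :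
    ∑ ξ : ZMod Q, ‖∑ a ∈ range T, k a * ch (ξ * (a : ZMod Q))‖ ^ 2 ≤ Q * T := by
  rw [pars (range T) (fun i : ℕ => (i : ZMod Q)) (cast_injOn T h)]
  gcongr
  refine (sum_le_card_nsmul _ _ 1 fun a _ => ?_).trans (by simp)
  exact pow_le_one₀ (norm_nonneg _) (hk a)

lemma wlem {ζ : Type*} (Z : Finset ζ) (T : ℕ) (φ u : ζ → ℕ → ℂ) (v : ℕ → ℂ)
    (hu : ∀ z i, ‖u z i‖ ≤ 1) (hv : ∀ i, ‖v i‖ ≤ 1) :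
    ∃ κ : ℝ, ‖∑ z ∈ Z, ∑ i ∈ range T, ∑ j ∈ range T, φ z (i + j) * u z i * v j‖ ^ 2
      ≤ #Z * T ^ 2 * ∑ z ∈ Z, ‖∑ t ∈ range (2 * T), φ z t * e (κ * t)‖ ^ 2 := by
  rcases Nat.eq_zero_or_pos T with rfl | hT
  · exact ⟨0, by simp⟩
  have : NeZero (2 * T) := ⟨by omega⟩
  set q := 2 * T with hq
  set Φ : ZMod q → ζ → ℂ := fun k z => ∑ t ∈ range q, φ z t * ch (k * (t : ZMod q)) with hΦ
  obtain ⟨k0, hk0⟩ := Finite.exists_max (fun k => ∑ z ∈ Z, ‖Φ k z‖ ^ 2)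
  refine ⟨(k0.val : ℝ) / q, ?_⟩
  have hΦe : ∀ z, ∑ t ∈ range q, φ z t * e ((k0.val : ℝ) / q * t) = Φ k0 z := by
    intro z
    refine sc fun t _ => ?_
    have := ch_e_val k0 (t : ℤ)
    push_cast at this
    rw [this]
  simp_rw [hΦe]
  set M := ∑ z ∈ Z, ‖Φ k0 z‖ ^ 2 with hM
  have hinv : ∀ z, ∀ n < q, (q : ℂ) * φ z n = ∑ k : ZMod q, Φ k z * ch (-(k * (n : ZMod q))) := by
    intro z n hn
    simp only [hΦ]
    simp_rw [sum_mul]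
    rw [sum_comm, sum_eq_single_of_mem n (by simpa using hn)]
    · have : ∀ k : ZMod q, φ z n * ch (k * (n : ZMod q)) * ch (-(k * (n : ZMod q))) = φ z n := by
        intro k; rw [mul_assoc, ← ch_add]; simp
      simp_rw [this]; simp [ZMod.card]
    · intro t ht htn
      have : ∀ k : ZMod q, φ z t * ch (k * (t : ZMod q)) * ch (-(k * (n : ZMod q))) = φ z t * ch (k * ((t : ZMod q) - (n : ZMod q))) := by
        intro k; rw [mul_assoc, ← ch_add]; congr 2; ring
      simp_rw [this]
      rw [← mul_sum, ch_sum, if_neg, mul_zero]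
      intro h
      refine htn (cast_injOn (Q := q) q le_rfl ht (by simpa using hn) (sub_eq_zero.mp h))
  set U : ZMod q → ζ → ℂ := fun k z => ∑ i ∈ range T, u z i * ch (-k * (i : ZMod q)) with hU
  set V : ZMod q → ℂ := fun k => ∑ i ∈ range T, v i * ch (-k * (i : ZMod q)) with hV
  have hneg : ∀ F : ZMod q → ℝ, ∑ k, F (-k) = ∑ k, F k := fun F => Equiv.sum_comp (Equiv.neg _) F
  have hVs : ∑ k, ‖V k‖ ^ 2 ≤ q * T := by
    rw [hneg (fun k => ‖∑ i ∈ range T, v i * ch (k * (i : ZMod q))‖ ^ 2)]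
    exact pars_range T q (by omega) v hv
  have hUs : ∀ z, ∑ k, ‖U k z‖ ^ 2 ≤ q * T := by
    intro z
    rw [hneg (fun k => ‖∑ i ∈ range T, u z i * ch (k * (i : ZMod q))‖ ^ 2)]
    exact pars_range T q (by omega) (u z) (hu z)
  have hid : (q : ℂ) * ∑ z ∈ Z, ∑ i ∈ range T, ∑ j ∈ range T, φ z (i + j) * u z i * v j
      = ∑ p ∈ univ ×ˢ Z, (V p.1 * Φ p.1 p.2) * U p.1 p.2 := by
    rw [sum_product_right, mul_sum]
    refine sc fun z _ => ?_
    have : ∀ k : ZMod q, V k * Φ k z * U k z = ∑ i ∈ range T, ∑ j ∈ range T,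
        (Φ k z * ch (-(k * ((i + j : ℕ) : ZMod q)))) * (u z i * v j) := by
      intro k
      rw [mul_comm (V k), mul_assoc, mul_comm (V k)]
      simp only [hU, hV]
      rw [sum_mul_sum, mul_sum]
      refine sc fun i _ => ?_
      rw [mul_sum]
      refine sc fun j _ => ?_
      have : -(k * ((i + j : ℕ) : ZMod q)) = -k * i + -k * j := by push_cast; ring
      rw [this, ch_add]; ring
    simp_rw [this]
    symm
    rw [sum_comm, mul_sum]
    refine sc fun i hi => ?_
    rw [sum_comm, mul_sum]
    refine sc fun j hj => ?_
    simp only [mem_range] at hi hj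
    rw [← sum_mul, ← hinv z (i + j) (by omega)]; ring
  have hcs := cs_mul (univ ×ˢ Z) (fun p : ZMod q × ζ => V p.1 * Φ p.1 p.2) (fun p => U p.1 p.2)
  rw [← hid, norm_mul, Complex.norm_natCast, mul_pow] at hcs
  have hM0 : 0 ≤ M := by positivity
  have h1 : ∑ p ∈ univ ×ˢ Z, ‖V p.1 * Φ p.1 p.2‖ ^ 2 ≤ q * T * M := by
    rw [sum_product]
    simp_rw [norm_mul, mul_pow, ← mul_sum]
    calc ∑ k, ‖V k‖ ^ 2 * ∑ z ∈ Z, ‖Φ k z‖ ^ 2 ≤ ∑ k, ‖V k‖ ^ 2 * M := by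
          gcongr with k; exact hk0 k
      _ ≤ _ := by rw [← sum_mul]; gcongr
  have h2 : ∑ p ∈ univ ×ˢ Z, ‖U p.1 p.2‖ ^ 2 ≤ #Z * (q * T) := by
    rw [sum_product, sum_comm]
    refine (sum_le_card_nsmul Z _ _ fun z _ => hUs z).trans (by simp)
  have hq0 : 0 < §q ^ 2 := by positivity
  refine le_of_mul_le_mul_left (hcs.trans ((mul_le_mul h1 h2 (by positivity) (by positivity)).trans (le_of_eq (by ring)))) hq0

lemma wlem1 (T : ℕ) (φ u v : ℕ → ℂ)
    (hu : ∀ i, ‖u i‖ ≤ 1) (hv : ∀ i, ‖v i‖ ≤ 1) :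
    ∃ κ : ℝ, ‖∑ i ∈ range T, ∑ j ∈ range T, φ (i + j) * u i * v j‖
      ≤ T * ‖∑ t ∈ range (2 * T), φ t * e (κ * t)‖ := by
  obtain ⟨κ, h⟩ := wlem (univ : Finset Unit) T (fun _ => φ) (fun _ => u) v (fun _ => hu) hv
  refine ⟨κ, ?_⟩
  simp only [univ_unique, sum_const, card_singleton, one_smul, Nat.cast_one, one_mul, ← mul_pow] at h
  exact (pow_le_pow_iff_left₀ (norm_nonneg _) (by positivity) two_ne_zero).mp h

section
variable {Q : ℕ} [NeZero Q]

lemma Qpos : 0 < §Q := mod_cast NeZero.pos Q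

lemma vw (f g : ZMod Q → ℂ) (hg : Bd g) (T : ℕ) (hT : 0 < T) (D : ZMod Q) (η : ℝ)
    (hη : 0 ≤ η) (h : η * Q * T ≤ ∑ s ∈ range T, ‖∑ z, g z * f (z + D * s)‖) :
    ∃ κ : ℝ, η ^ 2 * Q * T ^ 2 ≤ ∑ z, ‖∑ t ∈ range (2 * T), f (z + D * t) * e (κ * t)‖ ^ 2 := by
  set v : ℕ → ℂ := fun s => ph (∑ z, g z * f (z + D * s)) with hv
  obtain ⟨κ, hκ⟩ := wlem (univ : Finset (ZMod Q)) T (fun z n => f (z + D * n))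
    (fun z i => g (z + D * i)) v (fun z i => hg _) (fun i => (ph_norm _).le)
  refine ⟨κ, ?_⟩
  rw [← sum_norm_eq] at h
  have hid : ∑ z : ZMod Q, ∑ i ∈ range T, ∑ j ∈ range T, f (z + D * ¶(i + j)) * g (z + D * ¶i) * v j
     = T * ∑ s ∈ range T, v s * ∑ z, g z * f (z + D * s) := by
    rw [sum_comm]
    have : ∀ i ∈ range T, ∑ z : ZMod Q, ∑ j ∈ range T, f (z + D * ¶(i + j)) * g (z + D * ¶i) * v j
      = ∑ s ∈ range T, v s * ∑ z, g z * f (z + D * s) := by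
      intro i _
      rw [sum_comm]
      refine sc fun j _ => ?_
      rw [← sum_translate (D * ¶i) (fun z => g z * f (z + D * j)), mul_sum]
      refine sc fun z _ => ?_
      rw [show z + D * ((i + j : ℕ) : ZMod Q) = z + D * i + D * j by push_cast; ring]; ring
    rw [sum_congr rfl this]; simp
  rw [hid, norm_mul, Complex.norm_natCast] at hκ
  have hT' : 0 < §T := mod_cast hT
  have h1 : (§T * (η * Q * T)) ^ 2 ≤ (T * ‖∑ s ∈ range T, v s * ∑ z, g z * f (z + D * s)‖) ^ 2 := by
    gcongr
  have h2 := h1.trans hκ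
  simp only [card_univ, ZMod.card] at h2
  have hp : 0 < §Q * T ^ 2 := mul_pos Qpos (by positivity)
  refine le_of_mul_le_mul_left (le_trans (le_of_eq (by ring)) h2) hp

end
end

section
lemma cube {α : Type*} (X : Finset α) (hX : X.Nonempty) (T : ℕ) (hT : 0 < T)
    (A B C : α → ℕ → ℕ → ℂ) (φ : α → ℕ → ℂ)
    (hA : ∀ x i j, ‖A x i j‖ ≤ 1) (hB : ∀ x i j, ‖B x i j‖ ≤ 1) (hC : ∀ x i j, ‖C x i j‖ ≤ 1)
    (θ : ℝ) (hθ : 0 ≤ θ)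
    (h : θ * #X * T ^ 3 ≤ ‖∑ x ∈ X, ∑ t2 ∈ range T, ∑ t3 ∈ range T, ∑ t1 ∈ range T,
      A x t2 t3 * (B x t1 t3 * C x t1 t2 * φ x (t1 + t2 + t3))‖) :
    ∃ κ : α → ℕ → ℕ → ℝ, θ ^ 2 * #X * T ^ 3 ≤ ∑ t1 ∈ range T, ∑ x ∈ X, ∑ s ∈ range T,
      ‖∑ t ∈ range (2 * T), φ x (t1 + t) * conj (φ x (s + t)) * e (κ x t1 s * t)‖ := by
  have hw : ∀ x t1 s, ∃ κ : ℝ, ‖∑ i ∈ range T, ∑ j ∈ range T,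
      (φ x (t1 + (i + j)) * conj (φ x (s + (i + j)))) * (C x t1 i * conj (C x s i)) * (B x t1 j * conj (B x s j))‖
      ≤ T * ‖∑ t ∈ range (2 * T), φ x (t1 + t) * conj (φ x (s + t)) * e (κ * t)‖ := by
    intro x t1 s
    exact wlem1 T (fun n => φ x (t1 + n) * conj (φ x (s + n))) _ _
      (fun i => bmul (hC _ _ _) (bconj (hC _ _ _))) (fun i => bmul (hB _ _ _) (bconj (hB _ _ _)))
  choose κ hκ using hw
  refine ⟨κ, ?_⟩
  set P : Finset (α × ℕ × ℕ) := X ×ˢ range T ×ˢ range T with hP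
  have hPc : (#P : ℝ) = #X * T ^ 2 := by
    rw [hP, card_product, card_product, card_range]; push_cast; ring
  set F : α × ℕ × ℕ → ℕ → ℂ := fun p t1 =>
    B p.1 t1 p.2.2 * C p.1 t1 p.2.1 * φ p.1 (t1 + p.2.1 + p.2.2) with hF
  have h1 : ∑ x ∈ X, ∑ t2 ∈ range T, ∑ t3 ∈ range T, ∑ t1 ∈ range T,
      A x t2 t3 * (B x t1 t3 * C x t1 t2 * φ x (t1 + t2 + t3))
      = ∑ p ∈ P, A p.1 p.2.1 p.2.2 * ∑ t1 ∈ range T, F p t1 := by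
    rw [hP, sum_product]
    refine sc fun x _ => ?_
    rw [sum_product]
    refine sc fun t2 _ => sc fun t3 _ => ?_
    rw [mul_sum]
  rw [h1] at h
  have h2 := cs_bdd P (fun p => A p.1 p.2.1 p.2.2) (fun p => ∑ t1 ∈ range T, F p t1) (fun p _ => hA _ _ _)
  have h3 := sumsq_le P (range T) F
  have h4 : ∀ t1 s, ‖∑ p ∈ P, F p t1 * conj (F p s)‖ ≤
      T * ∑ x ∈ X, ‖∑ t ∈ range (2 * T), φ x (t1 + t) * conj (φ x (s + t)) * e (κ x t1 s * t)‖ := by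
    intro t1 s
    rw [hP, sum_product, mul_sum]
    refine (norm_sum_le _ _).trans (sum_le_sum fun x _ => ?_)
    refine le_trans (le_of_eq ?_) (hκ x t1 s)
    rw [sum_product]
    congr 1
    refine sc fun t2 _ => sc fun t3 _ => ?_
    simp only [hF, map_mul, add_assoc]; ring
  have h5 : ∑ i ∈ range T, ∑ j ∈ range T, ‖∑ p ∈ P, F p i * conj (F p j)‖ ≤
     T * ∑ t1 ∈ range T, ∑ x ∈ X, ∑ s ∈ range T,
      ‖∑ t ∈ range (2 * T), φ x (t1 + t) * conj (φ x (s + t)) * e (κ x t1 s * t)‖ := by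
    rw [mul_sum]
    refine sum_le_sum fun t1 _ => ?_
    rw [sum_comm (s := X), mul_sum]
    exact sum_le_sum fun s _ => h4 t1 s
  have hX' : (0 : ℝ) < #X := mod_cast hX.card_pos
  have hT' : 0 < §T := mod_cast hT
  have h6 : (θ * #X * T ^ 3) ^ 2 ≤ ‖∑ p ∈ P, A p.1 p.2.1 p.2.2 * ∑ t1 ∈ range T, F p t1‖ ^ 2 := by
    gcongr
  rw [hPc] at h2
  have h7 := h6.trans (h2.trans (mul_le_mul_of_nonneg_left (h3.trans h5) (by positivity)))
  have hp : (0 : ℝ) < #X * T ^ 3 := by positivity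
  refine le_of_mul_le_mul_left (le_trans (le_of_eq (by ring)) (h7.trans (le_of_eq (by ring)))) hp

section
variable {Q : ℕ} [NeZero Q]

lemma cardZ : (#(univ : Finset (ZMod Q)) : ℝ) = Q := by simp [ZMod.card]

lemma l4 (F0 F1 F2 F3 : ZMod Q → ℂ) (h0 : Bd F0) (h1 : Bd F1)
    (h2 : Bd F2) (h3 : Bd F3) (κ1 κ2 κ3 ρ1 ρ2 ρ3 σ : ℤ)
    (e1 : κ3 * ρ1 = σ) (e2 : (κ3 - κ1) * ρ2 = σ) (e3 : (κ3 - κ2) * ρ3 = σ) (R T : ℕ) (hR : 0 < R) (hT : 0 < T)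
    (η : ℝ) (hη : 0 ≤ η) (hTR : 4 * (T * (|ρ1| + |ρ2| + |ρ3| : ℝ)) ≤ η * R)
    (h : η * Q * R ≤ ‖∑ x : ZMod Q, ∑ r ∈ range R, F0 x * F1 (x + κ1 * (r : ℤ)) * F2 (x + κ2 * (r : ℤ)) * F3 (x + κ3 * (r : ℤ))‖) :
    ∃ (d : ZMod Q) (κ : ZMod Q → ℕ → ℝ), η ^ 2 / 4 * Q * T ^ 2 ≤ ∑ x : ZMod Q, ∑ s ∈ range T,
      ‖∑ t ∈ range (2 * T), F3 (x + σ * t) * conj (F3 (x + d + σ * (s + t))) * e (κ x s * t)‖ := by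
  set W : ZMod Q → ℤ → ℂ := fun x r => F0 x * F1 (x + κ1 * r) * F2 (x + κ2 * r) * F3 (x + κ3 * r) with hW
  have hWb : ∀ x r, ‖W x r‖ ≤ 1 := fun x r => bmul (bmul (bmul (h0 _) (h1 _)) (h2 _)) (h3 _)
  set g : ℕ → ZMod Q → ℕ → ℕ → ℕ → ℂ := fun r x t2 t3 t1 =>
    W (x - κ1 * ρ2 * t2 - κ2 * ρ3 * t3) (r + (ρ1 * t1 + ρ2 * t2 + ρ3 * t3)) with hg
  have hQ : 0 < §Q := Qpos
  have hS : ∀ t2 ∈ range T, ∀ t3 ∈ range T, ∀ t1 ∈ range T,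
      ‖∑ x, ∑ r ∈ range R, g r x t2 t3 t1 - ∑ x, ∑ r ∈ range R, W x r‖ ≤ η / 2 * Q * R := by
    intro t2 ht2 t3 ht3 t1 ht1
    simp only [mem_range] at ht1 ht2 ht3
    have hb : |((ρ1 * t1 + ρ2 * t2 + ρ3 * t3 : ℤ) : ℝ)| ≤ T * (|ρ1| + |ρ2| + |ρ3| : ℝ) := by
      push_cast
      have a1 : (t1 : ℝ) ≤ T := mod_cast ht1.le
      have a2 : (t2 : ℝ) ≤ T := mod_cast ht2.le
      have a3 : (t3 : ℝ) ≤ T := mod_cast ht3.le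
      calc |(ρ1 * t1 + ρ2 * t2 + ρ3 * t3 : ℝ)| ≤ |(ρ1 * t1 : ℝ)| + |(ρ2 * t2 : ℝ)| + |(ρ3 * t3 : ℝ)| := abs_add_three _ _ _
        _ = |(ρ1 : ℝ)| * t1 + |(ρ2 : ℝ)| * t2 + |(ρ3 : ℝ)| * t3 := by
          simp only [abs_mul, Nat.abs_cast]
        _ ≤ |(ρ1 : ℝ)| * T + |(ρ2 : ℝ)| * T + |(ρ3 : ℝ)| * T := by gcongr
        _ = _ := by ring
    have : ∑ x, ∑ r ∈ range R, g r x t2 t3 t1 = ∑ x, ∑ r ∈ range R, W x ((r : ℤ) + (ρ1 * (t1 : ℤ) + ρ2 * (t2 : ℤ) + ρ3 * (t3 : ℤ))) := by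
      rw [← sum_translate (-((κ1 : ZMod Q) * (ρ2 : ZMod Q) * (t2 : ZMod Q)) - (κ2 : ZMod Q) * (ρ3 : ZMod Q) * (t3 : ZMod Q))
        (fun x => ∑ r ∈ range R, W x ((r : ℤ) + (ρ1 * (t1 : ℤ) + ρ2 * (t2 : ℤ) + ρ3 * (t3 : ℤ))))]
      refine sc fun x _ => sc fun r _ => ?_
      simp only [hg]; congr 1; ring
    rw [this, ← sum_sub_distrib]
    have := norm_sum_le_card (univ : Finset (ZMod Q)) (fun x => ∑ r ∈ range R, W x ((r : ℤ) + (ρ1 * (t1 : ℤ) + ρ2 * (t2 : ℤ) + ρ3 * (t3 : ℤ))) - ∑ r ∈ range R, W x r)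
      (η / 2 * R) (fun x _ => by
        refine (shift_bd (W x) (hWb x) R _).trans ?_
        linarith)
    rw [cardZ] at this
    linarith
  have hS2 : η / 2 * Q * R * T ^ 3 ≤ ‖∑ t2 ∈ range T, ∑ t3 ∈ range T, ∑ t1 ∈ range T, ∑ x, ∑ r ∈ range R, g r x t2 t3 t1‖ := by
    have hb := norm_sum_le_card (range T) (fun t2 => ∑ t3 ∈ range T, ∑ t1 ∈ range T, (∑ x, ∑ r ∈ range R, g r x t2 t3 t1 - ∑ x, ∑ r ∈ range R, W x r))
      (T * (T * (η / 2 * Q * R))) (fun t2 ht2 => by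
        have := norm_sum_le_card (range T) (fun t3 => ∑ t1 ∈ range T, (∑ x, ∑ r ∈ range R, g r x t2 t3 t1 - ∑ x, ∑ r ∈ range R, W x r))
          (T * (η / 2 * Q * R)) (fun t3 ht3 => by
            have := norm_sum_le_card (range T) (fun t1 => (∑ x, ∑ r ∈ range R, g r x t2 t3 t1 - ∑ x, ∑ r ∈ range R, W x r))
              (η / 2 * Q * R) (hS t2 ht2 t3 ht3)
            simpa using this)
        simpa using this)
    simp only [sum_sub_distrib, sum_const, card_range, nsmul_eq_mul] at hb
    have h5 := norm_sub_norm_le ((T : ℂ) * (T * (T * ∑ x, ∑ r ∈ range R, W x r))) (∑ t2 ∈ range T, ∑ t3 ∈ range T, ∑ t1 ∈ range T, ∑ x, ∑ r ∈ range R, g r x t2 t3 t1)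
    rw [norm_sub_rev] at h5
    simp only [norm_mul, Complex.norm_natCast] at h5
    have h6 : §T * (T * (T * (η * Q * R))) ≤ T * (T * (T * ‖∑ x, ∑ r ∈ range R, W x r‖)) := by
      gcongr
    linarith
  have hsw : ∑ t2 ∈ range T, ∑ t3 ∈ range T, ∑ t1 ∈ range T, ∑ x, ∑ r ∈ range R, g r x t2 t3 t1
     = ∑ r ∈ range R, ∑ x, ∑ t2 ∈ range T, ∑ t3 ∈ range T, ∑ t1 ∈ range T, g r x t2 t3 t1 := by
    have c1 : ∀ t2 t3, ∑ t1 ∈ range T, ∑ x, ∑ r ∈ range R, g r x t2 t3 t1 = ∑ r ∈ range R, ∑ x, ∑ t1 ∈ range T, g r x t2 t3 t1 := by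
      intro t2 t3
      rw [sum_comm]
      rw [sum_comm (s := range R)]
      refine sc fun x _ => sum_comm
    simp_rw [c1]
    have c2 : ∀ t2, ∑ t3 ∈ range T, ∑ r ∈ range R, ∑ x, ∑ t1 ∈ range T, g r x t2 t3 t1 = ∑ r ∈ range R, ∑ x, ∑ t3 ∈ range T, ∑ t1 ∈ range T, g r x t2 t3 t1 := by
      intro t2
      rw [sum_comm]
      refine sc fun x _ => sum_comm
    simp_rw [c2]
    rw [sum_comm]
    refine sc fun x _ => sum_comm
  rw [hsw] at hS2
  obtain ⟨r, -, hr⟩ := pigeonR hR (fun r => ‖∑ x, ∑ t2 ∈ range T, ∑ t3 ∈ range T, ∑ t1 ∈ range T, g r x t2 t3 t1‖)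
    (η / 2 * Q * T ^ 3) (le_trans (le_of_eq (by ring)) (hS2.trans (norm_sum_le _ _)))
  have hgform : ∀ x t2 t3 t1, g r x t2 t3 t1 = F0 (x - κ1 * ρ2 * t2 - κ2 * ρ3 * t3) *
      (F1 (x + κ1 * r + κ1 * ρ1 * t1 + κ1 * ρ3 * t3 - κ2 * ρ3 * t3) *
       F2 (x + κ2 * r + κ2 * ρ1 * t1 + κ2 * ρ2 * t2 - κ1 * ρ2 * t2) *
       F3 (x + κ3 * r + σ * ((t1 + t2 + t3 : ℕ) : ZMod Q))) := by
    intro x t2 t3 t1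
    have e1' := congrArg (Int.cast : ℤ → ZMod Q) e1
    have e2' := congrArg (Int.cast : ℤ → ZMod Q) e2
    have e3' := congrArg (Int.cast : ℤ → ZMod Q) e3
    push_cast at e1' e2' e3'
    simp only [hg, hW]
    rw [mul_assoc, mul_assoc, ← mul_assoc (F1 _)]
    congr 1
    congr 1
    · congr 1
      · congr 1; push_cast; ring
      · congr 1; push_cast; ring
    · congr 1; push_cast
      linear_combination e1' * (t1 : ZMod Q) + e2' * (t2 : ZMod Q) + e3' * (t3 : ZMod Q)
  simp_rw [hgform] at hr
  obtain ⟨κ, hκ⟩ := cube (univ : Finset (ZMod Q)) ⟨0, by simp⟩ T hT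
    (fun x t2 t3 => F0 (x - κ1 * ρ2 * t2 - κ2 * ρ3 * t3))
    (fun x t1 t3 => F1 (x + κ1 * r + κ1 * ρ1 * t1 + κ1 * ρ3 * t3 - κ2 * ρ3 * t3))
    (fun x t1 t2 => F2 (x + κ2 * r + κ2 * ρ1 * t1 + κ2 * ρ2 * t2 - κ1 * ρ2 * t2))
    (fun x n => F3 (x + κ3 * r + σ * n)) (fun _ _ _ => h0 _) (fun _ _ _ => h1 _) (fun _ _ _ => h2 _)
    (η / 2) (by positivity) (by rw [cardZ]; exact hr)
  rw [cardZ] at hκ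
  obtain ⟨t1, -, ht1⟩ := pigeonR hT _ (η ^ 2 / 4 * Q * T ^ 2) (le_trans (le_of_eq (by ring)) hκ)
  refine ⟨-(σ * t1), fun x s => κ (x - κ3 * r - σ * t1) t1 s, ht1.trans (le_of_eq ?_)⟩
  symm
  rw [← sum_translate (κ3 * r + σ * t1 : ZMod Q)]
  refine sc fun x _ => sc fun s _ => ?_
  congr 1
  refine sc fun t _ => ?_
  dsimp only
  have a1 : x + κ3 * r + σ * ((t1 + t : ℕ) : ZMod Q) = x + (κ3 * r + σ * t1) + σ * t := by push_cast; ring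
  have a2 : x + κ3 * r + σ * ((s + t : ℕ) : ZMod Q) = x + (κ3 * r + σ * t1) + -(σ * t1) + σ * (s + t) := by push_cast; ring
  have a3 : x + (κ3 * r + σ * t1) - κ3 * r - σ * t1 = x := by ring
  rw [a1, a2, a3]

end
end

lemma powc {δ : ℝ} (hδ : 0 < δ) (h2 : δ ≤ 1 / 2) {c : ℝ} (k : ℕ) {n m : ℕ} (hc : c ≤ 2 ^ k)
    (hnm : m + k ≤ n) : c * δ ^ n ≤ δ ^ m := by
  obtain ⟨d, rfl⟩ := Nat.exists_eq_add_of_le hnm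
  rw [pow_add, pow_add]
  have h3 : δ ^ d ≤ 1 := pow_le_one₀ hδ.le (by linarith)
  have h4 : 2 ^ k * δ ^ k ≤ 1 := by
    rw [← mul_pow]; exact pow_le_one₀ (by positivity) (by linarith)
  have h5 : c * δ ^ k ≤ 1 := le_trans (by gcongr) h4
  calc c * (δ ^ m * δ ^ k * δ ^ d) = (c * δ ^ k) * δ ^ d * δ ^ m := by ring
    _ ≤ 1 * 1 * δ ^ m := by
      gcongr
    _ = _ := by ring

lemma pown {δ : ℝ} (hδ : 0 < δ) (h2 : δ ≤ 1 / 2) {n m : ℕ} (hnm : m ≤ n) : δ ^ n ≤ δ ^ m :=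
  pow_le_pow_of_le_one hδ.le (by linarith) hnm

lemma exR {δ : ℝ} (hδ : 0 < δ) (h2 : δ ≤ 1 / 2) (a : ℕ) (K : ℝ) (h : 1 ≤ δ ^ (a + 1) * K) :
    ∃ R : ℕ, 0 < R ∧ δ ^ (a + 1) * K ≤ R ∧ R ≤ δ ^ a * K := by
  refine ⟨⌈δ ^ (a + 1) * K⌉₊, Nat.ceil_pos.mpr (by linarith), Nat.le_ceil _, ?_⟩
  refine (Nat.ceil_lt_add_one (by linarith)).le.trans ?_
  have hK : 0 < K := by
    by_contra hK
    have : δ ^ (a + 1) * K ≤ 0 := mul_nonpos_of_nonneg_of_nonpos (by positivity) (not_lt.mp hK)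
    linarith
  calc δ ^ (a + 1) * K + 1 ≤ (δ ^ a * K) * (2 * δ) := by
        rw [pow_succ] at *; nlinarith
    _ ≤ (δ ^ a * K) * 1 := by gcongr; linarith
    _ = _ := by ring

/-- averaging a window over an arithmetic progression -/
lemma avg_shift (G : ℤ → ℂ) (hG : ∀ r, ‖G r‖ ≤ 1) (R q J : ℕ) :
    §J * ‖∑ r ∈ range R, G r‖ ≤
      ∑ r ∈ range R, ‖∑ j ∈ range J, G (r + (q * j : ℕ))‖ + 2 * (q * J) * J := by
  have hj : ∀ j ∈ range J, ‖∑ r ∈ range R, G r - ∑ r ∈ range R, G (r + (q * j : ℕ))‖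
      ≤ 2 * (q * J) := by
    intro j hj
    rw [norm_sub_rev]
    refine (shift_bd G hG R (q * j : ℕ)).trans ?_
    simp only [mem_range] at hj
    have : §j ≤ J := mod_cast hj.le
    push_cast
    rw [abs_of_nonneg (by positivity)]
    gcongr
  have h2 := norm_sum_le_card (range J) _ _ hj
  rw [sum_sub_distrib] at h2
  simp only [sum_const, card_range, nsmul_eq_mul] at h2
  have h3 := norm_sub_norm_le ((J : ℂ) * ∑ r ∈ range R, G r)
    (∑ j ∈ range J, ∑ r ∈ range R, G (r + (q * j : ℕ)))
  rw [norm_mul, Complex.norm_natCast] at h3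
  have h4 : ‖∑ j ∈ range J, ∑ r ∈ range R, G (r + (q * j : ℕ))‖ ≤
     ∑ r ∈ range R, ‖∑ j ∈ range J, G (r + (q * j : ℕ))‖ := by
    rw [sum_comm]; exact norm_sum_le _ _
  linarith

/-- some subwindow is large -/
lemma subwin {ι : Type*} (X : Finset ι) (G : ι → ℤ → ℂ) (hG : ∀ x r, ‖G x r‖ ≤ 1) (R q J : ℕ)
    (hR : 0 < R) (η : ℝ) (h4 : 4 * (q * J) ≤ η * R)
    (h : η * #X * R ≤ ∑ x ∈ X, ‖∑ r ∈ range R, G x r‖) :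
    ∃ r0 < R, η / 2 * #X * J ≤ ∑ x ∈ X, ‖∑ j ∈ range J, G x (r0 + (q * j : ℕ))‖ := by
  apply pigeonR hR (fun r0 : ℕ => ∑ x ∈ X, ‖∑ j ∈ range J, G x (r0 + (q * j : ℕ))‖)
  rw [sum_comm]
  have h1 := sum_le_sum (fun x (_ : x ∈ X) => avg_shift (G x) (hG x) R q J)
  rw [← mul_sum, sum_add_distrib] at h1
  simp only [sum_const, nsmul_eq_mul] at h1
  have h2 : §J * (η * #X * R) ≤ J * ∑ x ∈ X, ‖∑ r ∈ range R, G x r‖ := by gcongr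
  have h3 : (#X : ℝ) * (2 * (q * J) * J) ≤ #X * (η * R / 2 * J) := by
    gcongr; linarith
  linarith

lemma geo (θ c : ℝ) (R : ℕ) (B : ℝ) (h : B ≤ ‖∑ r ∈ range R, e (θ * r + c)‖) :
    ∃ k : ℤ, 2 * B * |θ - k| ≤ 1 := by
  refine ⟨round θ, ?_⟩
  set t := θ - round θ with ht
  have h1 : |t| ≤ 1 / 2 := abs_sub_round θ
  have h2 : 4 * |t| ≤ ‖e θ - 1‖ := by
    have : e θ = e t := (e_sub_int θ (round θ)).symm
    rw [this]; unfold e; rw [mul_comm _ Complex.I, Complex.norm_exp_I_mul_ofReal_sub_one]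
    have h3 := Real.mul_abs_le_abs_sin (x := Real.pi * t) (by
      rw [abs_mul, abs_of_pos Real.pi_pos]; nlinarith [Real.pi_pos])
    rw [abs_mul, abs_of_pos Real.pi_pos] at h3
    rw [show 2 * Real.pi * t / 2 = Real.pi * t by ring, Real.norm_eq_abs, abs_mul]
    have : 2 / Real.pi * (Real.pi * |t|) = 2 * |t| := by field_simp
    rw [this] at h3
    rw [abs_of_pos (by norm_num : (0:ℝ) < 2)]; linarith
  have h3 : (e θ - 1) * ∑ r ∈ range R, e (θ * r + c) = e (θ * R + c) - e c := by
    rw [mul_sum]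
    have := sum_range_sub (fun r : ℕ => e (θ * r + c)) R
    simp only [Nat.cast_zero, mul_zero, zero_add] at this
    rw [← this]
    refine sc fun r _ => ?_
    rw [sub_mul, one_mul, ← e_add]; congr 2; push_cast; ring
  have h4 : ‖e θ - 1‖ * ‖∑ r ∈ range R, e (θ * r + c)‖ ≤ 2 := by
    rw [← norm_mul, h3]
    refine (norm_sub_le _ _).trans ?_
    rw [norm_e, norm_e]; norm_num
  rcases le_or_gt B 0 with hB | hB
  · have : 2 * B * |t| ≤ 0 := mul_nonpos_of_nonpos_of_nonneg (by linarith) (abs_nonneg _)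
    linarith
  · have : 4 * |t| * B ≤ ‖e θ - 1‖ * ‖∑ r ∈ range R, e (θ * r + c)‖ := by gcongr
    linarith

/-- recurrence lemma -/
lemma recl (S : Finset ℕ) (H : ℕ) (hS : ∀ j ∈ S, j < H) (η : ℝ) (hη : 0 < η) (hη1 : η ≤ 1 / 16)
    (hc : η * H ≤ #S) (β c ε : ℝ) (hε : 0 < ε) (hd : ∀ j ∈ S, ∃ n : ℤ, |β * j + c - n| ≤ ε)
    (hεH : 16 * ε * H ≤ 1) (hbig : 8 ≤ η ^ 2 * H) :
    ∃ q : ℕ, 0 < q ∧ η * q ≤ 2 ∧ ∃ k : ℤ, η * H * |q * β - k| ≤ 4 * ε * q := by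
  have hHr : 0 < §H := by
    rcases (Nat.cast_nonneg (α := ℝ) H).eq_or_lt with h | h
    · rw [← h] at hbig; norm_num at hbig
    · exact h
  have hH8 : 8 ≤ η * H := by nlinarith
  have hHn : 0 < H := mod_cast hHr
  set L := ⌊2 / η⌋₊ with hL
  have hL1 : §L ≤ 2 / η := Nat.floor_le (by positivity)
  have hL2 : 3 / 2 / η ≤ L := by
    have h1 := Nat.lt_floor_add_one (2 / η)
    have h2 : 16 ≤ 1 / η := by rw [le_div_iff₀ hη]; linarith
    have h3 : 2 / η = 2 * (1 / η) := by ring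
    have h4 : 3 / 2 / η = 3 / 2 * (1 / η) := by ring
    rw [← hL] at h1
    linarith
  have hLpos : 0 < L := by
    have : 0 < §L := lt_of_lt_of_le (by positivity) hL2
    exact_mod_cast this
  have hcard : #(range (H / L + 1)) < #S := by
    rw [card_range]
    have h1 : §(H / L) ≤ H / L := Nat.cast_div_le
    have h2 : §H / L ≤ 2 / 3 * (η * H) := by
      rw [div_le_iff₀ (mod_cast hLpos)]
      calc §H = 2 / 3 * (η * H) * (3 / 2 / η) := by field_simp
        _ ≤ _ := by gcongr
    have : §(H / L + 1) < #S := by push_cast; linarith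
    exact_mod_cast this
  obtain ⟨i1, hi1, i2, hi2, hne, hdiv⟩ := exists_ne_map_eq_of_card_lt_of_maps_to hcard
    (f := fun j => j / L) (fun j hj => by
      simp only [coe_range, Set.mem_Iio]
      exact Nat.lt_succ_of_le (Nat.div_le_div_right (hS j hj).le))
  have hpair : ∃ a b, a ∈ S ∧ b ∈ S ∧ a < b ∧ b - a < L := by
    have h1 := Nat.div_add_mod i1 L
    have h2 := Nat.div_add_mod i2 L
    have h3 := Nat.mod_lt i1 hLpos
    have h4 := Nat.mod_lt i2 hLpos
    rw [hdiv] at h1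
    rcases lt_or_gt_of_ne hne with h | h
    · exact ⟨i1, i2, hi1, hi2, h, by omega⟩
    · exact ⟨i2, i1, hi2, hi1, h, by omega⟩
  obtain ⟨a, b, ha, hb, hab, hbaL⟩ := hpair
  set q := b - a with hq
  have hq0 : 0 < q := by omega
  have hqr : §q = b - a := by rw [hq, Nat.cast_sub hab.le]
  have hηq : η * q ≤ 2 := by
    have : §q ≤ 2 / η := le_trans (mod_cast hbaL.le) hL1
    rw [le_div_iff₀ hη] at this; linarith
  obtain ⟨na, hna⟩ := hd a ha
  obtain ⟨nb, hnb⟩ := hd b hb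
  set κ := q * β - (nb - na : ℤ) with hκ
  have hκ2 : |κ| ≤ 2 * ε := by
    have : κ = (β * b + c - nb) - (β * a + c - na) := by
      rw [hκ, hqr]; push_cast; ring
    rw [this]; exact (abs_sub _ _).trans (by linarith)
  refine ⟨q, hq0, hηq, nb - na, ?_⟩
  rw [← hκ]
  have hq' : 0 < §q := mod_cast hq0
  obtain ⟨s, hs, hcs⟩ := exists_le_card_fiber_of_nsmul_le_card_of_maps_to (s := S) (t := range q)
    (f := fun j => j % q) (fun j _ => by simpa using Nat.mod_lt j hq0) (by simpa using hq0.ne')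
    (b := η * H / q) (by
      rw [card_range, nsmul_eq_mul]; refine le_trans (le_of_eq ?_) hc; field_simp)
  set S' := S.filter fun j => j % q = s with hS'
  have hbigS : 4 ≤ η * H / q := by
    rw [le_div_iff₀ hq']; nlinarith
  have hSne : S'.Nonempty := by
    rw [← card_pos]
    have : (0 : ℝ) < #S' := by linarith
    exact_mod_cast this
  set u := S'.min' hSne with hu
  set v := S'.max' hSne with hv
  have huS : u ∈ S' := min'_mem _ _
  have hvS : v ∈ S' := max'_mem _ _
  have huv : u ≤ v := min'_le _ _ hvS
  simp only [hS', mem_filter] at huS hvS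
  obtain ⟨m, hm⟩ : ∃ m, v = u + q * m := by
    have : q ∣ v - u := (Nat.modEq_iff_dvd' huv).mp (by rw [Nat.ModEq, huS.2, hvS.2])
    obtain ⟨m, hm⟩ := this
    exact ⟨m, by omega⟩
  have hcardS : #S' ≤ m + 1 := by
    have hsub : S' ⊆ (range (m + 1)).image (fun i => u + q * i) := by
      intro j hj
      have h1 : u ≤ j := min'_le _ _ hj
      have h2 : j ≤ v := le_max' _ _ hj
      simp only [hS', mem_filter] at hj
      have : q ∣ j - u := (Nat.modEq_iff_dvd' h1).mp (by rw [Nat.ModEq, huS.2, hj.2])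
      obtain ⟨i, hi⟩ := this
      simp only [mem_image, mem_range]
      refine ⟨i, ?_, by omega⟩
      have : q * i ≤ q * m := by omega
      have := Nat.le_of_mul_le_mul_left this hq0
      omega
    refine (card_le_card hsub).trans (card_image_le.trans (by simp))
  obtain ⟨nu, hnu⟩ := hd u huS.1
  obtain ⟨nv, hnv⟩ := hd v hvS.1
  have hmH : §m ≤ H := by
    have h1 : v < H := hS v hvS.1
    have : m ≤ q * m := Nat.le_mul_of_pos_left m hq0
    exact_mod_cast (by omega : m ≤ H)
  have hκm : |κ| * m ≤ 1 / 4 := by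
    calc |κ| * m ≤ 2 * ε * H := by gcongr
      _ ≤ 1 / 4 := by linarith
  have hvr : (v : ℝ) = u + q * m := by rw [hm]; push_cast; ring
  have hn : |κ * m - ((nv - nu - m * (nb - na) : ℤ) : ℝ)| ≤ 2 * ε := by
    have : κ * m - ((nv - nu - m * (nb - na) : ℤ) : ℝ) = (β * v + c - nv) - (β * u + c - nu) := by
      rw [hκ, hvr]; push_cast; ring
    rw [this]; exact (abs_sub _ _).trans (by linarith)
  have hε16 : 2 * ε ≤ 1 / 8 := by
    have : (1 : ℝ) ≤ H := mod_cast hHn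
    nlinarith
  have hn0 : (nv - nu - m * (nb - na) : ℤ) = 0 := by
    set z := (nv - nu - m * (nb - na) : ℤ)
    have h1 : |κ * m| ≤ 1 / 4 := by rw [abs_mul, Nat.abs_cast]; exact hκm
    have h2 : |(z : ℝ)| < 1 := by
      have := abs_sub_abs_le_abs_sub (z : ℝ) (κ * m)
      rw [abs_sub_comm] at this
      linarith
    have h3 : |z| < 1 := mod_cast h2
    exact Int.abs_lt_one_iff.mp h3
  rw [hn0, Int.cast_zero, sub_zero, abs_mul, Nat.abs_cast] at hn
  have hm2 : η * H / q / 2 ≤ m := by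
    have : (#S' : ℝ) ≤ m + 1 := mod_cast hcardS
    linarith
  have h5 : η * H / q / 2 * |κ| ≤ 2 * ε := by
    refine le_trans ?_ hn
    rw [mul_comm |κ|]; gcongr
  have h6 : η * H * |κ| = (η * H / q / 2 * |κ|) * (2 * q) := by field_simp
  rw [h6]
  calc _ ≤ (2 * ε) * (2 * q) := by gcongr
    _ = _ := by ring

/-- first half of Weyl: popular differences -/
lemma weyl1 (δ : ℝ) (hδ : 0 < δ) (R H : ℕ) (hR : 0 < R) (hH : 0 < H) (hRH : 8 * §H ≤ δ * R) (a b : ℝ)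
    (h : δ * R ≤ ‖∑ r ∈ range R, e (a * r + b * r ^ 2)‖) :
    ∃ (S : Finset ℕ) (c : ℝ), (∀ j ∈ S, j < H) ∧ δ ^ 2 / 4 * H ≤ #S ∧
      ∀ j ∈ S, ∃ n : ℤ, |2 * b * j + c - n| ≤ 2 / (δ ^ 2 * R) := by
  classical
  set G : ℤ → ℂ := fun r => e (a * r + b * r ^ 2) with hG
  have hGb : ∀ r, ‖G r‖ ≤ 1 := fun r => (norm_e _).le
  have hav := avg_shift G hGb R 1 H
  have hR' : 0 < §R := mod_cast hR
  have hH' : 0 < §H := mod_cast hH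
  have hGs : ∑ r ∈ range R, G r = ∑ r ∈ range R, e (a * r + b * r ^ 2) := by
    simp [hG]
  rw [hGs] at hav
  have h1 : 3 / 4 * δ * R * H ≤ ∑ r ∈ range R, ‖∑ j ∈ range H, G (r + (1 * j : ℕ))‖ := by
    have : §H * (δ * R) ≤ H * ‖∑ r ∈ range R, e (a * r + b * r ^ 2)‖ := by gcongr
    have h2 : 2 * ((1 : ℕ) * §H) * H ≤ 1 / 4 * δ * R * H := by
      have := mul_le_mul_of_nonneg_right hRH hH'.le
      push_cast; linarith
    push_cast at *
    linarith
  have h2 : (3 / 4 * δ * R * H) ^ 2 ≤ R * ∑ r ∈ range R, ‖∑ j ∈ range H, G (r + (1 * j : ℕ))‖ ^ 2 := by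
    refine (pow_le_pow_left₀ (by positivity) h1 2).trans ?_
    have := sq_sum_le_card_mul_sum_sq (s := range R) (f := fun r : ℕ => ‖∑ j ∈ range H, G (r + (1 * j : ℕ))‖)
    simpa using this
  have h3 := sumsq_le (range R) (range H) (fun r j => G (r + (1 * j : ℕ)))
  have h4 : H * (δ ^ 2 / 2 * R * H) ≤ ∑ j' ∈ range H, ∑ j ∈ range H,
      ‖∑ r ∈ range R, G (r + (1 * j : ℕ)) * conj (G (r + (1 * j' : ℕ)))‖ := by
    rw [sum_comm]
    refine le_trans ?_ h3
    refine le_of_mul_le_mul_left (le_trans ?_ h2) hR'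
    have : 0 ≤ δ ^ 2 * R ^ 2 * H ^ 2 := by positivity
    nlinarith
  obtain ⟨j', hj', h5⟩ := pigeonR hH _ _ h4
  have hval : ∀ j : ℕ, ‖∑ r ∈ range R, G (r + (1 * j : ℕ)) * conj (G (r + (1 * j' : ℕ)))‖
      = ‖∑ r ∈ range R, e ((2 * b * j - 2 * b * j') * r + (a * j - a * j' + b * j ^ 2 - b * j' ^ 2))‖ := by
    intro j
    congr 1
    refine sc fun r _ => ?_
    simp only [hG]
    rw [e_conj, ← e_add]; congr 1; push_cast; ring
  have hpop := popular (range H) (fun j => ‖∑ r ∈ range R, G (r + (1 * j : ℕ)) * conj (G (r + (1 * j' : ℕ)))‖)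
    (δ ^ 2 / 2) R (by positivity) hR' (fun j _ => by
      have := norm_sum_le_card (range R) (fun r => G (r + (1 * j : ℕ)) * conj (G (r + (1 * j' : ℕ)))) 1
        (fun r _ => bmul (hGb _) (bconj (hGb _)))
      simpa using this) (by rw [card_range]; linarith)
  refine ⟨(range H).filter fun j => δ ^ 2 / 2 / 2 * R ≤ ‖∑ r ∈ range R, G (r + (1 * j : ℕ)) * conj (G (r + (1 * j' : ℕ)))‖,
    - (2 * b * j'), ?_, ?_, ?_⟩
  · intro j hj; simp only [mem_filter, mem_range] at hj; exact hj.1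
  · rw [card_range] at hpop
    refine le_trans (le_of_eq (by ring)) hpop
  · intro j hj
    simp only [mem_filter, mem_range] at hj
    have h6 := hj.2
    rw [hval] at h6
    obtain ⟨k, hk⟩ := geo _ _ R _ h6
    refine ⟨k, ?_⟩
    rw [le_div_iff₀ (by positivity)]
    rw [show 2 * b * j + -(2 * b * j') - k = 2 * b * j - 2 * b * j' - k by ring]
    nlinarith

lemma weyl : ∃ C : ℕ, ∀ (δ : ℝ), 0 < δ → δ ≤ 1 / 2 → ∀ (R : ℕ) (a b : ℝ), 1 ≤ δ ^ C * R →
    δ * R ≤ ‖∑ r ∈ range R, e (a * r + b * r ^ 2)‖ →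
    ∃ q : ℕ, 0 < q ∧ δ ^ C * q ≤ 1 ∧ (∃ k : ℤ, δ ^ C * R ^ 2 * |q * b - k| ≤ 1) ∧
      ∃ l : ℤ, δ ^ C * R * |q * a - l| ≤ 1 := by
  refine ⟨40, fun δ hδ hδ2 R a b hbig h => ?_⟩
  have hR' : 0 < §R := by
    by_contra hR
    have : §R = 0 := le_antisymm (not_lt.mp hR) (Nat.cast_nonneg _)
    rw [this] at hbig; norm_num at hbig
  have hR : 0 < R := mod_cast hR'
  have hbig' : ∀ n ≤ 40, 1 ≤ δ ^ n * R := fun n hn =>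
    hbig.trans (by gcongr ?_ * R; exact pown hδ hδ2 hn)
  obtain ⟨H, hH, hH1, hH2⟩ := exR hδ hδ2 7 R (hbig' 8 (by norm_num))
  simp only [Nat.reduceAdd] at hH1
  have hH' : 0 < §H := mod_cast hH
  obtain ⟨S, c, hS1, hS2, hS3⟩ := weyl1 δ hδ R H hR hH (by
    have := powc hδ hδ2 (c := 8) 3 (n := 7) (m := 1) (by norm_num) (by norm_num)
    calc 8 * §H ≤ 8 * (δ ^ 7 * R) := by gcongr
      _ = (8 * δ ^ 7) * R := by ring
      _ ≤ δ ^ 1 * R := by gcongr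
      _ = _ := by ring) a b h
  have hε : (0 : ℝ) < 2 / (δ ^ 2 * R) := by positivity
  obtain ⟨q, hq, hηq, k, hk⟩ := recl S H hS1 (δ ^ 2 / 4) (by positivity) (by nlinarith) hS2 (2 * b) c _ hε hS3 (by
      rw [show 16 * (2 / (δ ^ 2 * R)) * §H = (32 * H) / (δ ^ 2 * R) by ring]
      rw [div_le_one (by positivity)]
      have h3 := powc hδ hδ2 (c := 32) 5 (n := 7) (m := 2) (by norm_num) (by norm_num)
      calc 32 * §H ≤ 32 * (δ ^ 7 * R) := by gcongr
        _ = (32 * δ ^ 7) * R := by ring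
        _ ≤ δ ^ 2 * R := by gcongr) (by
      have h1 := hbig' 20 (by norm_num)
      have h3 := powc hδ hδ2 (c := 128) 7 (n := 20) (m := 12) (by norm_num) (by norm_num)
      have : 128 ≤ δ ^ 4 * H := by
        calc (128 : ℝ) ≤ 128 * (δ ^ 20 * R) := by linarith
          _ = (128 * δ ^ 20) * R := by ring
          _ ≤ δ ^ 12 * R := by gcongr
          _ = δ ^ 4 * (δ ^ 8 * R) := by ring
          _ ≤ _ := by gcongr
      nlinarith)
  have hq' : 0 < §q := mod_cast hq
  set κ := (2 * q : ℝ) * b - k with hκ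
  have hqb : δ ^ 2 * q ≤ 8 := by linarith
  have hκb : δ ^ 22 * R ^ 2 * |κ| ≤ 1 := by
    have e1 : §q * (2 * b) - k = κ := by rw [hκ]; ring
    rw [e1] at hk
    have h1 : δ ^ 4 * H * R * |κ| ≤ 32 * q := by
      have h2 := mul_le_mul_of_nonneg_left hk (show (0:ℝ) ≤ 4 * δ ^ 2 * R by positivity)
      have e2 : 4 * δ ^ 2 * R * (4 * (2 / (δ ^ 2 * R)) * q) = 32 * q := by field_simp; norm_num
      rw [e2] at h2
      linarith
    have h3 := powc hδ hδ2 (c := 256) 8 (n := 8) (m := 0) (by norm_num) (by norm_num)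
    calc δ ^ 22 * R ^ 2 * |κ| = δ ^ 10 * (δ ^ 4 * (δ ^ 8 * R) * R * |κ|) := by ring
      _ ≤ δ ^ 10 * (δ ^ 4 * H * R * |κ|) := by gcongr
      _ ≤ δ ^ 10 * (32 * q) := by gcongr
      _ = 32 * δ ^ 8 * (δ ^ 2 * q) := by ring
      _ ≤ 32 * δ ^ 8 * 8 := by gcongr
      _ = 256 * δ ^ 8 := by ring
      _ ≤ 1 := by simpa using h3
  have hq6 : δ ^ 6 * (2 * q) ≤ 1 := by
    have h3 := powc hδ hδ2 (c := 16) 4 (n := 4) (m := 0) (by norm_num) (by norm_num)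
    calc δ ^ 6 * (2 * q) = 2 * δ ^ 4 * (δ ^ 2 * q) := by ring
      _ ≤ 2 * δ ^ 4 * 8 := by gcongr
      _ = 16 * δ ^ 4 := by ring
      _ ≤ 1 := by simpa using h3
  obtain ⟨J, hJ, hJ1, hJ2⟩ := exR hδ hδ2 30 R (hbig' 31 (by norm_num))
  simp only [Nat.reduceAdd] at hJ1
  have hJ' : 0 < §J := mod_cast hJ
  have hqJ : δ ^ 6 * (2 * q * J) ≤ δ ^ 30 * R := by
    calc δ ^ 6 * (2 * q * J) = (δ ^ 6 * (2 * q)) * J := by ring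
      _ ≤ 1 * (δ ^ 30 * R) := by gcongr
      _ = _ := by ring
  have hqJ2 : 2 * q * J ≤ δ ^ 24 * R := by
    refine le_of_mul_le_mul_left (hqJ.trans (le_of_eq (by ring))) (show 0 < δ ^ 6 by positivity)
  obtain ⟨r0, hr0, hsub⟩ := subwin ({()} : Finset Unit) (fun _ r => e (a * r + b * r ^ 2))
    (fun _ _ => (norm_e _).le) R (2 * q) J hR δ (by
      have h3 := powc hδ hδ2 (c := 4) 2 (n := 24) (m := 1) (by norm_num) (by norm_num)
      push_cast
      calc 4 * (2 * q * J : ℝ) ≤ 4 * (δ ^ 24 * R) := by gcongr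
        _ = (4 * δ ^ 24) * R := by ring
        _ ≤ δ ^ 1 * R := by gcongr
        _ = _ := by ring) (by simpa using h)
  simp only [card_singleton, Nat.cast_one, mul_one, sum_singleton] at hsub
  have hr0' : (r0 : ℝ) ≤ R := mod_cast hr0.le
  have hdiff : ‖∑ j ∈ range J, (e (a * ((r0 + (2 * q * j : ℕ) : ℤ) : ℝ) + b * ((r0 + (2 * q * j : ℕ) : ℤ) : ℝ) ^ 2)
      - e ((2 * q * a) * j + (a * r0 + b * r0 ^ 2)))‖ ≤ J * (δ / 4) := by
    have := norm_sum_le_card (range J) (fun j : ℕ => (e (a * ((r0 + (2 * q * j : ℕ) : ℤ) : ℝ) + b * ((r0 + (2 * q * j : ℕ) : ℤ) : ℝ) ^ 2)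
      - e ((2 * q * a) * j + (a * r0 + b * r0 ^ 2)))) (δ / 4) (fun j hj => by
        simp only [mem_range] at hj
        have hjJ : §j ≤ J := mod_cast hj.le
        have e1 : a * ((r0 + (2 * q * j : ℕ) : ℤ) : ℝ) + b * ((r0 + (2 * q * j : ℕ) : ℤ) : ℝ) ^ 2 =
            ((2 * q * a) * j + (a * r0 + b * r0 ^ 2) + (2 * r0 * j + 2 * q * j ^ 2) * κ) + ((2 * r0 * j + 2 * q * j ^ 2) * k : ℤ) := by
          rw [hκ]; push_cast; ring
        rw [e1, e_add_int]
        refine (e_sub_norm _ _).trans ?_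
        rw [add_sub_cancel_left, abs_mul, abs_of_nonneg (by positivity : (0:ℝ) ≤ 2 * r0 * j + 2 * q * j ^ 2)]
        have h5 : (2 * r0 * j + 2 * q * j ^ 2 : ℝ) ≤ 3 * δ ^ 30 * R ^ 2 := by
          have h6 : (2 * q * j : ℝ) ≤ δ ^ 24 * R := le_trans (by gcongr) hqJ2
          have h7 : δ ^ 24 ≤ 1 := pow_le_one₀ hδ.le (by linarith)
          calc (2 * r0 * j + 2 * q * j ^ 2 : ℝ) = (2 * r0 + 2 * q * j) * j := by ring
            _ ≤ (2 * R + R) * (δ ^ 30 * R) := by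
              have h8 : (2 * q * j : ℝ) ≤ R := h6.trans (by nlinarith)
              exact mul_le_mul (by linarith) (hjJ.trans hJ2) (by positivity) (by positivity)
            _ = _ := by ring
        have h3 := powc hδ hδ2 (c := 84) 7 (n := 8) (m := 1) (by norm_num) (by norm_num)
        calc 7 * ((2 * r0 * j + 2 * q * j ^ 2) * |κ|) ≤ 7 * ((3 * δ ^ 30 * R ^ 2) * |κ|) := by gcongr
          _ = 21 * δ ^ 8 * (δ ^ 22 * R ^ 2 * |κ|) := by ring
          _ ≤ 21 * δ ^ 8 * 1 := by gcongr
          _ ≤ δ / 4 := by linarith)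
    simpa using this
  rw [sum_sub_distrib] at hdiff
  have hlow : δ / 4 * J ≤ ‖∑ j ∈ range J, e ((2 * q * a) * j + (a * r0 + b * r0 ^ 2))‖ := by
    have := norm_sub_norm_le (∑ j ∈ range J, e (a * ((r0 + (2 * q * j : ℕ) : ℤ) : ℝ) + b * ((r0 + (2 * q * j : ℕ) : ℤ) : ℝ) ^ 2))
      (∑ j ∈ range J, e ((2 * q * a) * j + (a * r0 + b * r0 ^ 2)))
    linarith
  obtain ⟨l, hl⟩ := geo _ _ J _ hlow
  have hp : ∀ n ≤ 40, δ ^ 40 ≤ δ ^ n := fun n hn => pown hδ hδ2 hn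
  refine ⟨2 * q, by omega, ?_, ⟨k, ?_⟩, ⟨l, ?_⟩⟩
  · push_cast
    exact le_trans (by gcongr ?_ * _; exact hp 6 (by norm_num)) hq6
  · push_cast
    exact le_trans (by gcongr ?_ * _ * _; exact hp 22 (by norm_num)) hκb
  · push_cast
    have h8 : δ ^ 32 * R * |2 * q * a - l| ≤ 2 := by
      calc δ ^ 32 * R * |2 * q * a - l| = δ * (δ ^ 31 * R) * |2 * q * a - l| := by ring
        _ ≤ δ * J * |2 * q * a - l| := by gcongr
        _ ≤ 2 := by linarith
    calc δ ^ 40 * R * |2 * q * a - l| ≤ δ ^ 33 * R * |2 * q * a - l| := by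
          gcongr ?_ * _ * _; exact hp 33 (by norm_num)
      _ = δ * (δ ^ 32 * R * |2 * q * a - l|) := by ring
      _ ≤ (1 / 2) * 2 := by gcongr
      _ = 1 := by norm_num

section
def Mj (ε : ℝ) (K : ℕ) (t : ℝ) : Prop :=
  ∃ q' : ℕ, 0 < q' ∧ ε * q' ≤ 1 ∧ ∃ k : ℤ, ε * K * |q' * t - k| ≤ 1

lemma Mj.mono {ε ε' : ℝ} {K : ℕ} {t : ℝ} (h : Mj ε K t) (h' : ε' ≤ ε) : Mj ε' K t := by
  obtain ⟨q, h1, h2, k, h3⟩ := h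
  refine ⟨q, h1, le_trans (by gcongr) h2, k, le_trans (by gcongr) h3⟩

section
variable {Q : ℕ} [NeZero Q]

def MajQ (ε : ℝ) (K : ℕ) (ξ : ZMod Q) : Prop :=
  ∃ q' : ℕ, 0 < q' ∧ ε * q' ≤ 1 ∧ ∃ k : ℤ, ε * K ^ 2 * |q' * ((ξ.val : ℝ) / Q) - k| ≤ 1

lemma MajQ.mono {ε ε' : ℝ} {K : ℕ} {t : ZMod Q} (h : MajQ ε K t) (h' : ε' ≤ ε) : MajQ ε' K t := by
  obtain ⟨q, h1, h2, k, h3⟩ := h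
  refine ⟨q, h1, le_trans (by gcongr) h2, k, le_trans (by gcongr) h3⟩

lemma maj_count (ε : ℝ) (hε : 0 < ε) (hε1 : ε ≤ 1) (K : ℕ) (hK : 1 ≤ ε * K ^ 2) (hQK : §Q ≤ 16 * K ^ 2)
    (S : Finset (ZMod Q)) (hS : ∀ ξ ∈ S, MajQ ε K ξ) : #S * ε ^ 3 ≤ 264 := by
  have hQ : 0 < §Q := Qpos
  have hS' : ∀ ξ : ZMod Q, ∃ q' : ℕ, ∃ k : ℤ, ξ ∈ S → 0 < q' ∧ ε * q' ≤ 1 ∧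
      ε * K ^ 2 * |q' * ((ξ.val : ℝ) / Q) - k| ≤ 1 := by
    intro ξ
    by_cases h : ξ ∈ S
    · obtain ⟨q, h1, h2, k, h3⟩ := hS ξ h
      exact ⟨q, k, fun _ => ⟨h1, h2, h3⟩⟩
    · exact ⟨0, 0, fun h' => absurd h' h⟩
  choose q k hqk using hS'
  set B := ⌊1 / ε⌋₊ with hB
  set B' := ⌊16 / ε⌋ with hB'
  have hB1 : (B : ℝ) ≤ 1 / ε := Nat.floor_le (by positivity)
  have hB'1 : (B' : ℝ) ≤ 16 / ε := Int.floor_le _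
  have hB'0 : 0 ≤ B' := Int.floor_nonneg.mpr (by positivity)
  set box : Finset (ℕ × ℤ × ℤ) := range (B + 1) ×ˢ Icc (-B') B' ×ˢ Icc (-1) ((B : ℤ) + 1) with hbox
  have hmaps : Set.MapsTo (fun ξ => ((q ξ, (q ξ : ℤ) * ξ.val - k ξ * Q, k ξ) : ℕ × ℤ × ℤ)) S box := by
    intro ξ hξ
    obtain ⟨h1, h2, h3⟩ := hqk ξ hξ
    have h4 : q ξ ≤ B := by
      apply Nat.le_floor
      rw [le_div_iff₀ hε]; linarith
    have hd : |q ξ * ((ξ.val : ℝ) / Q) - k ξ| ≤ 1 := by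
      have := abs_nonneg (q ξ * ((ξ.val : ℝ) / Q) - k ξ)
      nlinarith
    have hv : (ξ.val : ℝ) / Q < 1 := by
      rw [div_lt_one hQ]; exact_mod_cast ZMod.val_lt ξ
    have hv0 : 0 ≤ (ξ.val : ℝ) / Q := by positivity
    rw [abs_le] at hd
    have hqB : (q ξ : ℝ) ≤ B := mod_cast h4
    have k1 : -1 ≤ k ξ := by
      have : (-1 : ℝ) ≤ k ξ := by
        have : 0 ≤ q ξ * ((ξ.val : ℝ) / Q) := by positivity
        linarith
      exact_mod_cast this
    have k2 : k ξ ≤ B + 1 := by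
      have : (k ξ : ℝ) ≤ B + 1 := by
        have : q ξ * ((ξ.val : ℝ) / Q) ≤ q ξ * 1 := by gcongr
        linarith
      exact_mod_cast this
    have h5 : |(((q ξ : ℤ) * ξ.val - k ξ * Q : ℤ) : ℝ)| ≤ 16 / ε := by
      have e1 : (((q ξ : ℤ) * ξ.val - k ξ * Q : ℤ) : ℝ) = (q ξ * ((ξ.val : ℝ) / Q) - k ξ) * Q := by
        push_cast; field_simp
      rw [e1, abs_mul, abs_of_pos hQ, le_div_iff₀ hε]
      have := abs_nonneg (q ξ * ((ξ.val : ℝ) / Q) - k ξ)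
      calc |q ξ * ((ξ.val : ℝ) / Q) - k ξ| * Q * ε ≤ |q ξ * ((ξ.val : ℝ) / Q) - k ξ| * (16 * K ^ 2) * ε := by gcongr
        _ = 16 * (ε * K ^ 2 * |q ξ * ((ξ.val : ℝ) / Q) - k ξ|) := by ring
        _ ≤ 16 * 1 := by gcongr
        _ = 16 := by norm_num
    have h6 : |(q ξ : ℤ) * ξ.val - k ξ * Q| ≤ B' := by
      apply Int.le_floor.mpr
      rw [Int.cast_abs]; exact h5
    rw [abs_le] at h6
    simp only [hbox, mem_coe, mem_product, mem_range, mem_Icc]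
    exact ⟨by omega, h6, k1, k2⟩
  have hinj : Set.InjOn (fun ξ => ((q ξ, (q ξ : ℤ) * ξ.val - k ξ * Q, k ξ) : ℕ × ℤ × ℤ)) S := by
    intro ξ hξ ξ' hξ' h
    simp only [Prod.mk.injEq] at h
    obtain ⟨h1, h2, h3⟩ := h
    rw [h1, h3] at h2
    have h4 : (q ξ' : ℤ) * ξ.val = q ξ' * ξ'.val := by linarith
    have h5 := (hqk ξ' hξ').1
    have h6 : (ξ.val : ℤ) = ξ'.val := mul_left_cancel₀ (mod_cast h5.ne') h4
    exact ZMod.val_injective Q (mod_cast h6)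
  have hcard := card_le_card_of_injOn _ hmaps hinj
  have hbc : (#box : ℝ) = (B + 1) * ((2 * B' + 1) * (B + 3)) := by
    simp only [hbox, card_product, card_range, Int.card_Icc]
    push_cast
    have e1 : §((B' + 1 - -B').toNat) = 2 * B' + 1 := by
      have : (((B' + 1 - -B').toNat : ℕ) : ℤ) = 2 * B' + 1 := by omega
      exact_mod_cast this
    have e2 : ((((B : ℤ) + 1 + 1 - -1).toNat : ℕ) : ℝ) = B + 3 := by
      have : ((((B : ℤ) + 1 + 1 - -1).toNat : ℕ) : ℤ) = B + 3 := by omega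
      exact_mod_cast this
    rw [e1, e2]
  have h1 : (1 : ℝ) ≤ 1 / ε := by rw [le_div_iff₀ hε]; linarith
  have hB'2 : (B' : ℝ) ≤ 16 * (1 / ε) := hB'1.trans (le_of_eq (by ring))
  have hB'0r : (0 : ℝ) ≤ B' := mod_cast hB'0
  calc #S * ε ^ 3 ≤ #box * ε ^ 3 := by gcongr
    _ ≤ ((2 * (1 / ε)) * ((33 * (1 / ε)) * (4 * (1 / ε)))) * ε ^ 3 := by
      rw [hbc]
      gcongr <;> linarith
    _ = 264 := by field_simp; norm_num

/-- Weyl, packaged for quadratic characters -/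
lemma weylch : ∃ C : ℕ, 2 ≤ C ∧ ∀ (δ : ℝ), 0 < δ → δ ≤ 1 / 2 → ∀ (Q : ℕ) [NeZero Q] (K R q m : ℕ) (ξ : ZMod Q) (β : ℝ),
    0 < q → δ * q ≤ 1 → δ * K ≤ R → m ≤ K → 1 ≤ δ ^ C * K →
    δ * R ≤ ‖∑ r ∈ range R, e (β * r) * ch (ξ * ¶(m + q * r) ^ 2)‖ →
    MajQ (δ ^ C) K ξ ∧ Mj (δ ^ C) K β := by
  obtain ⟨C, hC⟩ := weyl
  refine ⟨C + 5, by omega, fun δ hδ hδ2 Q _ K R q m ξ β hq hδq hKR hm hbig h => ?_⟩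
  have hK : (0 : ℝ) ≤ K := by positivity
  have hbig2 : 1 ≤ δ ^ C * R := by
    calc 1 ≤ δ ^ (C + 5) * K := hbig
      _ ≤ δ ^ (C + 1) * K := by gcongr ?_ * _; exact pown hδ hδ2 (by omega)
      _ = δ ^ C * (δ * K) := by ring
      _ ≤ _ := by gcongr
  have hform : ‖∑ r ∈ range R, e (β * r) * ch (ξ * ¶(m + q * r) ^ 2)‖
      = ‖∑ r ∈ range R, e ((β + 2 * m * q * ((ξ.val : ℝ) / Q)) * r + (q ^ 2 * ((ξ.val : ℝ) / Q)) * r ^ 2)‖ := by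
    rw [← one_mul ‖∑ r ∈ range R, e ((β + 2 * m * q * ((ξ.val : ℝ) / Q)) * r + (q ^ 2 * ((ξ.val : ℝ) / Q)) * r ^ 2)‖,
      ← norm_e ((ξ.val : ℝ) / Q * m ^ 2), ← norm_mul, mul_sum]
    congr 1
    refine sc fun r _ => ?_
    have := ch_e_val ξ (((m + q * r : ℕ) : ℤ) ^ 2)
    push_cast at this
    push_cast
    rw [this, ← e_add, ← e_add]; congr 1; ring
  rw [hform] at h
  obtain ⟨q1, hq1, hq1b, ⟨k, hk⟩, ⟨l, hl⟩⟩ := hC δ hδ hδ2 R _ _ hbig2 h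
  set t := (ξ.val : ℝ) / Q with ht
  have hR : (0 : ℝ) ≤ R := by positivity
  have hq' : 0 < §q := mod_cast hq
  have hq1' : (0 : ℝ) < q1 := mod_cast hq1
  have hkk : |(q1 * q ^ 2 : ℕ) * t - k| = |q1 * (q ^ 2 * t) - k| := by
    congr 1; push_cast; ring
  constructor
  · refine ⟨q1 * q ^ 2, by positivity, ?_, k, ?_⟩
    · push_cast
      calc δ ^ (C + 5) * (q1 * q ^ 2) = δ ^ 3 * ((δ ^ C * q1) * (δ * q) ^ 2) := by ring
        _ ≤ 1 * (1 * 1 ^ 2) := by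
          gcongr
          exact pow_le_one₀ hδ.le (by linarith)
        _ = 1 := by norm_num
    · rw [hkk]
      calc δ ^ (C + 5) * K ^ 2 * |q1 * (q ^ 2 * t) - k| = δ ^ 3 * (δ ^ C * (δ * K) ^ 2 * |q1 * (q ^ 2 * t) - k|) := by ring
        _ ≤ 1 * (δ ^ C * R ^ 2 * |q1 * (q ^ 2 * t) - k|) := by
          gcongr
          exact pow_le_one₀ hδ.le (by linarith)
        _ ≤ 1 := by linarith
  · refine ⟨q * q1, by positivity, ?_, q * l - 2 * m * k, ?_⟩
    · push_cast
      calc δ ^ (C + 5) * (q * q1) = δ ^ 4 * ((δ ^ C * q1) * (δ * q)) := by ring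
        _ ≤ 1 * (1 * 1) := by
          gcongr
          exact pow_le_one₀ hδ.le (by linarith)
        _ = 1 := by norm_num
    · have e1 : §(q * q1) * β - ((q * l - 2 * m * k : ℤ) : ℝ)
          = q * (q1 * (β + 2 * m * q * t) - l) - 2 * m * (q1 * (q ^ 2 * t) - k) := by
        push_cast; ring
      rw [e1]
      set u := q1 * (β + 2 * m * q * t) - l
      set v := q1 * (q ^ 2 * t) - k
      have h1 : |q * u - 2 * m * v| ≤ q * |u| + 2 * K * |v| := by
        refine (abs_sub _ _).trans ?_
        rw [abs_mul, abs_mul, abs_of_pos hq', abs_of_nonneg (by positivity : (0 : ℝ) ≤ 2 * m)]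
        gcongr
      have h2 : δ ^ (C + 2) * K * (q * |u|) ≤ 1 := by
        calc δ ^ (C + 2) * K * (q * |u|) = (δ * q) * (δ ^ C * (δ * K) * |u|) := by ring
          _ ≤ 1 * (δ ^ C * R * |u|) := by gcongr
          _ ≤ 1 := by linarith
      have h3 : δ ^ (C + 2) * K * (2 * K * |v|) ≤ 2 := by
        calc δ ^ (C + 2) * K * (2 * K * |v|) = 2 * (δ ^ C * (δ * K) ^ 2 * |v|) := by ring
          _ ≤ 2 * (δ ^ C * R ^ 2 * |v|) := by gcongr
          _ ≤ 2 := by linarith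
      have h4 : 3 * δ ^ 3 ≤ 1 := by
        simpa using powc hδ hδ2 (c := 3) 2 (n := 3) (m := 0) (by norm_num) (by norm_num)
      calc δ ^ (C + 5) * K * |q * u - 2 * m * v| ≤ δ ^ (C + 5) * K * (q * |u| + 2 * K * |v|) := by gcongr
        _ = δ ^ 3 * (δ ^ (C + 2) * K * (q * |u|) + δ ^ (C + 2) * K * (2 * K * |v|)) := by ring
        _ ≤ δ ^ 3 * (1 + 2) := by gcongr
        _ ≤ 1 := by linarith

/-- the dual function of the normal form (unnormalised) -/
noncomputable def DD (f0 c : ZMod Q → ℂ) (β : ZMod Q → ℝ) (q K R : ℕ) (z : ZMod Q) : ℂ :=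
  ∑ m ∈ range K, ∑ r ∈ range R, f0 (z - ¶(m + q * r) ^ 2) *
    c (z - ((m + q * r : ℕ) : ZMod Q) ^ 2 + m) * e (β (z - ((m + q * r : ℕ) : ZMod Q) ^ 2 + m) * r)

lemma psi_eq (f0 c : ZMod Q → ℂ) (β : ZMod Q → ℝ) (q K R : ℕ) (g : ZMod Q → ℂ) :
    ∑ z, DD f0 c β q K R z * g z = ∑ m ∈ range K, ∑ x, ∑ r ∈ range R,
      f0 x * c (x + m) * e (β (x + m) * r) * g (x + ¶(m + q * r) ^ 2) := by
  unfold DD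
  simp_rw [sum_mul]
  rw [sum_comm]
  refine sc fun m _ => ?_
  rw [sum_comm]
  symm
  rw [sum_comm]
  refine sc fun r _ => ?_
  symm
  rw [← sum_translate (¶(m + q * r) ^ 2)]
  refine sc fun x _ => ?_
  rw [add_sub_cancel_right]

lemma DD_norm (f0 c : ZMod Q → ℂ) (h0 : Bd f0) (hc : Bd c) (β : ZMod Q → ℝ) (q K R : ℕ) (z : ZMod Q) :
    ‖DD f0 c β q K R z‖ ≤ K * R := by
  unfold DD
  have := norm_sum_le_card (range K) _ R (fun m _ => by
    have := norm_sum_le_card (range R) (fun r => f0 (z - ¶(m + q * r) ^ 2) *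
    c (z - ((m + q * r : ℕ) : ZMod Q) ^ 2 + m) * e (β (z - ((m + q * r : ℕ) : ZMod Q) ^ 2 + m) * r)) 1
      (fun r _ => bmul (bmul (h0 _) (hc _)) (norm_e _).le)
    simpa using this)
  simpa using this

end

lemma psiWeyl : ∃ C : ℕ, 2 ≤ C ∧ ∀ (δ : ℝ), 0 < δ → δ ≤ 1 / 2 → ∀ (Q : ℕ) [NeZero Q] (K R q : ℕ) (ξ : ZMod Q)
    (f0 c : ZMod Q → ℂ) (_ : Bd f0) (_ : Bd c) (β : ZMod Q → ℝ),
    0 < q → δ * q ≤ 1 → δ * K ≤ R → 1 ≤ δ ^ C * K →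
    δ * Q * K * R ≤ ‖∑ z, DD f0 c β q K R z * ch (ξ * z)‖ →
    MajQ (δ ^ C) K ξ ∧ ∃ w, c w ≠ 0 ∧ Mj (δ ^ C) K (β w) := by
  obtain ⟨C, hC2, hC⟩ := weylch
  refine ⟨C, hC2, fun δ hδ hδ2 Q _ K R q ξ f0 c h0 hc β hq hδq hKR hbig h => ?_⟩
  have hKr : 0 < §K := by
    by_contra hR
    have : §K = 0 := le_antisymm (not_lt.mp hR) (Nat.cast_nonneg _)
    rw [this] at hbig; norm_num at hbig
  have hR : 0 < §R := lt_of_lt_of_le (by positivity) hKR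
  have hQ : 0 < §Q := Qpos
  rw [psi_eq] at h
  obtain ⟨m, hm, h1⟩ := pigeonR (n := K) (mod_cast hKr) _ (δ * Q * R) (le_trans (le_of_eq (by ring)) (h.trans (norm_sum_le _ _)))
  obtain ⟨x, -, h2⟩ := pigeon (s := (univ : Finset (ZMod Q))) ⟨0, by simp⟩ _ (δ * R) (le_trans (le_of_eq (by rw [cardZ]; ring)) (h1.trans (norm_sum_le _ _)))
  have e1 : ∑ r ∈ range R, f0 x * c (x + m) * e (β (x + m) * r) * ch (ξ * (x + ¶(m + q * r) ^ 2))
     = (f0 x * c (x + m) * ch (ξ * x)) * ∑ r ∈ range R, e (β (x + m) * r) * ch (ξ * ¶(m + q * r) ^ 2) := by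
    rw [mul_sum]
    refine sc fun r _ => ?_
    rw [mul_add, ch_add]; ring
  rw [e1, norm_mul] at h2
  have hcne : c (x + m) ≠ 0 := by
    intro h0
    rw [h0] at h2; simp at h2
    have : 0 < δ * R := by positivity
    linarith
  have h3 := h2.trans (mul_le_of_le_one_left (norm_nonneg _) (bmul (bmul (h0 x) (hc (x + m))) (ch_norm _).le))
  obtain ⟨h4, h5⟩ := hC δ hδ hδ2 Q K R q m ξ (β (x + m)) hq hδq hKR hm.le hbig h3
  exact ⟨h4, x + m, hcne, h5⟩
end

lemma shift2 {ι : Type*} (X : Finset ι) (G : ι → ℤ → ℤ → ℂ) (hG : ∀ x m r, ‖G x m r‖ ≤ 1) (K R : ℕ) (a b : ℤ) :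
    ‖∑ x ∈ X, ∑ m ∈ range K, ∑ r ∈ range R, G x (m + a) (r + b) - ∑ x ∈ X, ∑ m ∈ range K, ∑ r ∈ range R, G x m r‖
      ≤ #X * (2 * |(a : ℝ)| * R + 2 * |(b : ℝ)| * K) := by
  rw [← sum_sub_distrib]
  refine norm_sum_le_card _ _ _ fun x _ => ?_
  have h1 : ‖∑ m ∈ range K, ∑ r ∈ range R, G x (m + a) (r + b) - ∑ m ∈ range K, ∑ r ∈ range R, G x m (r + b)‖
      ≤ 2 * |(a : ℝ)| * R := by
    rw [sum_comm, sum_comm (s := range K) (f := fun (m r : ℕ) => G x m (r + b)), ← sum_sub_distrib]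
    refine (norm_sum_le_card _ _ (2 * |(a : ℝ)|) fun (r : ℕ) _ => shift_bd (fun m => G x m (r + b)) (fun m => hG _ _ _) K a).trans ?_
    simp only [card_range]; linarith
  have h2 : ‖∑ m ∈ range K, ∑ r ∈ range R, G x m (r + b) - ∑ m ∈ range K, ∑ r ∈ range R, G x m r‖
      ≤ 2 * |(b : ℝ)| * K := by
    rw [← sum_sub_distrib]
    refine (norm_sum_le_card _ _ (2 * |(b : ℝ)|) fun (m : ℕ) _ => shift_bd (fun r => G x m r) (fun m => hG _ _ _) R b).trans ?_
    simp only [card_range]; linarith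
  calc _ = ‖(∑ m ∈ range K, ∑ r ∈ range R, G x (m + a) (r + b) - ∑ m ∈ range K, ∑ r ∈ range R, G x m (r + b)) +
      (∑ m ∈ range K, ∑ r ∈ range R, G x m (r + b) - ∑ m ∈ range K, ∑ r ∈ range R, G x m r)‖ := by rw [sub_add_sub_cancel]
    _ ≤ _ := (norm_add_le _ _).trans (add_le_add h1 h2)

/-- if many approximants are close to `S`, their sum is large -/
lemma sum_near (T : ℕ) (F : ℕ → ℂ) (S : ℂ) (E B : ℝ) (h : ∀ i < T, ‖F i - S‖ ≤ E) (hS : B + E ≤ ‖S‖) :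
    T * B ≤ ‖∑ i ∈ range T, F i‖ := by
  have h1 : ‖∑ i ∈ range T, (F i - S)‖ ≤ T * E := by
    have := norm_sum_le_card (range T) (fun i => F i - S) E (fun i hi => h i (mem_range.mp hi))
    simpa using this
  have h2 : (T : ℂ) * S = ∑ i ∈ range T, F i - ∑ i ∈ range T, (F i - S) := by
    rw [sum_sub_distrib]; simp
  have h3 := norm_sub_le (∑ i ∈ range T, F i) (∑ i ∈ range T, (F i - S))
  rw [← h2, norm_mul, Complex.norm_natCast] at h3
  have : §T * (B + E) ≤ T * ‖S‖ := by gcongr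
  linarith

lemma largeSpec {Q : ℕ} [NeZero Q] (P : ZMod Q → ℝ) (hP : ∀ ξ, 0 ≤ P ξ) (S : ZMod Q → ℝ) (hS0 : ∀ ξ, 0 ≤ S ξ) (R A ε ε' : ℝ)
    (hS : ∀ ξ, S ξ ≤ R) (hε : 0 < ε) (hε1 : ε ≤ 1) (hε' : 0 < ε') (hε'1 : ε' ≤ 1) (hPA : ∑ ξ, P ξ ≤ A) (h : ε * A * R ^ 2 ≤ ∑ ξ, P ξ * S ξ ^ 2)
    (hAR : 0 < ε * A * R ^ 2)
    (K : ℕ) (hK : 1 ≤ ε' * K ^ 2) (hQK : §Q ≤ 16 * K ^ 2)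
    (hM : ∀ ξ, ε / 2 * R ≤ S ξ → MajQ ε' K ξ) : ∃ ξ, ε / 2 * A * ε' ^ 3 ≤ 264 * P ξ := by
  classical
  set B := (univ : Finset (ZMod Q)).filter (fun ξ => ε / 2 * R ≤ S ξ) with hB
  have h1 : ∑ ξ, P ξ * S ξ ^ 2 ≤ ∑ ξ ∈ B, P ξ * R ^ 2 + ε / 2 * A * R ^ 2 := by
    rw [← sum_filter_add_sum_filter_not _ (fun ξ => ε / 2 * R ≤ S ξ)]
    have e1 : ∑ ξ ∈ B, P ξ * S ξ ^ 2 ≤ ∑ ξ ∈ B, P ξ * R ^ 2 :=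
      sum_le_sum fun ξ _ => by have := hP ξ; have := hS ξ; have := hS0 ξ; gcongr
    have e2 : ∑ ξ with ¬ ε / 2 * R ≤ S ξ, P ξ * S ξ ^ 2 ≤ ε / 2 * A * R ^ 2 := by
      calc _ ≤ ∑ ξ with ¬ ε / 2 * R ≤ S ξ, P ξ * (ε / 2 * R ^ 2) := by
            refine sum_le_sum fun ξ hξ => ?_
            simp only [mem_filter, mem_univ, true_and, not_le] at hξ
            have := hP ξ
            gcongr
            have h0 := hS0 ξ
            calc S ξ ^ 2 ≤ (ε / 2 * R) ^ 2 := by gcongr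
              _ = (ε / 2 * R ^ 2) * (ε / 2) := by ring
              _ ≤ (ε / 2 * R ^ 2) * 1 := by gcongr; linarith
              _ = _ := by ring
        _ ≤ ∑ ξ, P ξ * (ε / 2 * R ^ 2) :=
            sum_le_sum_of_subset_of_nonneg (filter_subset _ _) fun ξ _ _ => by have := hP ξ; positivity
        _ = (∑ ξ, P ξ) * (ε / 2 * R ^ 2) := by rw [sum_mul]
        _ ≤ A * (ε / 2 * R ^ 2) := by gcongr
        _ = _ := by ring
    exact add_le_add e1 e2
  rw [← sum_mul] at h1
  have hR2 : 0 < R ^ 2 := by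
    rcases (sq_nonneg R).lt_or_eq with h | h
    · exact h
    · rw [← h] at hAR; simp at hAR
  have h2 : ε / 2 * A ≤ ∑ ξ ∈ B, P ξ := by
    have : ε / 2 * A * R ^ 2 ≤ (∑ ξ ∈ B, P ξ) * R ^ 2 := by linarith
    exact le_of_mul_le_mul_right this hR2
  have hApos : 0 < ε / 2 * A := by
    have : 0 < ε * A := pos_of_mul_pos_left hAR hR2.le
    linarith
  have hBne : B.Nonempty := by
    by_contra hne
    rw [not_nonempty_iff_eq_empty] at hne
    rw [hne] at h2; simp at h2; linarith
  have hc := maj_count ε' hε' hε'1 K hK hQK B (fun ξ hξ => hM ξ (by simpa [hB] using hξ))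
  obtain ⟨ξ, -, hξ⟩ := pigeon hBne P (ε / 2 * A * ε' ^ 3 / 264) (by
    calc (#B : ℝ) * (ε / 2 * A * ε' ^ 3 / 264) = (ε / 2 * A) * (#B * ε' ^ 3 / 264) := by ring
      _ ≤ (ε / 2 * A) * 1 := by gcongr; linarith
      _ ≤ _ := by linarith)
  exact ⟨ξ, by linarith⟩

set_option maxHeartbeats 1000000 in
lemma E1 : ∃ C : ℕ, 2 ≤ C ∧ ∀ (δ : ℝ), 0 < δ → δ ≤ 1 / 2 → ∀ (Q : ℕ) [NeZero Q] (K R q R' : ℕ)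
    (f0 c f2 : ZMod Q → ℂ) (_ : Bd f0) (_ : Bd c) (_ : Bd f2) (β : ZMod Q → ℝ),
    0 < q → δ * q ≤ 1 → δ * K ≤ R → 1 ≤ δ ^ C * K → §Q ≤ 16 * K ^ 2 → 0 < R' → 8 * §R' ≤ δ * R → 8 * (q * R' : ℝ) ≤ δ * K →
    δ * Q * K * R ≤ ‖∑ z, DD f0 c β q K R z * f2 z‖ →
    ∃ θ : ℝ, δ ^ C * Q * R' ^ 2 ≤ ∑ z : ZMod Q, ‖∑ t ∈ range (2 * R'), f2 (z + q * t) * e (θ * t)‖ ^ 2 := by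
  obtain ⟨C, hC2, hC⟩ := weylch
  refine ⟨2 * (18 + 27 * C), by omega, fun δ hδ hδ2 Q _ K R q R' f0 c f2 h0 hc h2 β hq hδq hKR hbig hQK hR' hR1 hR2 h => ?_⟩
  have hKr : 0 < §K := by
    by_contra hR
    have : §K = 0 := le_antisymm (not_lt.mp hR) (Nat.cast_nonneg _)
    rw [this] at hbig; norm_num at hbig
  have hR : 0 < §R := lt_of_lt_of_le (by positivity) hKR
  have hQ : 0 < §Q := Qpos
  have hR'r : 0 < §R' := mod_cast hR'
  let F : ZMod Q → ℤ → ℤ → ℂ := fun x m r =>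
    f0 x * c (x + (m : ZMod Q)) * e (β (x + (m : ZMod Q)) * r) * f2 (x + ((m : ZMod Q) + q * (r : ZMod Q)) ^ 2)
  have hF : ∀ x m r, ‖F x m r‖ ≤ 1 := fun x m r => bmul (bmul (bmul (h0 _) (hc _)) (norm_e _).le) (h2 _)
  have hS : ∑ z, DD f0 c β q K R z * f2 z = ∑ x, ∑ m ∈ range K, ∑ r ∈ range R, F x m r := by
    rw [psi_eq, sum_comm]
    refine sc fun x _ => sc fun m _ => sc fun r _ => ?_
    simp only [F]; push_cast; rfl
  rw [hS] at h
  have hnear := sum_near R' (fun i => ∑ x, ∑ m ∈ range K, ∑ r ∈ range R, F x (m + (-(q * i : ℕ) : ℤ)) (r + (i : ℕ)))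
    _ (δ / 2 * Q * K * R) (δ / 2 * Q * K * R) (fun i hi => by
      refine (shift2 _ F hF K R _ _).trans ?_
      rw [cardZ]
      push_cast
      rw [abs_neg, abs_of_nonneg (by positivity), abs_of_nonneg (by positivity)]
      have hi' : §i ≤ R' := mod_cast hi.le
      have e1 : §q * i ≤ δ * K / 8 := by
        have : §q * i ≤ q * R' := by gcongr
        linarith
      have e2 : §i ≤ δ * R / 8 := by linarith
      calc §Q * (2 * (q * i) * R + 2 * i * K) ≤ Q * (2 * (δ * K / 8) * R + 2 * (δ * R / 8) * K) := by gcongr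
        _ = δ / 2 * Q * K * R := by ring) (le_trans (le_of_eq (by ring)) h)
  have hre : ∑ i ∈ range R', ∑ x, ∑ m ∈ range K, ∑ r ∈ range R, F x (m + (-(q * i : ℕ) : ℤ)) (r + (i : ℕ))
     = ∑ m ∈ range K, ∑ x : ZMod Q, ∑ r ∈ range R, (c (x + m) * e (β (x + m) * r)) * ∑ i ∈ range R', (f0 (x + q * i) * e (β (x + m) * i)) *
        f2 (x + ((m + q * r : ℕ) : ZMod Q) ^ 2 + q * i) := by
    have : ∀ i ∈ range R', ∑ x, ∑ m ∈ range K, ∑ r ∈ range R, F x (m + (-(q * i : ℕ) : ℤ)) (r + (i : ℕ))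
       = ∑ m ∈ range K, ∑ x : ZMod Q, ∑ r ∈ range R, (c (x + m) * e (β (x + m) * r)) * ((f0 (x + q * i) * e (β (x + m) * i)) *
        f2 (x + ((m + q * r : ℕ) : ZMod Q) ^ 2 + q * i)) := by
      intro i _
      rw [← sum_translate (¶q * ¶i), sum_comm]
      refine sc fun m _ => sc fun x _ => sc fun r _ => ?_
      simp only [F]
      push_cast
      have a1 : x + (q : ZMod Q) * (i : ZMod Q) + ((m : ZMod Q) + -((q : ZMod Q) * (i : ZMod Q))) = x + m := by ring
      have a2 : x + (q : ZMod Q) * (i : ZMod Q) + ((m : ZMod Q) + -((q : ZMod Q) * (i : ZMod Q)) + (q : ZMod Q) * ((r : ZMod Q) + i)) ^ 2 = x + ((m : ZMod Q) + q * r) ^ 2 + q * i := by ring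
      rw [a1, a2, mul_add, e_add]; ring
    rw [Finset.sum_congr rfl this, Finset.sum_comm]
    refine sc fun m _ => ?_
    rw [sum_comm]
    refine sc fun x _ => ?_
    rw [sum_comm]
    refine sc fun r _ => ?_
    rw [mul_sum]
  rw [hre] at hnear
  obtain ⟨m, hm, h1⟩ := pigeonR (n := K) (mod_cast hKr) _ (δ / 2 * Q * R * R') (le_trans (le_of_eq (by ring)) (hnear.trans (norm_sum_le _ _)))
  rw [← sum_product'] at h1
  set Y : Finset (ZMod Q × ℕ) := univ ×ˢ range R with hY
  have hYc : (#Y : ℝ) = Q * R := by rw [hY, card_product]; push_cast; rw [cardZ, card_range]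
  have hcs := cs_bdd Y (fun y => c (y.1 + m) * e (β (y.1 + m) * y.2)) (fun y => ∑ i ∈ range R', (f0 (y.1 + q * i) * e (β (y.1 + m) * i)) *
        f2 (y.1 + ((m + q * y.2 : ℕ) : ZMod Q) ^ 2 + q * i)) (fun y _ => bmul (hc _) (norm_e _).le)
  have hss := sumsq_le Y (range R') (fun y i => (f0 (y.1 + q * i) * e (β (y.1 + m) * i)) *
        f2 (y.1 + ((m + q * y.2 : ℕ) : ZMod Q) ^ 2 + q * i))
  rw [hYc] at hcs
  have h3 : (δ / 2 * Q * R * R') ^ 2 ≤ Q * R * _ := (pow_le_pow_left₀ (by positivity) h1 2).trans (hcs.trans (mul_le_mul_of_nonneg_left hss (by positivity)))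
  rw [sum_comm] at h3
  obtain ⟨i', hi', h4⟩ := pigeonR hR' _ (δ ^ 2 / 4 * Q * R * R') (by
    refine le_of_mul_le_mul_left (le_trans (le_of_eq ?_) h3) (show 0 < §Q * R by positivity)
    ring)
  set p : ℕ → ZMod Q → ℂ := fun i z => f2 (z + q * i) * conj (f2 (z + q * i')) with hp
  have hpb : ∀ i z, ‖p i z‖ ≤ 1 := fun i z => bmul (h2 _) (bconj (h2 _))
  have h5 : ∀ i : ℕ, ‖∑ y ∈ Y, (f0 (y.1 + q * i) * e (β (y.1 + m) * i)) * f2 (y.1 + ((m + q * y.2 : ℕ) : ZMod Q) ^ 2 + q * i) *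
      conj ((f0 (y.1 + q * i') * e (β (y.1 + m) * i')) * f2 (y.1 + ((m + q * y.2 : ℕ) : ZMod Q) ^ 2 + q * i'))‖ ^ 2
      ≤ ∑ ξ, ‖ft (p i) ξ‖ ^ 2 * ‖∑ r ∈ range R, (1 : ℂ) * ch (ξ * -(¶(m + q * r) ^ 2))‖ ^ 2 := by
    intro i
    rw [← conv_planch (range R) (fun r => ((m + q * r : ℕ) : ZMod Q) ^ 2) (fun _ => 1) (p i)]
    rw [hY, sum_product]
    have := cs_bdd univ (fun x : ZMod Q => f0 (x + q * i) * e (β (x + m) * i) * conj (f0 (x + q * i') * e (β (x + m) * i')))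
      (fun x => ∑ r ∈ range R, (1 : ℂ) * p i (x + ¶(m + q * r) ^ 2)) (fun x _ => bmul (bmul (h0 _) (norm_e _).le) (bconj (bmul (h0 _) (norm_e _).le)))
    rw [cardZ] at this
    refine le_trans (le_of_eq ?_) this
    congr 2
    refine sc fun x _ => ?_
    rw [mul_sum]
    refine sc fun r _ => ?_
    simp only [hp, map_mul]; ring
  have h6 : (δ ^ 2 / 4 * Q * R * R') ^ 2 ≤ R' * ∑ ξ, (∑ i ∈ range R', ‖ft (p i) ξ‖ ^ 2) * ‖∑ r ∈ range R, (1 : ℂ) * ch (ξ * -(¶(m + q * r) ^ 2))‖ ^ 2 := by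
    refine (pow_le_pow_left₀ (by positivity) h4 2).trans (sq_sum_le_card_mul_sum_sq.trans ?_)
    rw [card_range]
    gcongr
    refine (Finset.sum_le_sum fun i _ => h5 i).trans (le_of_eq ?_)
    rw [sum_comm]
    exact sc fun ξ _ => by rw [sum_mul]
  have hPl : ∑ ξ, ∑ i ∈ range R', ‖ft (p i) ξ‖ ^ 2 ≤ Q * Q * R' := by
    rw [sum_comm]
    calc _ ≤ ∑ i ∈ range R', §Q * Q := by
          refine sum_le_sum fun i _ => ?_
          rw [planch]
          gcongr
          calc _ ≤ ∑ x : ZMod Q, (1 : ℝ) := sum_le_sum fun x _ => pow_le_one₀ (norm_nonneg _) (hpb i x)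
            _ = Q := by rw [sum_const, nsmul_eq_mul, cardZ, mul_one]
      _ = _ := by simp; ring
  have hd9 : δ ^ 9 ≤ δ := by simpa using pown hδ hδ2 (show 1 ≤ 9 by norm_num)
  have hδ1 : δ ≤ 1 := by linarith
  have hεC : (0 : ℝ) < (δ ^ 9) ^ C := by positivity
  have hKC : 1 ≤ (δ ^ 9) ^ C * K := by
    refine hbig.trans ?_
    rw [← pow_mul]
    gcongr ?_ * _
    exact pown hδ hδ2 (by omega)
  have hK1 : (1 : ℝ) ≤ K := by
    have : (1 : ℕ) ≤ K := mod_cast hKr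
    exact_mod_cast this
  obtain ⟨ξ, hξ⟩ := largeSpec (fun ξ => ∑ i ∈ range R', ‖ft (p i) ξ‖ ^ 2) (fun ξ => by positivity)
    (fun ξ => ‖∑ r ∈ range R, (1 : ℂ) * ch (ξ * -(¶(m + q * r) ^ 2))‖) (fun ξ => norm_nonneg _)
    R (Q * Q * R') (δ ^ 4 / 16) ((δ ^ 9) ^ C) (fun ξ => by
      have := norm_sum_le_card (range R) (fun r => (1 : ℂ) * ch (ξ * -(¶(m + q * r) ^ 2))) 1 (fun r _ => by rw [one_mul, ch_norm])
      simpa using this) (by positivity) (by have := pow_le_one₀ hδ.le hδ1 (n := 4); linarith) hεC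
    (pow_le_one₀ (by positivity) (pow_le_one₀ hδ.le hδ1)) hPl (by
      refine le_of_mul_le_mul_left (le_trans (le_of_eq ?_) h6) hR'r
      ring) (by positivity) K (by
        have : §K ≤ K ^ 2 := by nlinarith
        calc 1 ≤ (δ ^ 9) ^ C * K := hKC
          _ ≤ _ := by gcongr) hQK (fun ξ hξ => by
      refine (hC (δ ^ 9) (by positivity) (by linarith) Q K R q m ξ 0 hq (le_trans (by gcongr) hδq) (le_trans (by gcongr) hKR) hm.le hKC ?_).1
      have e1 : ‖∑ r ∈ range R, e (0 * r) * ch (ξ * ¶(m + q * r) ^ 2)‖ = ‖∑ r ∈ range R, (1 : ℂ) * ch (ξ * -(¶(m + q * r) ^ 2))‖ := by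
        rw [← Complex.norm_conj, map_sum]
        congr 1
        refine sc fun r _ => ?_
        rw [map_mul, ch_conj, zero_mul, e_zero, map_one]; congr 2; ring
      rw [e1]
      refine le_trans ?_ hξ
      gcongr
      have := powc hδ hδ2 (c := 32) 5 (n := 9) (m := 4) (by norm_num) (by norm_num)
      linarith)
  obtain ⟨κ, hκ⟩ := vw f2 (fun z => conj (f2 (z + q * i')) * ch (ξ * z)) (fun z => bmul (bconj (h2 _)) (ch_norm _).le) R' hR' ¶q (δ ^ (18 + 27 * C)) (by positivity) (by
    have e1 : ∀ i ∈ range R', ‖ft (p i) ξ‖ ^ 2 ≤ Q * ‖∑ z, conj (f2 (z + q * i')) * ch (ξ * z) * f2 (z + q * i)‖ := by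
      intro i _
      have e2 : ft (p i) ξ = ∑ z, conj (f2 (z + q * i')) * ch (ξ * z) * f2 (z + q * i) := by
        unfold ft
        refine sc fun z _ => ?_
        simp only [hp]; ring
      rw [← e2, pow_two]
      gcongr
      unfold ft
      have := norm_sum_le_card univ (fun x => p i x * ch (ξ * x)) 1 (fun x _ => bmul (hpb i x) (ch_norm _).le)
      rwa [cardZ, mul_one] at this
    have e3 := sum_le_sum e1
    rw [← mul_sum] at e3
    refine le_of_mul_le_mul_left ?_ hQ
    refine le_trans ?_ e3
    have e4 : 264 * 32 * δ ^ (18 + 27 * C) ≤ δ ^ (4 + 27 * C) := powc hδ hδ2 14 (by norm_num) (by omega)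
    have e5 : 264 * 32 * δ ^ (18 + 27 * C) * (Q * Q * R') ≤ δ ^ (4 + 27 * C) * (Q * Q * R') := by gcongr
    have e6 : δ ^ (4 + 27 * C) = δ ^ 4 * ((δ ^ 9) ^ C) ^ 3 := by rw [← pow_mul, ← pow_mul, ← pow_add]; congr 1; ring
    rw [e6] at e5
    linarith)
  refine ⟨κ, ?_⟩
  rw [mul_comm 2, pow_mul]
  exact hκ

section
/-- `f` is an average of unimodular multiples of translates of `D` -/
def Avg {Q : ℕ} [NeZero Q] (f D : ZMod Q → ℂ) : Prop :=
  ∀ (ι : Type) (A : Finset ι) (k : ι → ℂ) (b : ι → ZMod Q), ∃ τ, ‖∑ a ∈ A, k a * f (b a)‖ ≤ ‖∑ a ∈ A, k a * D (b a + τ)‖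

section
variable {Q : ℕ} [NeZero Q]

lemma E1c (D : ZMod Q → ℂ) (hD : Bd D) (q P : ℕ) (hP : 0 < P) (θ η : ℝ)
    (h : η * Q * P ^ 2 ≤ ∑ z : ZMod Q, ‖∑ t ∈ range P, D (z + q * t) * e (θ * t)‖ ^ 2) :
    ∃ f : ZMod Q → ℂ, (Bd f) ∧ (∀ z, ∀ j : ℕ, ‖f (z + q * j) - e (-θ * j) * f z‖ ≤ 2 * j / P) ∧
      η * Q ≤ ‖∑ z, conj (D z) * f z‖ ∧ Avg f D := by
  have hPr : (0 : ℝ) < P := mod_cast hP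
  have hPc : (P : ℂ) ≠ 0 := mod_cast hP.ne'
  set g : ZMod Q → ℂ := fun z => (∑ t ∈ range P, D (z + q * t) * e (θ * t)) / P with hg
  have hgb : ∀ z, ‖g z‖ ≤ 1 := fun z => by
    simp only [hg, norm_div, Complex.norm_natCast]
    rw [div_le_one hPr]
    have := norm_sum_le_card (range P) (fun t => D (z + q * t) * e (θ * t)) 1 (fun t _ => bmul (hD _) (norm_e _).le)
    simpa using this
  let G : ZMod Q → ℤ → ℂ := fun z i => g (z - q * (i : ZMod Q)) * e (-θ * i)
  have hG : ∀ z i, ‖G z i‖ ≤ 1 := fun z i => bmul (hgb _) (norm_e _).le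
  have hfb : ∀ z, ‖(∑ i ∈ range P, G z i) / P‖ ≤ 1 := fun z => by
    simp only [norm_div, Complex.norm_natCast]
    rw [div_le_one hPr]
    have := norm_sum_le_card (range P) (fun i => G z i) 1 (fun t _ => hG _ _)
    simpa using this
  refine ⟨fun z => (∑ i ∈ range P, G z i) / P, hfb, ?_, ?_, ?_⟩
  · intro z j
    have h1 : ∑ i ∈ range P, G (z + q * j) i = e (-θ * j) * ∑ i ∈ range P, G z (i + (-(j : ℤ))) := by
      rw [mul_sum]
      refine sc fun i _ => ?_
      simp only [G]
      rw [mul_left_comm, ← e_add]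
      congr 1
      · congr 1; push_cast; ring
      · congr 1; push_cast; ring
    dsimp only
    rw [h1, mul_div_assoc, ← mul_sub, norm_mul, norm_e, one_mul, ← sub_div, norm_div, Complex.norm_natCast]
    gcongr
    refine (shift_bd (G z) (hG z) P _).trans ?_
    push_cast; rw [abs_neg, abs_of_nonneg (by positivity)]
  · have h1 : ∑ z, conj (D z) * ((∑ i ∈ range P, G z i) / P) = ((∑ z, ‖g z‖ ^ 2 : ℝ) : ℂ) := by
      have e1 : ∀ z, conj (D z) * ((∑ i ∈ range P, G z i) / P) = ∑ i ∈ range P, conj (D z) * G z i / P := by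
        intro z; rw [sum_div, mul_sum]; exact sc fun _ _ => by ring
      simp_rw [e1]
      rw [sum_comm]
      have e2 : ∀ i ∈ range P, ∑ z, conj (D z) * G z i / P = ∑ z : ZMod Q, g z * conj (D (z + q * i) * e (θ * i)) / P := by
        intro i _
        rw [← sum_translate (¶q * ¶i)]
        refine sc fun z _ => ?_
        simp only [G, map_mul, e_conj]
        push_cast
        rw [add_sub_cancel_right, neg_mul]; ring
      rw [sum_congr rfl e2, sum_comm]
      push_cast
      refine sc fun z _ => ?_
      rw [← sum_div, ← mul_sum, ← map_sum, mul_div_assoc, ← Complex.mul_conj']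
      congr 1
      simp only [hg, map_div₀, Complex.conj_natCast]
    rw [h1, Complex.norm_real, Real.norm_of_nonneg (by positivity)]
    have e3 : ∑ z, ‖g z‖ ^ 2 = (∑ z : ZMod Q, ‖∑ t ∈ range P, D (z + q * t) * e (θ * t)‖ ^ 2) / P ^ 2 := by
      rw [sum_div]
      refine sc fun z _ => ?_
      simp only [hg, norm_div, Complex.norm_natCast, div_pow]
    rw [e3, le_div_iff₀ (by positivity)]; exact h
  · intro ι A k b
    have h1 : ∑ a ∈ A, k a * ((∑ i ∈ range P, G (b a) i) / P) = (∑ i ∈ range P, ∑ t ∈ range P, e (θ * t) * e (-θ * i) * ∑ a ∈ A, k a * D (b a + ((q : ZMod Q) * t - q * i))) / P ^ 2 := by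
      have e0 : ∀ a ∈ A, k a * ((∑ i ∈ range P, G (b a) i) / P) = (∑ i ∈ range P, ∑ t ∈ range P, e (θ * t) * e (-θ * i) * (k a * D (b a + ((q : ZMod Q) * t - q * i)))) / P ^ 2 := by
        intro a _
        rw [pow_two, ← div_div, mul_div_assoc', mul_sum]
        congr 1
        rw [sum_div]
        refine sc fun i _ => ?_
        simp only [G, hg]
        rw [div_mul_eq_mul_div, mul_div_assoc', sum_mul, mul_sum]
        congr 1
        refine sc fun t _ => ?_
        push_cast
        rw [show b a - (q : ZMod Q) * (i : ZMod Q) + q * t = b a + ((q : ZMod Q) * (t : ZMod Q) - q * i) by ring]; ring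
      rw [sum_congr rfl e0, ← sum_div]
      congr 1
      rw [sum_comm]
      refine sc fun i _ => ?_
      rw [sum_comm]
      refine sc fun t _ => ?_
      rw [mul_sum]
    obtain ⟨i, hi, h2⟩ := pigeonR hP _ (P * ‖∑ a ∈ A, k a * ((∑ i ∈ range P, G (b a) i) / P)‖) (by
      refine le_trans (le_of_eq ?_) (norm_sum_le (range P) (fun i => ∑ t ∈ range P, e (θ * t) * e (-θ * i) * ∑ a ∈ A, k a * D (b a + ((q : ZMod Q) * t - q * i))))
      rw [h1, norm_div, norm_pow, Complex.norm_natCast]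
      field_simp)
    obtain ⟨t, ht, h3⟩ := pigeonR hP _ _ (h2.trans (norm_sum_le _ _))
    rw [norm_mul, norm_mul, norm_e, norm_e, one_mul, one_mul] at h3
    exact ⟨_, h3⟩

set_option maxHeartbeats 1000000 in
lemma E2 (f0 c f : ZMod Q → ℂ) (h0 : Bd f0) (hc : Bd c) (hf : Bd f) (β : ZMod Q → ℝ)
    (K R q a0 H T : ℕ) (η : ℝ) (hη : 0 < η) (hη2 : η ≤ 1 / 2) (hR : 0 < R) (hK : 0 < K) (hT : 0 < T)
    (hH : 64 ≤ η ^ 4 * H) (ha0 : 16 * (a0 * H : ℝ) ≤ η ^ 2 * R) (hTR : 160 * (T * H ^ 2 : ℝ) ≤ η ^ 4 * R)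
    (h : η * Q * K * R ≤ ‖∑ z, DD f0 c β q K R z * f z‖) :
    ∃ l1 l2 : ℕ, 1 ≤ l1 ∧ l1 < H ∧ 1 ≤ l2 ∧ l2 < H ∧ ∃ (d : ZMod Q) (κ : ZMod Q → ℕ → ℝ),
      η ^ 16 * Q * T ^ 2 ≤ ∑ x : ZMod Q, ∑ s ∈ range T, ‖∑ t ∈ range (2 * T),
        f (x + ((q * (2 * q * a0 * l1 * l2 * (l1 + l2)) * t : ℕ) : ZMod Q)) *
          conj (f (x + d + ((q * (2 * q * a0 * l1 * l2 * (l1 + l2)) * (s + t) : ℕ) : ZMod Q))) * e (κ x s * t)‖ := by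
  have hQ : 0 < §Q := Qpos
  rw [psi_eq] at h
  obtain ⟨m, hm, h1⟩ := pigeonR hK _ (η * Q * R) (le_trans (le_of_eq (by ring)) (h.trans (norm_sum_le _ _)))
  let y : ℤ → ZMod Q := fun r => (m : ZMod Q) + q * (r : ZMod Q)
  let G : ZMod Q → ℤ → ℂ := fun x r => f (x + y r ^ 2) * e (β (x + m) * r)
  have hG : ∀ x r, ‖G x r‖ ≤ 1 := fun x r => bmul (hf _) (norm_e _).le
  have h2 : η * #(univ : Finset (ZMod Q)) * R ≤ ∑ x, ‖∑ r ∈ range R, G x r‖ := by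
    rw [cardZ]
    refine h1.trans ((norm_sum_le _ _).trans (sum_le_sum fun x _ => ?_))
    have : ∑ r ∈ range R, f0 x * c (x + m) * e (β (x + m) * r) * f (x + ¶(m + q * r) ^ 2)
        = (f0 x * c (x + m)) * ∑ r ∈ range R, G x r := by
      rw [mul_sum]
      refine sc fun r _ => ?_
      simp only [G, y]; push_cast; ring
    rw [this, norm_mul]
    exact mul_le_of_le_one_left (norm_nonneg _) (bmul (h0 _) (hc _))
  have hη4 : η ^ 4 ≤ η ^ 2 := pown hη hη2 (by norm_num)
  have hη1 : η ^ 2 ≤ η := by simpa using pown hη hη2 (show 1 ≤ 2 by norm_num)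
  obtain ⟨j1, l1, hj1, hl1, hl1', h3⟩ := vdc univ G hG η hη (by linarith) R a0 H
    (by
      have : η ^ 2 * R ≤ η * R := by gcongr
      have : (0 : ℝ) ≤ a0 * H := by positivity
      linarith) (by
      have : η ^ 4 * H ≤ η ^ 2 * H := by gcongr
      linarith) h2
  let G2 : ZMod Q → ℤ → ℂ := fun x r => f (x + y (r + (a0 * j1 : ℕ)) ^ 2) * conj (f (x + y (r + (a0 * j1 : ℕ) + (a0 * l1 : ℕ)) ^ 2))
  have hG2 : ∀ x r, ‖G2 x r‖ ≤ 1 := fun x r => bmul (hf _) (bconj (hf _))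
  have h4 : η ^ 2 / 2 * #(univ : Finset (ZMod Q)) * R ≤ ∑ x, ‖∑ r ∈ range R, G2 x r‖ := by
    refine h3.trans ((norm_sum_le _ _).trans (sum_le_sum fun x _ => ?_))
    have : ∑ r ∈ range R, G x (r + (a0 * j1 : ℕ)) * conj (G x (r + (a0 * j1 : ℕ) + (a0 * l1 : ℕ)))
        = e (-(β (x + m) * (a0 * l1 : ℕ))) * ∑ r ∈ range R, G2 x r := by
      rw [mul_sum]
      refine sc fun r _ => ?_
      simp only [G, G2, map_mul, e_conj]
      rw [show ∀ a b c d : ℂ, a * b * (c * d) = (b * d) * (a * c) by intros; ring, ← e_add]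
      congr 2; push_cast; ring
    rw [this, norm_mul, norm_e, one_mul]
  obtain ⟨j2, l2, hj2, hl2, hl2', h5⟩ := vdc univ G2 hG2 (η ^ 2 / 2) (by positivity) (by nlinarith) R a0 H
    (by linarith) (by ring_nf; linarith) h4
  refine ⟨l1, l2, hl1, hl1', hl2, hl2', ?_⟩
  rw [cardZ] at h5
  let y0 : ZMod Q := (m : ZMod Q) + q * ((a0 * j1 : ℕ) + (a0 * j2 : ℕ))
  let A : ZMod Q := q * (a0 * l1 : ℕ)
  let B : ZMod Q := q * (a0 * l2 : ℕ)
  let κ1 : ℤ := 2 * q ^ 2 * a0 * l1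
  let κ2 : ℤ := 2 * q ^ 2 * a0 * l2
  let κ3 : ℤ := 2 * q ^ 2 * a0 * (l1 + l2)
  have h6 : ∑ x, ∑ r ∈ range R, G2 x (r + (a0 * j2 : ℕ)) * conj (G2 x (r + (a0 * j2 : ℕ) + (a0 * l2 : ℕ)))
     = ∑ x, ∑ r ∈ range R, f x * (conj (f (x + (κ1 : ZMod Q) * (r : ℤ) + (2 * A * y0 + A ^ 2)))) *
        (conj (f (x + (κ2 : ZMod Q) * (r : ℤ) + (2 * B * y0 + B ^ 2)))) *
        f (x + (κ3 : ZMod Q) * (r : ℤ) + (2 * (A + B) * y0 + (A + B) ^ 2)) := by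
    rw [sum_comm, sum_comm (s := univ) (t := range R)]
    refine sc fun r _ => ?_
    rw [← sum_translate (-(y (r + (a0 * j2 : ℕ) + (a0 * j1 : ℕ)) ^ 2))]
    refine sc fun x _ => ?_
    simp only [G2, map_mul, Complex.conj_conj]
    rw [mul_comm (conj (f _)) (f _), ← mul_assoc]
    have hh : ∀ a b c d a' b' c' d' : ZMod Q, a = a' → b = b' → c = c' → d = d' →
        f a * conj (f b) * f c * conj (f d) = f a' * conj (f b') * conj (f d') * f c' := by
      rintro a b c d _ _ _ _ rfl rfl rfl rfl; ring
    rw [mul_assoc, mul_assoc, ← mul_assoc, ← mul_assoc]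
    apply hh
    all_goals
      simp only [y, κ1, κ2, κ3, y0, A, B]
      push_cast; ring
  rw [h6] at h5
  have hl1r : (l1 : ℝ) ≤ H := mod_cast hl1'.le
  have hl2r : (l2 : ℝ) ≤ H := mod_cast hl2'.le
  obtain ⟨d, κ, h7⟩ := l4 f (fun x => conj (f (x + (2 * A * y0 + A ^ 2)))) (fun x => conj (f (x + (2 * B * y0 + B ^ 2))))
    (fun x => f (x + (2 * (A + B) * y0 + (A + B) ^ 2))) hf (fun x => bconj (hf _)) (fun x => bconj (hf _)) (fun x => hf _)
    κ1 κ2 κ3 (l1 * l2) (l1 * (l1 + l2)) (l2 * (l1 + l2)) (q * (2 * q * a0 * l1 * l2 * (l1 + l2)) : ℕ)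
    (by simp only [κ3]; push_cast; ring) (by simp only [κ3, κ1]; push_cast; ring) (by simp only [κ3, κ2]; push_cast; ring)
    R T hR hT (η ^ 4 / 8) (by positivity) (by
      push_cast
      rw [abs_of_nonneg (by positivity), abs_of_nonneg (by positivity), abs_of_nonneg (by positivity)]
      have e1 : (l1 : ℝ) * l2 + l1 * (l1 + l2) + l2 * (l1 + l2) ≤ 5 * H ^ 2 := by
        calc (l1 : ℝ) * l2 + l1 * (l1 + l2) + l2 * (l1 + l2) ≤ H * H + H * (H + H) + H * (H + H) := by gcongr
          _ = _ := by ring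
      calc 4 * (§T * (l1 * l2 + l1 * (l1 + l2) + l2 * (l1 + l2))) ≤ 4 * (T * (5 * H ^ 2)) := by gcongr
        _ ≤ η ^ 4 / 8 * R := by linarith) (le_trans (le_of_eq (by ring)) h5)
  refine ⟨d, fun x s => κ (x - (2 * (A + B) * y0 + (A + B) ^ 2)) s, ?_⟩
  have e2 : η ^ 16 * Q * T ^ 2 ≤ (η ^ 4 / 8) ^ 2 / 4 * Q * T ^ 2 := by
    gcongr
    have := powc hη hη2 (c := 256) 8 (n := 16) (m := 8) (by norm_num) (by norm_num)
    nlinarith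
  refine e2.trans (h7.trans (le_of_eq ?_))
  conv_rhs => rw [← sum_translate (2 * (A + B) * y0 + (A + B) ^ 2)]
  refine sc fun x _ => sc fun s _ => ?_
  congr 1
  refine sc fun t _ => ?_
  dsimp only
  rw [add_sub_cancel_right]
  have hh : ∀ (a b a' b' : ZMod Q) (w : ℂ), a = a' → b = b' → f a * conj (f b) * w = f a' * conj (f b') * w := by
    rintro a b _ _ w rfl rfl; rfl
  apply hh
  · push_cast; ring
  · push_cast; ring

end
end

section
section
variable {Q : ℕ} [NeZero Q]

lemma grid_inj (q σ w n : ℕ) (hw : w ≤ σ) (hq : 0 < q) (h : q * (n * σ) ≤ Q) (x : ZMod Q) :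
    Set.InjOn (fun a : ℕ × ℕ => x + ¶(q * (σ * a.1 + a.2))) (range n ×ˢ range w : Finset (ℕ × ℕ)) := by
  rintro ⟨t, j⟩ ha ⟨t', j'⟩ ha' hh
  simp only [coe_product, coe_range, Set.mem_prod, Set.mem_Iio] at ha ha'
  replace ha := And.intro ha.1 (ha.2.trans_le hw)
  replace ha' := And.intro ha'.1 (ha'.2.trans_le hw)
  have key : ∀ t j, t < n ∧ j < σ → σ * t + j < n * σ := by
    rintro t j ⟨h1, h2⟩
    calc σ * t + j < σ * t + σ := by omega
      _ = (t + 1) * σ := by ring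
      _ ≤ n * σ := Nat.mul_le_mul_right _ h1
  have hlt : ∀ t j, t < n ∧ j < σ → q * (σ * t + j) < Q := fun t j h' =>
    lt_of_lt_of_le (Nat.mul_lt_mul_of_pos_left (key t j h') hq) h
  have h1 := add_left_cancel hh
  have h2 := cast_injOn Q le_rfl (by simpa using hlt t j ha) (by simpa using hlt t' j' ha') h1
  have h3 := Nat.eq_of_mul_eq_mul_left hq h2
  have hj : j = j' := by
    have := congrArg (· % σ) h3
    simpa [Nat.mul_add_mod, Nat.mod_eq_of_lt ha.2, Nat.mod_eq_of_lt ha'.2] using this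
  subst hj
  have : σ * t = σ * t' := by simpa using h3
  have hσ : 0 < σ := by omega
  rw [Nat.eq_of_mul_eq_mul_left hσ this]

set_option maxHeartbeats 1000000 in
lemma fill (p : ZMod Q → ℂ) (hp : ∀ x, ‖p x‖ ≤ 1) (q σ w T : ℕ) (hw : 0 < w) (hwσ : w ≤ σ) (hq : 0 < q) (hQ : q * (2 * T * σ) ≤ Q)
    (θ κ ε η : ℝ) (hη : 0 < η) (hη2 : η ≤ 1 / 2) (hε : 16 * ε ≤ η)
    (hper : ∀ z, ∀ j < w, ‖p (z + (q : ZMod Q) * (j : ZMod Q)) - e (θ * j) * p z‖ ≤ ε) (x : ZMod Q) (hT : 32 ≤ η * T)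
    (h : η * T ≤ ‖∑ t ∈ range (2 * T), p (x + ((q * σ * t : ℕ) : ZMod Q)) * e (κ * t)‖) :
    ∃ ξ, η ^ 2 / 16 * T * w ≤ ‖ft p ξ‖ := by
  have hTp : (0 : ℝ) < T := by
    by_contra h'
    have : η * T ≤ 0 := mul_nonpos_of_nonneg_of_nonpos hη.le (not_lt.mp h')
    linarith
  have hσr : (0 : ℝ) < w := by exact_mod_cast hw
  set I := ⌊η * T / 16⌋₊ with hI
  have hI1 : (I : ℝ) ≤ η * T / 16 := Nat.floor_le (by positivity)
  have hI2 : η * T / 32 ≤ I := by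
    have := Nat.lt_floor_add_one (η * T / 16)
    rw [← hI] at this; linarith
  have hIT : I ≤ 2 * T := by
    have : (I : ℝ) ≤ 2 * T := by nlinarith
    exact_mod_cast this
  by_contra hcon
  push Not at hcon
  have hk := klem (range (2 * T) ×ˢ range w) (fun a => 0 + ((q * (σ * a.1 + a.2) : ℕ) : ZMod Q)) (grid_inj q σ w (2 * T) hwσ hq hQ 0)
    (fun a => e (κ * a.1) * e (-(θ * a.2))) (fun a => bmul (norm_e _).le (norm_e _).le) p _ (fun ξ => (hcon ξ).le)
  set F : ZMod Q → ℂ := fun z => ∑ a ∈ range (2 * T) ×ˢ range w, e (κ * a.1) * e (-(θ * a.2)) * p (z + (0 + ((q * (σ * a.1 + a.2) : ℕ) : ZMod Q))) with hF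
  have hlow : ∀ b ∈ range I ×ˢ range w, w * (η * T / 2) ≤ ‖F (x + ((q * (σ * b.1 + b.2) : ℕ) : ZMod Q))‖ := by
    rintro ⟨i, j0⟩ hb
    simp only [mem_product, mem_range] at hb
    let G : ℤ → ℂ := fun n => p (x + ((q * σ : ℕ) : ZMod Q) * (n : ZMod Q)) * e (κ * n)
    have hG : ∀ n, ‖G n‖ ≤ 1 := fun n => bmul (hp _) (norm_e _).le
    have h1 := shift_bd G hG (2 * T) i
    have h2 : η * T ≤ ‖∑ t ∈ range (2 * T), G t‖ := by
      refine h.trans (le_of_eq ?_)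
      congr 1
      refine Finset.sum_congr rfl fun t _ => ?_
      simp only [G]; push_cast; rfl
    have hmain : ∑ a ∈ range (2 * T) ×ˢ range w, e (κ * a.1) * e (θ * j0) * p (x + ((q * (σ * (i + a.1)) : ℕ) : ZMod Q))
        = w * (e (θ * j0) * e (-(κ * i)) * ∑ t ∈ range (2 * T), G (t + i)) := by
      rw [Finset.sum_product]
      simp only [sum_const, card_range, nsmul_eq_mul]
      rw [← Finset.mul_sum, Finset.mul_sum (a := e (θ * j0) * e (-(κ * i)))]
      congr 1
      refine Finset.sum_congr rfl fun t _ => ?_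
      simp only [G]
      have e1 : e (κ * t) = e (-(κ * i)) * e (κ * ((t + i : ℤ) : ℝ)) := by rw [← e_add]; congr 1; push_cast; ring
      rw [e1]
      have e2 : ((q * (σ * (i + t)) : ℕ) : ZMod Q) = ((q * σ : ℕ) : ZMod Q) * ((t + i : ℤ) : ZMod Q) := by push_cast; ring
      rw [e2]; ring
    have herr : ‖F (x + ((q * (σ * i + j0) : ℕ) : ZMod Q)) - ∑ a ∈ range (2 * T) ×ˢ range w, e (κ * a.1) * e (θ * j0) * p (x + ((q * (σ * (i + a.1)) : ℕ) : ZMod Q))‖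
        ≤ 2 * T * w * (2 * ε) := by
      simp only [hF]
      rw [← Finset.sum_sub_distrib]
      refine (norm_sum_le_card _ _ (2 * ε) fun a ha => ?_).trans (le_of_eq (by simp [Finset.card_product]))
      simp only [mem_product, mem_range] at ha
      set v := x + ((q * (σ * (i + a.1)) : ℕ) : ZMod Q) with hv
      have e1 : x + ((q * (σ * i + j0) : ℕ) : ZMod Q) + (0 + ((q * (σ * a.1 + a.2) : ℕ) : ZMod Q)) = v + (q : ZMod Q) * (j0 : ZMod Q) + (q : ZMod Q) * (a.2 : ZMod Q) := by
        rw [hv]; push_cast; ring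
      rw [e1]
      have d1 := hper (v + (q : ZMod Q) * (j0 : ZMod Q)) a.2 ha.2
      have d2 := hper v j0 hb.2
      have e2 : e (κ * a.1) * e (-(θ * a.2)) * p (v + (q : ZMod Q) * (j0 : ZMod Q) + (q : ZMod Q) * (a.2 : ZMod Q)) - e (κ * a.1) * e (θ * j0) * p v
         = e (κ * a.1) * e (-(θ * a.2)) * (p (v + (q : ZMod Q) * (j0 : ZMod Q) + (q : ZMod Q) * (a.2 : ZMod Q)) - e (θ * a.2) * p (v + (q : ZMod Q) * (j0 : ZMod Q)))
          + e (κ * a.1) * (p (v + (q : ZMod Q) * (j0 : ZMod Q)) - e (θ * j0) * p v) := by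
        have : e (-(θ * a.2)) * e (θ * a.2) = 1 := by rw [← e_add, neg_add_cancel, e_zero]
        linear_combination (e (κ * a.1) * p (v + (q : ZMod Q) * (j0 : ZMod Q))) * this
      rw [e2]
      refine (norm_add_le _ _).trans ?_
      rw [norm_mul, norm_mul, norm_mul, norm_e, norm_e, one_mul, one_mul, one_mul]
      linarith
    rw [hmain] at herr
    have h3 : (w : ℝ) * (η * T - 2 * I) ≤ ‖(w : ℂ) * (e (θ * j0) * e (-(κ * i)) * ∑ t ∈ range (2 * T), G (t + i))‖ := by
      rw [norm_mul, norm_mul, norm_mul, norm_e, norm_e, one_mul, one_mul, Complex.norm_natCast]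
      gcongr
      have h4 := norm_sub_norm_le (∑ t ∈ range (2 * T), G t) (∑ t ∈ range (2 * T), G (t + i))
      rw [norm_sub_rev] at h4
      have hiI : (i : ℝ) ≤ I := by exact_mod_cast hb.1.le
      simp only [Int.cast_natCast, Nat.abs_cast] at h1
      linarith
    have h5 := norm_sub_norm_le ((w : ℂ) * (e (θ * j0) * e (-(κ * i)) * ∑ t ∈ range (2 * T), G (t + i))) (F (x + ((q * (σ * i + j0) : ℕ) : ZMod Q)))
    rw [norm_sub_rev] at h5
    have h6 : (w : ℝ) * (η * T - 2 * I) - 2 * T * w * (2 * ε) ≥ w * (η * T / 2) := by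
      have : 2 * (I : ℝ) + 2 * T * (2 * ε) ≤ η * T / 2 := by nlinarith
      nlinarith
    linarith
  have hsum : (#(range I ×ˢ range w) : ℝ) * (w * (η * T / 2)) ^ 2 ≤ ∑ z, ‖F z‖ ^ 2 := by
    calc _ = ∑ b ∈ range I ×ˢ range w, (w * (η * T / 2) : ℝ) ^ 2 := by rw [sum_const, nsmul_eq_mul]
      _ ≤ ∑ b ∈ range I ×ˢ range w, ‖F (x + ((q * (σ * b.1 + b.2) : ℕ) : ZMod Q))‖ ^ 2 :=
          Finset.sum_le_sum fun b hb => pow_le_pow_left₀ (by positivity) (hlow b hb) 2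
      _ = ∑ z ∈ (range I ×ˢ range w).image (fun b : ℕ × ℕ => x + ((q * (σ * b.1 + b.2) : ℕ) : ZMod Q)), ‖F z‖ ^ 2 := by
          rw [Finset.sum_image (grid_inj q σ w I hwσ hq (le_trans (by gcongr) hQ) x)]
      _ ≤ _ := Finset.sum_le_sum_of_subset_of_nonneg (Finset.subset_univ _) fun _ _ _ => by positivity
  have hfin := hsum.trans hk
  rw [Finset.card_product, Finset.card_product, card_range, card_range, card_range] at hfin
  push_cast at hfin
  have h7 : η * T / 32 * w * (w * (η * T / 2)) ^ 2 ≤ (2 * T * w) * (η ^ 2 / 16 * T * w) ^ 2 := le_trans (by gcongr) hfin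
  have h8 : η ^ 3 * (T ^ 3 * w ^ 3 / 128) ≤ η ^ 4 * (T ^ 3 * w ^ 3 / 128 : ℝ) := by nlinarith
  have h9 := le_of_mul_le_mul_right h8 (by positivity)
  have h10 : η ^ 3 > 0 := by positivity
  nlinarith

end
end

set_option maxHeartbeats 1000000 in
lemma E3a : ∃ C : ℕ, 2 ≤ C ∧ ∀ (η : ℝ), 0 < η → η ≤ 1 / 2 → ∀ (Q : ℕ) [NeZero Q] (K R q T : ℕ)
    (f0 c g : ZMod Q → ℂ) (_ : Bd f0) (_ : Bd c) (_ : Bd g) (β : ZMod Q → ℝ)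
    (n ξ : ℕ → ZMod Q) (w : ℕ → ℂ) (_ : ∀ s, ‖w s‖ ≤ 1),
    0 < q → η * q ≤ 1 → η * K ≤ R → 1 ≤ η ^ C * K → §Q ≤ 16 * K ^ 2 → 0 < T →
    η * T * Q * K * R ≤ ‖∑ s ∈ range T, ∑ z, w s * g z * ch (ξ s * z) * DD f0 c β q K R (z + n s)‖ →
    ∃ ξ0 : ZMod Q, ∃ S ⊆ range T, η ^ C * T ≤ #S ∧ ∀ s ∈ S, ξ s = ξ0 ∧ w s ≠ 0 := by
  classical
  obtain ⟨C, hC2, hC⟩ := psiWeyl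
  refine ⟨9 * C + 12, by omega, fun η hη hη2 Q _ K R q T f0 c g h0 hc hg β n ξ w hw hq hηq hKR hbig hQK hT h => ?_⟩
  have hKr : 0 < §K := by
    by_contra hR
    have : §K = 0 := le_antisymm (not_lt.mp hR) (Nat.cast_nonneg _)
    rw [this] at hbig; norm_num at hbig
  have hR : 0 < §R := lt_of_lt_of_le (by positivity) hKR
  have hQ : 0 < §Q := Qpos
  have hTr : 0 < §T := mod_cast hT
  let Φ : ZMod Q → ℕ → ℕ → ℂ := fun z m r => f0 (z - ¶(m + q * r) ^ 2) *
    c (z - ((m + q * r : ℕ) : ZMod Q) ^ 2 + m) * e (β (z - ((m + q * r : ℕ) : ZMod Q) ^ 2 + m) * r)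
  set Y : Finset (ZMod Q × ℕ × ℕ) := univ ×ˢ range K ×ˢ range R with hY
  have hYc : (#Y : ℝ) = Q * K * R := by
    rw [hY, card_product, card_product]; push_cast; rw [cardZ, card_range, card_range, mul_assoc]
  have h1 : ∑ s ∈ range T, ∑ z, w s * g z * ch (ξ s * z) * DD f0 c β q K R (z + n s)
      = ∑ y ∈ Y, g y.1 * ∑ s ∈ range T, w s * ch (ξ s * y.1) * Φ (y.1 + n s) y.2.1 y.2.2 := by
    rw [sum_comm, hY, sum_product]
    refine sc fun z _ => ?_
    dsimp only
    rw [← mul_sum, sum_comm (s := range K ×ˢ range R), mul_sum]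
    refine sc fun s _ => ?_
    rw [← mul_sum, sum_product]
    unfold DD
    simp only [Φ]; ring
  rw [h1] at h
  have hcs := cs_bdd Y (fun y => g y.1) (fun y => ∑ s ∈ range T, w s * ch (ξ s * y.1) * Φ (y.1 + n s) y.2.1 y.2.2) (fun y _ => hg _)
  have hss := sumsq_le Y (range T) (fun y s => w s * ch (ξ s * y.1) * Φ (y.1 + n s) y.2.1 y.2.2)
  rw [hYc] at hcs
  have h3 := (pow_le_pow_left₀ (by positivity) h 2).trans (hcs.trans (mul_le_mul_of_nonneg_left hss (by positivity)))
  rw [sum_comm] at h3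
  obtain ⟨s', hs', h4⟩ := pigeonR hT _ (η ^ 2 * T * (Q * K * R)) (by
    refine le_of_mul_le_mul_left (le_trans (le_of_eq ?_) h3) (show 0 < §Q * K * R by positivity)
    ring)
  set N : ℕ → ℝ := fun s => ‖∑ y ∈ Y, w s * ch (ξ s * y.1) * Φ (y.1 + n s) y.2.1 y.2.2 * conj (w s' * ch (ξ s' * y.1) * Φ (y.1 + n s') y.2.1 y.2.2)‖ with hN
  have hΦ : ∀ z m r, ‖Φ z m r‖ ≤ 1 := fun z m r => bmul (bmul (h0 _) (hc _)) (norm_e _).le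
  have hNb : ∀ s ∈ range T, N s ≤ Q * K * R := fun s _ => by
    have := norm_sum_le_card Y (fun y => w s * ch (ξ s * y.1) * Φ (y.1 + n s) y.2.1 y.2.2 * conj (w s' * ch (ξ s' * y.1) * Φ (y.1 + n s') y.2.1 y.2.2)) 1
      (fun y _ => bmul (bmul (bmul (hw _) (ch_norm _).le) (hΦ _ _ _)) (bconj (bmul (bmul (hw _) (ch_norm _).le) (hΦ _ _ _))))
    rwa [hYc, mul_one] at this
  have h5 := popular (range T) N (η ^ 2) (Q * K * R) (by positivity) (by positivity) hNb (by rw [card_range]; exact h4)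
  set S1 := (range T).filter (fun s => η ^ 2 / 2 * (Q * K * R) ≤ N s) with hS1
  have hη3 : η ^ 3 ≤ η ^ 2 / 2 := by
    have : η ^ 2 * η ≤ η ^ 2 * (1 / 2) := by gcongr
    nlinarith
  have hη3' : η ^ 3 ≤ η := by simpa using pown hη hη2 (show 1 ≤ 3 by norm_num)
  have hK3 : 1 ≤ (η ^ 3) ^ C * K := by
    refine hbig.trans ?_
    rw [← pow_mul]; gcongr ?_ * _; exact pown hη hη2 (by omega)
  have hprop : ∀ s ∈ S1, MajQ ((η ^ 3) ^ C) K (ξ s - ξ s') ∧ w s ≠ 0 := by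
    intro s hs
    simp only [hS1, mem_filter] at hs
    have hs2 := hs.2
    have e1 : ∑ y ∈ Y, w s * ch (ξ s * y.1) * Φ (y.1 + n s) y.2.1 y.2.2 * conj (w s' * ch (ξ s' * y.1) * Φ (y.1 + n s') y.2.1 y.2.2)
       = (w s * conj (w s')) * ∑ z, DD (fun x => f0 (x + n s) * conj (f0 (x + n s'))) (fun x => c (x + n s) * conj (c (x + n s')))
          (fun x => β (x + n s) - β (x + n s')) q K R z * ch ((ξ s - ξ s') * z) := by
      rw [hY, sum_product, mul_sum]
      refine sc fun z _ => ?_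
      unfold DD
      rw [sum_product, sum_mul, mul_sum]
      refine sc fun m _ => ?_
      rw [sum_mul, mul_sum]
      refine sc fun r _ => ?_
      simp only [Φ, map_mul, ch_conj, e_conj]
      have b1 : ch ((ξ s - ξ s') * z) = ch (ξ s * z) * ch (-(ξ s' * z)) := by rw [← ch_add]; congr 1; ring
      have b2 : ∀ a b : ℝ, e ((a - b) * r) = e (a * r) * e (-(b * r)) := fun a b => by rw [← e_add]; congr 1; ring
      rw [b1, b2]
      have a1 : ∀ k, z + n k - ¶(m + q * r) ^ 2 = z - ¶(m + q * r) ^ 2 + n k := fun k => by ring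
      have a2 : ∀ k, z - ((m + q * r : ℕ) : ZMod Q) ^ 2 + n k + m = z - ((m + q * r : ℕ) : ZMod Q) ^ 2 + m + n k := fun k => by ring
      simp only [a1, a2]; ring
    simp only [hN] at hs2
    rw [e1, norm_mul] at hs2
    have hw0 : w s ≠ 0 := by
      intro h0
      rw [h0] at hs2; simp at hs2
      have : 0 < η ^ 2 / 2 * (Q * K * R) := by positivity
      linarith
    refine ⟨(hC (η ^ 3) (by positivity) (by linarith) Q K R q (ξ s - ξ s') (fun x => f0 (x + n s) * conj (f0 (x + n s'))) (fun x => c (x + n s) * conj (c (x + n s'))) (fun x => bmul (h0 _) (bconj (h0 _))) (fun x => bmul (hc _) (bconj (hc _))) (fun x => β (x + n s) - β (x + n s')) hq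
      (le_trans (by gcongr) hηq) (le_trans (by gcongr) hKR) hK3 ?_).1, hw0⟩
    have := hs2.trans (mul_le_of_le_one_left (norm_nonneg _) (bmul (hw s) (bconj (hw s'))))
    refine le_trans ?_ this
    calc η ^ 3 * Q * K * R = η ^ 3 * (Q * K * R) := by ring
      _ ≤ _ := by gcongr
  rw [card_range] at h5
  have hS1ne : S1.Nonempty := by
    rw [← card_pos]
    have : (0 : ℝ) < #S1 := lt_of_lt_of_le (by positivity) h5
    exact_mod_cast this
  have hcount := maj_count ((η ^ 3) ^ C) (by positivity) (pow_le_one₀ (by positivity) (by linarith)) K (by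
      have hK1 : (1 : ℝ) ≤ K := by
        have : (1 : ℕ) ≤ K := mod_cast hKr
        exact_mod_cast this
      have : §K ≤ K ^ 2 := by nlinarith
      calc 1 ≤ (η ^ 3) ^ C * K := hK3
        _ ≤ _ := by gcongr) hQK (S1.image (fun s => ξ s - ξ s')) (by
      intro x hx
      obtain ⟨s, hs, rfl⟩ := mem_image.mp hx
      exact (hprop s hs).1)
  have hfib : (#S1 : ℝ) = ∑ b ∈ S1.image (fun s => ξ s - ξ s'), (#{a ∈ S1 | ξ a - ξ s' = b} : ℝ) := by
    exact_mod_cast card_eq_sum_card_image (fun s => ξ s - ξ s') S1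
  obtain ⟨b, -, hb⟩ := pigeon (hS1ne.image _) (fun b => (#{a ∈ S1 | ξ a - ξ s' = b} : ℝ)) (η ^ (9 * C + 12) * T) (by
    rw [← hfib]
    refine le_trans ?_ h5
    have e1 : 264 * 2 * η ^ (9 * C + 12) ≤ η ^ (9 * C + 2) := powc hη hη2 10 (by norm_num) (by omega)
    have e2 : η ^ (9 * C + 2) = η ^ 2 * ((η ^ 3) ^ C) ^ 3 := by rw [← pow_mul, ← pow_mul, ← pow_add]; congr 1; ring
    have hpos : (0 : ℝ) < ((η ^ 3) ^ C) ^ 3 := by positivity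
    refine le_of_mul_le_mul_right ?_ (show (0 : ℝ) < 264 * 2 by norm_num)
    have e3 : η ^ (9 * C + 12) * (264 * 2) ≤ η ^ 2 * ((η ^ 3) ^ C) ^ 3 := by rw [← e2]; linarith
    have hc0 : (0 : ℝ) ≤ #(S1.image (fun s => ξ s - ξ s')) := by positivity
    calc (#(S1.image (fun s => ξ s - ξ s')) : ℝ) * (η ^ (9 * C + 12) * T) * (264 * 2)
        = #(S1.image (fun s => ξ s - ξ s')) * (η ^ (9 * C + 12) * (264 * 2)) * T := by ring
      _ ≤ #(S1.image (fun s => ξ s - ξ s')) * (η ^ 2 * ((η ^ 3) ^ C) ^ 3) * T := by gcongr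
      _ = (#(S1.image (fun s => ξ s - ξ s')) * ((η ^ 3) ^ C) ^ 3) * η ^ 2 * T := by ring
      _ ≤ 264 * η ^ 2 * T := by gcongr
      _ = _ := by ring)
  refine ⟨b + ξ s', {a ∈ S1 | ξ a - ξ s' = b}, ?_, hb, ?_⟩
  · exact (filter_subset _ _).trans (filter_subset _ _)
  · intro s hs
    rw [mem_filter] at hs
    exact ⟨by rw [← hs.2]; ring, (hprop s hs.1).2⟩

lemma Kpos {δ : ℝ} {C K : ℕ} (h : 1 ≤ δ ^ C * K) : 0 < §K := by
  by_contra hR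
  have : §K = 0 := le_antisymm (not_lt.mp hR) (Nat.cast_nonneg _)
  rw [this] at h; norm_num at h

lemma bigmono {δ : ℝ} {C K : ℕ} (hδ : 0 < δ) (hδ2 : δ ≤ 1 / 2) (h : 1 ≤ δ ^ C * K) {C' : ℕ} (hC : C' ≤ C) : 1 ≤ δ ^ C' * K :=
  h.trans (mul_le_mul_of_nonneg_right (pown hδ hδ2 hC) (Nat.cast_nonneg _))

lemma ENa : ∃ A : ℕ, 7 ≤ A ∧ ∀ (δ : ℝ), 0 < δ → δ ≤ 1 / 2 → ∀ (Q : ℕ) [NeZero Q] (K R q : ℕ)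
    (f0 c f2 : ZMod Q → ℂ) (_ : Bd f0) (_ : Bd c) (_ : Bd f2) (β : ZMod Q → ℝ),
    0 < q → δ * q ≤ 1 → δ * K ≤ R → 1 ≤ δ ^ A * K → §Q ≤ 16 * K ^ 2 →
    δ * Q * K * R ≤ ‖∑ z, DD f0 c β q K R z * f2 z‖ →
    ∃ (f : ZMod Q → ℂ) (P : ℕ) (θ : ℝ), (Bd f) ∧ δ ^ 7 * K ≤ P ∧
      (∀ z, ∀ j : ℕ, ‖f (z + q * j) - e (-θ * j) * f z‖ ≤ 2 * j / P) ∧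
      δ ^ A * Q * K * R ≤ ‖∑ z, DD f0 c β q K R z * f z‖ ∧
      ∀ (ι : Type) (A : Finset ι) (k : ι → ℂ) (b : ι → ZMod Q), ∃ τ,
        ‖∑ a ∈ A, k a * f (b a)‖ * (K * R) ≤ ‖∑ a ∈ A, conj (k a) * DD f0 c β q K R (b a + τ)‖ := by
  obtain ⟨C, hC2, hC⟩ := E1
  refine ⟨2 * C + 7, by omega, fun δ hδ hδ2 Q _ K R q f0 c f2 h0 hc h2 β hq hδq hKR hbig hQK h => ?_⟩
  have hK := Kpos hbig
  have hR : 0 < §R := lt_of_lt_of_le (by positivity) hKR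
  have hQ : 0 < §Q := Qpos
  obtain ⟨R', hR'0, hR'1, hR'2⟩ := exR hδ hδ2 6 K (bigmono hδ hδ2 hbig (by omega))
  set F := DD f0 c β q K R with hF
  have hKR0 : 0 < §K * R := by positivity
  set D : ZMod Q → ℂ := fun z => conj (F z) / ((K * R : ℝ) : ℂ) with hD
  have nD : ‖((K * R : ℝ) : ℂ)‖ = K * R := by rw [Complex.norm_real, Real.norm_of_nonneg hKR0.le]
  have hDb : Bd D := fun x => by
    simp only [hD, norm_div, nD, RCLike.norm_conj]
    rw [div_le_one hKR0]; exact DD_norm f0 c h0 hc β q K R x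
  have hsq : δ ^ 2 * Q * (K * R) ^ 2 ≤ ∑ z, ‖F z‖ ^ 2 := by
    have h1 := cs_bdd univ f2 F (fun x _ => h2 x)
    rw [cardZ] at h1
    simp_rw [mul_comm (f2 _)] at h1
    have := (pow_le_pow_left₀ (by positivity) h 2).trans h1
    refine le_of_mul_le_mul_left (le_trans (le_of_eq ?_) this) hQ
    ring
  have hFD : δ ^ 2 * Q * K * R ≤ ‖∑ z, F z * D z‖ := by
    have : ∑ z, F z * D z = (((∑ z, ‖F z‖ ^ 2) / (K * R) : ℝ) : ℂ) := by
      push_cast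
      rw [sum_div]
      refine sc fun z _ => ?_
      simp only [hD]
      rw [← mul_div_assoc, Complex.mul_conj']
      push_cast; rfl
    rw [this, Complex.norm_real, Real.norm_of_nonneg (by positivity), le_div_iff₀ hKR0]
    exact le_trans (le_of_eq (by ring)) hsq
  have hd2 : δ ^ 2 ≤ δ := by simpa using pown hδ hδ2 (show 1 ≤ 2 by norm_num)
  obtain ⟨θ, hθ⟩ := hC (δ ^ 2) (by positivity) (by linarith) Q K R q R' f0 c D h0 hc hDb β hq
    (le_trans (by gcongr) hδq) (le_trans (by gcongr) hKR) (by rw [← pow_mul]; exact bigmono hδ hδ2 hbig (by omega)) hQK hR'0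
    (by
      calc 8 * §R' ≤ 8 * δ ^ 6 * K := by linarith
        _ ≤ δ ^ 3 * K := by gcongr; exact powc hδ hδ2 3 (by norm_num) (by norm_num)
        _ = δ ^ 2 * (δ * K) := by ring
        _ ≤ _ := by gcongr)
    (by
      calc 8 * (§q * R') ≤ 8 * (q * (δ ^ 6 * K)) := by gcongr
        _ = (δ * q) * (8 * δ ^ 5) * K := by ring
        _ ≤ 1 * δ ^ 2 * K := by gcongr; exact powc hδ hδ2 3 (by norm_num) (by norm_num)
        _ = _ := by ring) hFD
  obtain ⟨f, hf, hfp, hfb, hfa⟩ := E1c D hDb q (2 * R') (by omega) θ ((δ ^ 2) ^ C / 4) (le_trans (le_of_eq (by push_cast; ring)) hθ)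
  refine ⟨f, 2 * R', θ, hf, by norm_num at hR'1; push_cast; linarith [show (0 : ℝ) ≤ R' by positivity], hfp, ?_, fun ι A k b => ?_⟩
  · have : ∑ z, conj (D z) * f z = (∑ z, F z * f z) / ((K * R : ℝ) : ℂ) := by
      rw [sum_div]
      refine sc fun z _ => ?_
      simp only [hD, map_div₀, Complex.conj_conj, Complex.conj_ofReal]; ring
    rw [this, norm_div, nD, le_div_iff₀ hKR0] at hfb
    refine le_trans ?_ hfb
    have := powc hδ hδ2 2 (n := 2 * C + 7) (m := 2 * C) (c := 4) (by norm_num) (by omega)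
    rw [← pow_mul]
    calc δ ^ (2 * C + 7) * Q * K * R = δ ^ (2 * C + 7) * (Q * (K * R)) := by ring
      _ ≤ (δ ^ (2 * C) / 4) * (Q * (K * R)) := by gcongr; linarith
      _ = _ := by ring
  · obtain ⟨τ, hτ⟩ := hfa ι A k b
    refine ⟨τ, ?_⟩
    have : ∑ a ∈ A, k a * D (b a + τ) = conj (∑ a ∈ A, conj (k a) * F (b a + τ)) / ((K * R : ℝ) : ℂ) := by
      rw [map_sum, sum_div]
      refine sc fun z _ => ?_
      simp only [hD, map_mul, Complex.conj_conj]; ring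
    rw [this, norm_div, nD, RCLike.norm_conj, le_div_iff₀ hKR0] at hτ
    exact hτ

section
lemma prod_diff {a b a' b' : ℂ} (u : ℂ) (hu : ‖u‖ = 1) (h1 : ‖a'‖ ≤ 1) (h2 : ‖b‖ ≤ 1) {t : ℝ} (ha : ‖a' - u * a‖ ≤ t) (hb : ‖b' - u * b‖ ≤ t) :
    ‖a' * conj b' - a * conj b‖ ≤ 2 * t := by
  have hu1 : u * conj u = 1 := by rw [Complex.mul_conj', hu]; norm_num
  have : a' * conj b' - a * conj b = a' * conj (b' - u * b) + (a' - u * a) * (conj u * conj b) := by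
    rw [map_sub, map_mul]; linear_combination (a * conj b) * hu1
  rw [this]
  refine (norm_add_le _ _).trans ?_
  rw [norm_mul, norm_mul, norm_mul, RCLike.norm_conj, RCLike.norm_conj, RCLike.norm_conj, hu]
  have := mul_le_mul h1 hb (norm_nonneg _) zero_le_one
  have := mul_le_mul ha (show 1 * ‖b‖ ≤ 1 by linarith) (by positivity) ((norm_nonneg _).trans ha)
  linarith

section
variable {Q : ℕ} [NeZero Q]

set_option maxHeartbeats 1000000 in
lemma ENb1 (η : ℝ) (hη : 0 < η) (hη2 : η ≤ 1 / 2) (K R q P : ℕ) (f0 c f : ZMod Q → ℂ) (h0 : ∀ x, ‖f0 x‖ ≤ 1) (hc : ∀ x, ‖c x‖ ≤ 1)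
    (hf : Bd f) (β : ZMod Q → ℝ) (θ : ℝ) (hq : 0 < q) (hηq : η * q ≤ 1) (hKR : η * K ≤ R) (hbig : 1 ≤ η ^ 67 * K)
    (hKQ : §K ^ 2 ≤ Q) (hQK : §Q ≤ 16 * K ^ 2) (hP : η * K ≤ P)
    (hper : ∀ z, ∀ j : ℕ, ‖f (z + q * j) - e (-θ * j) * f z‖ ≤ 2 * j / P)
    (h : η * Q * K * R ≤ ‖∑ z, DD f0 c β q K R z * f z‖) :
    ∃ (σ T : ℕ) (d : ZMod Q), 0 < T ∧ η ^ 36 * K ≤ T ∧ T ≤ η ^ 35 * K ∧ η ^ 66 * K ≤ σ ∧ σ ≤ η ^ 29 * K ∧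
      ∃ S0 ⊆ range T, η ^ 18 * T ≤ #S0 ∧ ∃ ξ : ℕ → ZMod Q, ∀ s ∈ S0,
        η ^ 144 * Q ≤ ‖ft (fun z => f z * conj (f (z + d + ¶(q * σ * s)))) (ξ s)‖ := by
  classical
  have hK := Kpos hbig
  have hR : 0 < §R := lt_of_lt_of_le (by positivity) hKR
  have hPr : (0 : ℝ) < P := lt_of_lt_of_le (by positivity) hP
  have hQ : 0 < §Q := Qpos
  obtain ⟨T, hT0, hT1, hT2⟩ := exR hη hη2 35 K (bigmono hη hη2 hbig (by omega))
  obtain ⟨a0, ha0, ha1, ha2⟩ := exR hη hη2 65 K (bigmono hη hη2 hbig (by omega))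
  set H := ⌈64 / η ^ 4⌉₊ with hH
  have hH1 : 64 ≤ η ^ 4 * H := by
    have := Nat.le_ceil (64 / η ^ 4)
    rw [div_le_iff₀ (by positivity)] at this; linarith
  have hH2 : η ^ 11 * H ≤ 1 := by
    have h1 : §H ≤ 64 / η ^ 4 + 1 := (Nat.ceil_lt_add_one (by positivity)).le
    have h2 : η ^ 4 * H ≤ 64 + η ^ 4 := by
      calc η ^ 4 * H ≤ η ^ 4 * (64 / η ^ 4 + 1) := by gcongr
        _ = _ := by field_simp
    have h3 : η ^ 4 ≤ 1 := pow_le_one₀ hη.le (by linarith)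
    have h4 : 65 * η ^ 7 ≤ η ^ 0 := powc hη hη2 7 (by norm_num) (by norm_num)
    calc η ^ 11 * H = η ^ 7 * (η ^ 4 * H) := by ring
      _ ≤ η ^ 7 * 65 := by gcongr; linarith
      _ ≤ 1 := by simpa [mul_comm] using h4
  obtain ⟨l1, l2, hl1, hl1', hl2, hl2', d, κ, hE⟩ := E2 f0 c f h0 hc hf β K R q a0 H T η hη hη2 (mod_cast hR) (mod_cast hK) hT0 hH1
    (by
      calc 16 * (a0 * H : ℝ) ≤ 16 * (η ^ 65 * K * H) := by gcongr
        _ = 16 * η ^ 54 * K * (η ^ 11 * H) := by ring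
        _ ≤ η ^ 3 * K * 1 := by gcongr; exact powc hη hη2 4 (by norm_num) (by norm_num)
        _ = η ^ 2 * (η * K) := by ring
        _ ≤ _ := by gcongr)
    (by
      calc 160 * (T * H ^ 2 : ℝ) ≤ 160 * (η ^ 35 * K * H ^ 2) := by gcongr
        _ = 160 * η ^ 13 * K * (η ^ 11 * H) ^ 2 := by ring
        _ ≤ η ^ 5 * K * 1 ^ 2 := by gcongr; exact powc hη hη2 8 (by norm_num) (by norm_num)
        _ = η ^ 4 * (η * K) := by ring
        _ ≤ _ := by gcongr) h
  set σ := 2 * q * a0 * l1 * l2 * (l1 + l2) with hσ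
  have hσ1 : η ^ 66 * K ≤ σ := by
    refine ha1.trans ?_
    have : a0 ≤ σ := by
      have : 1 ≤ 2 * q * l1 * l2 * (l1 + l2) := Nat.pos_of_ne_zero (by positivity)
      calc a0 = a0 * 1 := by ring
        _ ≤ a0 * (2 * q * l1 * l2 * (l1 + l2)) := Nat.mul_le_mul_left _ this
        _ = σ := by rw [hσ]; ring
    exact_mod_cast this
  have hσ2 : σ ≤ η ^ 29 * K := by
    have a1 : (l1 : ℝ) ≤ H := mod_cast hl1'.le
    have a2 : (l2 : ℝ) ≤ H := mod_cast hl2'.le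
    calc §σ = 2 * q * a0 * l1 * l2 * (l1 + l2) := by rw [hσ]; push_cast; ring
      _ ≤ 2 * q * (η ^ 65 * K) * H * H * (H + H) := by gcongr
      _ = 4 * η ^ 31 * K * (η * q) * (η ^ 11 * H) ^ 3 := by ring
      _ ≤ η ^ 29 * K * 1 * 1 ^ 3 := by gcongr; exact powc hη hη2 2 (by norm_num) (by norm_num)
      _ = _ := by ring
  have hσ0 : 0 < σ := by
    have : 0 < §σ := lt_of_lt_of_le (by positivity) hσ1
    exact_mod_cast this
  obtain ⟨x, -, hx⟩ := pigeon (s := (univ : Finset (ZMod Q))) univ_nonempty _ (η ^ 16 * T ^ 2) (le_trans (le_of_eq (by rw [cardZ]; ring)) hE)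
  have hTr : 0 < §T := mod_cast hT0
  let W : ℕ → ℝ := fun s => ‖∑ t ∈ range (2 * T), f (x + ¶(q * σ * t)) *
          conj (f (x + d + ¶(q * σ * (s + t)))) * e (κ x s * t)‖
  have hpop := popular (range T) W (η ^ 16 / 2) (2 * T) (by positivity) (by positivity) (fun s _ => by
    have := norm_sum_le_card (range (2 * T)) (fun t => f (x + ¶(q * σ * t)) *
          conj (f (x + d + ¶(q * σ * (s + t)))) * e (κ x s * t)) 1 (fun t _ => bmul (bmul (hf _) (bconj (hf _))) (norm_e _).le)
    simp only [W]; simpa using this) (by rw [card_range]; exact le_trans (le_of_eq (by ring)) hx)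
  have h1617 : η ^ 17 ≤ η ^ 16 / 2 := by
    have := powc hη hη2 1 (c := 2) (n := 17) (m := 16) (by norm_num) (by norm_num); linarith
  have h1618 : η ^ 18 ≤ η ^ 16 / 4 := by
    have := powc hη hη2 2 (c := 4) (n := 18) (m := 16) (by norm_num) (by norm_num); linarith
  have key : ∀ s ∈ (range T).filter (fun s => η ^ 16 / 2 / 2 * (2 * T) ≤ W s), ∃ ξ,
      η ^ 144 * Q ≤ ‖ft (fun z => f z * conj (f (z + d + ¶(q * σ * s)))) ξ‖ := by
    intro s hs
    rw [mem_filter] at hs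
    obtain ⟨ξ, hξ⟩ := fill (fun z => f z * conj (f (z + d + ¶(q * σ * s)))) (fun x => bmul (hf _) (bconj (hf _))) q σ σ T hσ0 le_rfl hq
      (by
        have : §(q * (2 * T * σ)) ≤ Q := by
          push_cast
          calc (q * (2 * T * σ) : ℝ) ≤ q * (2 * (η ^ 35 * K) * (η ^ 29 * K)) := by gcongr
            _ = (η * q) * (2 * η ^ 63) * K ^ 2 := by ring
            _ ≤ 1 * η ^ 0 * K ^ 2 := by gcongr; exact powc hη hη2 1 (by norm_num) (by norm_num)
            _ ≤ Q := by simpa using hKQ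
        exact_mod_cast this) 0 (κ x s) (4 * η ^ 28) (η ^ 17) (by positivity) (by
          have := powc hη hη2 1 (c := 2) (n := 17) (m := 0) (by norm_num) (by norm_num); linarith)
      (by have := powc hη hη2 6 (c := 64) (n := 28) (m := 17) (by norm_num) (by norm_num); linarith)
      (fun z j hj => by
        have b1 := prod_diff (e (-θ * j)) (norm_e _) (hf (z + q * j)) (hf (z + d + ¶(q * σ * s))) (hper z j) (hper (z + d + ¶(q * σ * s)) j)
        rw [zero_mul, e_zero, one_mul]
        rw [show z + (q : ZMod Q) * (j : ZMod Q) + d + ((q * σ * s : ℕ) : ZMod Q) = z + d + ((q * σ * s : ℕ) : ZMod Q) + q * j by ring]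
        refine b1.trans ?_
        have : (2 * j / P : ℝ) ≤ 2 * η ^ 28 := by
          rw [div_le_iff₀ hPr]
          have hj' : §j ≤ σ := mod_cast hj.le
          calc (2 * j : ℝ) ≤ 2 * (η ^ 29 * K) := by linarith
            _ = 2 * η ^ 28 * (η * K) := by ring
            _ ≤ _ := by gcongr
        linarith) x
      (by
        have := powc hη hη2 5 (c := 32) (n := 67) (m := 17 + 36) (by norm_num) (by norm_num)
        calc (32 : ℝ) ≤ 32 * (η ^ 67 * K) := by linarith
          _ = (32 * η ^ 67) * K := by ring
          _ ≤ η ^ (17 + 36) * K := by gcongr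
          _ = η ^ 17 * (η ^ (35 + 1) * K) := by ring
          _ ≤ _ := by gcongr)
      (by
        have hs2 := hs.2
        simp only [W] at hs2
        refine le_trans ?_ (hs2.trans (le_of_eq ?_))
        · have := mul_le_mul_of_nonneg_right h1617 hTr.le
          linarith
        · congr 1
          refine sc fun t _ => ?_
          have : x + d + ¶(q * σ * (s + t)) = x + ¶(q * σ * t) + d + ¶(q * σ * s) := by push_cast; ring
          simp only [this])
    refine ⟨ξ, le_trans ?_ hξ⟩
    have b1 := powc hη hη2 8 (c := 256) (n := 144) (m := 136) (by norm_num) (by norm_num)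
    calc η ^ 144 * Q ≤ η ^ 144 * (16 * K ^ 2) := by gcongr
      _ = (256 * η ^ 144) * K ^ 2 / 16 := by ring
      _ ≤ η ^ 136 * K ^ 2 / 16 := by gcongr
      _ = (η ^ 17) ^ 2 / 16 * (η ^ (35 + 1) * K) * (η ^ 66 * K) := by ring
      _ ≤ _ := by gcongr
  choose! ξ hξ using key
  refine ⟨σ, T, d, hT0, hT1, hT2, hσ1, hσ2, _, filter_subset _ _, ?_, ξ, hξ⟩
  refine le_trans ?_ hpop
  rw [card_range]
  have := mul_le_mul_of_nonneg_right h1618 hTr.le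
  linarith
end
end

set_option maxHeartbeats 1000000 in
lemma ENb : ∃ C : ℕ, 2 ≤ C ∧ ∀ (η : ℝ), 0 < η → η ≤ 1 / 2 → ∀ (Q : ℕ) [NeZero Q] (K R q P : ℕ)
    (f0 c f : ZMod Q → ℂ) (_ : Bd f0) (_ : Bd c) (_ : Bd f) (β : ZMod Q → ℝ) (θ : ℝ),
    0 < q → η * q ≤ 1 → η * K ≤ R → 1 ≤ η ^ C * K → §K ^ 2 ≤ Q → §Q ≤ 16 * K ^ 2 → η * K ≤ P →
    (∀ z, ∀ j : ℕ, ‖f (z + q * j) - e (-θ * j) * f z‖ ≤ 2 * j / P) →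
    η * Q * K * R ≤ ‖∑ z, DD f0 c β q K R z * f z‖ →
    (∀ (ι : Type) (A : Finset ι) (k : ι → ℂ) (b : ι → ZMod Q), ∃ τ,
        ‖∑ a ∈ A, k a * f (b a)‖ * (K * R) ≤ ‖∑ a ∈ A, conj (k a) * DD f0 c β q K R (b a + τ)‖) →
    ∃ w, c w ≠ 0 ∧ Mj (η ^ C) K (β w) := by
  classical
  obtain ⟨C3, hC3, hE3⟩ := E3a
  obtain ⟨C4, hC4, hW⟩ := psiWeyl
  set B := 162 * C3 + 144 with hB
  refine ⟨(3 * B + 56) * C4 + 162 * C3 + B + 67, by omega, fun η hη hη2 Q _ K R q P f0 c f h0 hc hf β θ hq hηq hKR hbig hKQ hQK hP hper h hAvg => ?_⟩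
  have hK := Kpos hbig
  have hR : 0 < §R := lt_of_lt_of_le (by positivity) hKR
  have hPr : (0 : ℝ) < P := lt_of_lt_of_le (by positivity) hP
  have hQ : 0 < §Q := Qpos
  have hη1 : ∀ n : ℕ, 1 ≤ n → η ^ n ≤ η := fun n hn => by simpa using pown hη hη2 hn
  obtain ⟨σ, T, d, hT0, hT1, hT2, hσ1, hσ2, S0, hS0, hS0c, ξ, hξ⟩ := ENb1 η hη hη2 K R q P f0 c f h0 hc hf β θ hq hηq hKR
    (bigmono hη hη2 hbig (by omega)) hKQ hQK hP hper h
  have hTr : 0 < §T := mod_cast hT0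
  let b : ℕ → ZMod Q := fun s => d + ¶(q * σ * s)
  let p : ℕ → ZMod Q → ℂ := fun s z => f z * conj (f (z + d + ¶(q * σ * s)))
  let w : ℕ → ℂ := fun s => if s ∈ S0 then ph (ft (p s) (ξ s)) else 0
  have hw : ∀ s, ‖w s‖ ≤ 1 := fun s => by
    simp only [w]; split_ifs
    · exact (ph_norm _).le
    · simp
  obtain ⟨τ, hτ⟩ := hAvg (ℕ × ZMod Q) (range T ×ˢ univ) (fun a => conj (w a.1 * f a.2 * ch (ξ a.1 * a.2))) (fun a => a.2 + b a.1)
  have e1 : ∑ a ∈ range T ×ˢ (univ : Finset (ZMod Q)), conj (w a.1 * f a.2 * ch (ξ a.1 * a.2)) * f (a.2 + b a.1)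
      = conj (∑ s ∈ S0, (‖ft (p s) (ξ s)‖ : ℂ)) := by
    rw [sum_product, ← sum_subset hS0, map_sum]
    · refine sc fun s hs => ?_
      rw [← ph_mul]
      unfold ft
      rw [mul_sum, map_sum]
      refine sc fun z _ => ?_
      simp only [w, if_pos hs, p, b, map_mul, Complex.conj_conj, ft, add_assoc]; ring
    · intro s _ hs
      simp [w, hs]
  have e2 : ∑ a ∈ range T ×ˢ (univ : Finset (ZMod Q)), conj (conj (w a.1 * f a.2 * ch (ξ a.1 * a.2))) * DD f0 c β q K R (a.2 + b a.1 + τ)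
      = ∑ s ∈ range T, ∑ z, w s * f z * ch (ξ s * z) * DD f0 c β q K R (z + (b s + τ)) := by
    rw [sum_product]
    refine sc fun s _ => sc fun z _ => ?_
    rw [Complex.conj_conj, add_assoc]
  rw [e1, e2, RCLike.norm_conj] at hτ
  have e3 : η ^ 162 * T * Q ≤ ‖∑ s ∈ S0, (‖ft (p s) (ξ s)‖ : ℂ)‖ := by
    rw [← Complex.ofReal_sum, Complex.norm_real, Real.norm_of_nonneg (by positivity)]
    calc η ^ 162 * T * Q = (η ^ 18 * T) * (η ^ 144 * Q) := by ring
      _ ≤ #S0 * (η ^ 144 * Q) := by gcongr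
      _ ≤ _ := by
        rw [← nsmul_eq_mul]; exact card_nsmul_le_sum _ _ _ hξ
  obtain ⟨ξ0, S, hS, hSc, hSp⟩ := hE3 (η ^ 162) (by positivity) ((hη1 _ (by norm_num)).trans hη2) Q K R q T f0 c f h0 hc hf β (fun s => b s + τ) ξ w hw hq
    (le_trans (by gcongr; exact hη1 _ (by norm_num)) hηq) (le_trans (by gcongr; exact hη1 _ (by norm_num)) hKR)
    (by rw [← pow_mul]; exact bigmono hη hη2 hbig (by omega)) hQK hT0 (by
      refine le_trans ?_ hτ
      calc η ^ 162 * T * Q * K * R = (η ^ 162 * T * Q) * (K * R) := by ring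
        _ ≤ _ := by gcongr)
  have e4 : η ^ B * Q * T ≤ ∑ s ∈ range T, ‖ft (p s) ξ0‖ := by
    calc η ^ B * Q * T = ((η ^ 162) ^ C3 * T) * (η ^ 144 * Q) := by rw [← pow_mul, hB, pow_add]; ring
      _ ≤ #S * (η ^ 144 * Q) := by gcongr
      _ ≤ ∑ s ∈ S, ‖ft (p s) ξ0‖ := by
        rw [← nsmul_eq_mul]; refine card_nsmul_le_sum _ _ _ fun s hs => ?_
        obtain ⟨h1, h2⟩ := hSp s hs
        have : s ∈ S0 := by
          by_contra h'; exact h2 (by simp [w, h'])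
        rw [← h1]; exact hξ s this
      _ ≤ _ := sum_le_sum_of_subset_of_nonneg hS fun _ _ _ => norm_nonneg _
  obtain ⟨κ, hκ⟩ := vw (fun z => conj (f (z + d))) (fun z => f z * ch (ξ0 * z)) (fun z => bmul (hf z) (ch_norm _).le) T hT0 ¶(q * σ)
    (η ^ B) (by positivity) (e4.trans (le_of_eq (by
      refine sc fun s _ => ?_
      congr 1
      refine sc fun z _ => ?_
      have : z + d + ((q * σ * s : ℕ) : ZMod Q) = z + ((q * σ : ℕ) : ZMod Q) * s + d := by push_cast; ring
      simp only [p, this]; ring)))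
  obtain ⟨z, -, hz⟩ := pigeon (s := (univ : Finset (ZMod Q))) univ_nonempty _ ((η ^ B * T) ^ 2) (le_trans (le_of_eq (by rw [cardZ]; ring)) hκ)
  have hz2 := abs_le_of_sq_le_sq hz (norm_nonneg _)
  rw [abs_of_nonneg (by positivity)] at hz2
  obtain ⟨v, hv0, hv1, hv2⟩ := exR hη hη2 (B + 11) K (bigmono hη hη2 hbig (by omega))
  obtain ⟨ξ1, hξ1⟩ := fill f hf q σ v T hv0 (by
      have : (v : ℝ) ≤ σ := (hv2.trans (by gcongr ?_ * _; exact pown hη hη2 (by omega))).trans hσ1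
      exact_mod_cast this) hq
      (by
        have : §(q * (2 * T * σ)) ≤ Q := by
          push_cast
          calc (q * (2 * T * σ) : ℝ) ≤ q * (2 * (η ^ 35 * K) * (η ^ 29 * K)) := by gcongr
            _ = (η * q) * (2 * η ^ 63) * K ^ 2 := by ring
            _ ≤ 1 * η ^ 0 * K ^ 2 := by gcongr; exact powc hη hη2 1 (by norm_num) (by norm_num)
            _ ≤ Q := by simpa using hKQ
        exact_mod_cast this) (-θ) (-κ) (2 * η ^ (B + 10)) (η ^ B) (by positivity) ((hη1 _ (by omega)).trans hη2)
      (by have := powc hη hη2 5 (c := 32) (n := B + 10) (m := B) (by norm_num) (by omega); linarith)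
      (fun z j hj => by
        refine (hper z j).trans ?_
        rw [div_le_iff₀ hPr]
        have hj' : §j ≤ v := mod_cast hj.le
        calc (2 * j : ℝ) ≤ 2 * (η ^ (B + 11) * K) := by linarith
          _ = 2 * η ^ (B + 10) * (η * K) := by ring
          _ ≤ _ := by gcongr) (z + d)
      (by
        have := powc hη hη2 5 (c := 32) (n := B + 67) (m := B + 36) (by norm_num) (by omega)
        have h2 := bigmono hη hη2 hbig (C' := B + 67) (by omega)
        calc (32 : ℝ) ≤ 32 * (η ^ (B + 67) * K) := by linarith
          _ = (32 * η ^ (B + 67)) * K := by ring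
          _ ≤ η ^ (B + 36) * K := by gcongr
          _ = η ^ B * (η ^ 36 * K) := by ring
          _ ≤ _ := by gcongr)
      (by
        refine hz2.trans (le_of_eq ?_)
        rw [← RCLike.norm_conj, map_sum]
        congr 1
        refine sc fun t _ => ?_
        have : z + ((q * σ : ℕ) : ZMod Q) * t + d = z + d + ((q * σ * t : ℕ) : ZMod Q) := by push_cast; ring
        simp only [map_mul, Complex.conj_conj, e_conj, this, neg_mul])
  have e5 : η ^ (3 * B + 56) * Q ≤ ‖ft f ξ1‖ := by
    refine le_trans ?_ hξ1
    have b1 := powc hη hη2 8 (c := 256) (n := 3 * B + 56) (m := 3 * B + 48) (by norm_num) (by omega)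
    calc η ^ (3 * B + 56) * Q ≤ η ^ (3 * B + 56) * (16 * K ^ 2) := by gcongr
      _ = (256 * η ^ (3 * B + 56)) * K ^ 2 / 16 := by ring
      _ ≤ η ^ (3 * B + 48) * K ^ 2 / 16 := by gcongr
      _ = (η ^ B) ^ 2 / 16 * (η ^ 36 * K) * (η ^ (B + 11 + 1) * K) := by rw [← pow_mul]; ring
      _ ≤ _ := by gcongr
  obtain ⟨τ', hτ'⟩ := hAvg (ZMod Q) univ (fun z => ch (ξ1 * z)) id
  have e6 : ‖∑ z, conj (ch (ξ1 * z)) * DD f0 c β q K R (id z + τ')‖ = ‖∑ z, DD f0 c β q K R z * ch (-ξ1 * z)‖ := by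
    have : ∑ z, conj (ch (ξ1 * z)) * DD f0 c β q K R (id z + τ') = ch (ξ1 * τ') * ∑ z, DD f0 c β q K R z * ch (-ξ1 * z) := by
      rw [← sum_translate τ' (fun z => DD f0 c β q K R z * ch (-ξ1 * z)), mul_sum]
      refine sc fun z _ => ?_
      have : ch (-(ξ1 * z)) = ch (ξ1 * τ') * ch (-ξ1 * (z + τ')) := by rw [← ch_add]; congr 1; ring
      rw [ch_conj, this, id]; ring
    rw [this, norm_mul, ch_norm, one_mul]
  have e7 : ∑ z, ch (ξ1 * z) * f (id z) = ft f ξ1 := sc fun z _ => mul_comm _ _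
  rw [e6, e7] at hτ'
  obtain ⟨-, u, hu, hu2⟩ := hW (η ^ (3 * B + 56)) (by positivity) ((hη1 _ (by omega)).trans hη2) Q K R q (-ξ1) f0 c h0 hc β hq
    (le_trans (by gcongr; exact hη1 _ (by omega)) hηq) (le_trans (by gcongr; exact hη1 _ (by omega)) hKR)
    (by rw [← pow_mul]; exact bigmono hη hη2 hbig (by omega))
    (by
      refine le_trans ?_ hτ'
      calc η ^ (3 * B + 56) * Q * K * R = (η ^ (3 * B + 56) * Q) * (K * R) := by ring
        _ ≤ _ := by gcongr)
  refine ⟨u, hu, hu2.mono ?_⟩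
  rw [← pow_mul]; exact pown hη hη2 (by omega)

lemma EN : ∃ C : ℕ, 2 ≤ C ∧ ∀ (δ : ℝ), 0 < δ → δ ≤ 1 / 2 → ∀ (Q : ℕ) [NeZero Q] (K R q : ℕ)
    (f0 c f2 : ZMod Q → ℂ) (_ : Bd f0) (_ : Bd c) (_ : Bd f2) (β : ZMod Q → ℝ),
    0 < q → δ * q ≤ 1 → δ * K ≤ R → 1 ≤ δ ^ C * K → §K ^ 2 ≤ Q → §Q ≤ 16 * K ^ 2 →
    δ * Q * K * R ≤ ‖∑ z, DD f0 c β q K R z * f2 z‖ → ∃ w, c w ≠ 0 ∧ Mj (δ ^ C) K (β w) := by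
  obtain ⟨A, hA, hEa⟩ := ENa
  obtain ⟨C, hC, hEb⟩ := ENb
  refine ⟨A * C, by nlinarith, fun δ hδ hδ2 Q _ K R q f0 c f2 h0 hc h2 β hq hδq hKR hbig hKQ hQK h => ?_⟩
  obtain ⟨f, P, θ, hf, hP, hper, hb, hav⟩ := hEa δ hδ hδ2 Q K R q f0 c f2 h0 hc h2 β hq hδq hKR (bigmono hδ hδ2 hbig (by nlinarith)) hQK h
  have h1 : δ ^ A ≤ δ := by simpa using pown hδ hδ2 (show 1 ≤ A by omega)
  obtain ⟨w, hw⟩ := hEb (δ ^ A) (by positivity) (h1.trans hδ2) Q K R q P f0 c f h0 hc hf β θ hq (le_trans (by gcongr) hδq) (le_trans (by gcongr) hKR)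
    (by rwa [← pow_mul]) hKQ hQK (le_trans (mul_le_mul_of_nonneg_right (pown hδ hδ2 hA) (Nat.cast_nonneg _)) hP) hper hb hav
  exact ⟨w, by rwa [← pow_mul] at hw⟩

section
lemma sum3 {ι κ l : Type*} (s : Finset ι) (t : Finset κ) (u : Finset l) (F : ι → κ → l → ℂ) :
    ∑ w ∈ s, ∑ r ∈ t, ∑ y ∈ u, F w r y = ∑ y ∈ u, ∑ w ∈ s, ∑ r ∈ t, F w r y := by
  rw [sum_comm (s := u)]; exact sc fun w _ => sum_comm

section
variable {Q : ℕ} [NeZero Q]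

lemma cardle (W : Finset (ZMod Q)) : (#W : ℝ) ≤ Q := by
  rw [← cardZ (Q := Q)]; exact_mod_cast card_le_card (subset_univ W)

noncomputable def Dn (f0 f2 : ZMod Q → ℂ) (K : ℕ) (w : ZMod Q) : ℂ :=
  (∑ y ∈ range K, f0 (w - y) * f2 (w - y + (y : ZMod Q) ^ 2)) / K

lemma Dn_norm (f0 f2 : ZMod Q → ℂ) (h0 : Bd f0) (h2 : Bd f2) (K : ℕ) (w : ZMod Q) : ‖Dn f0 f2 K w‖ ≤ 1 := by
  unfold Dn
  rw [norm_div, Complex.norm_natCast]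
  refine div_le_one_of_le₀ ?_ (Nat.cast_nonneg _)
  simpa using norm_sum_le_card (range K) (fun y : ℕ => f0 (w - y) * f2 (w - y + (y : ZMod Q) ^ 2)) 1 (fun y _ => bmul (h0 _) (h2 _))

lemma Dn_DD (f0 f2 c : ZMod Q → ℂ) (h0 : Bd f0) (h2 : Bd f2) (hc : Bd c) (β : ZMod Q → ℝ) (K R q : ℕ) (hK : 0 < K) :
    ‖K * ∑ w, c w * ∑ r ∈ range R, Dn f0 f2 K (w + ¶q * ¶r) * e (β w * r) - ∑ z, DD f0 c β q K R z * f2 z‖ ≤ Q * R * (2 * (q * R)) := by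
  have hK' : (K : ℂ) ≠ 0 := mod_cast hK.ne'
  let G : ZMod Q → ℕ → ℤ → ℂ := fun w r y => f0 (w + q * r - y) * f2 (w + q * r - y + (y : ZMod Q) ^ 2)
  have e1 : K * ∑ w, c w * ∑ r ∈ range R, Dn f0 f2 K (w + ¶q * ¶r) * e (β w * r)
      = ∑ w, ∑ r ∈ range R, c w * e (β w * r) * ∑ y ∈ range K, G w r y := by
    rw [mul_sum]
    refine sc fun w _ => ?_
    rw [mul_sum, mul_sum]
    refine sc fun r _ => ?_
    simp only [Dn, G, Int.cast_natCast]; field_simp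
  have e2 : ∑ z, DD f0 c β q K R z * f2 z = ∑ w, ∑ r ∈ range R, c w * e (β w * r) * ∑ y ∈ range K, G w r (y + (q * r : ℕ)) := by
    rw [psi_eq]
    simp_rw [mul_sum]
    conv_rhs => rw [sum3]
    refine sc fun (m : ℕ) _ => ?_
    conv_rhs => rw [← sum_translate (E := ℂ) (m : ZMod Q)]
    refine sc fun x _ => sc fun r _ => ?_
    have a1 : x + (m : ZMod Q) + q * r - (((m : ℤ) + ((q * r : ℕ) : ℤ) : ℤ) : ZMod Q) = x := by push_cast; ring
    have a2 : (((m : ℤ) + ((q * r : ℕ) : ℤ) : ℤ) : ZMod Q) = ¶(m + q * r) := by push_cast; ring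
    simp only [G, a1]
    rw [a2]; ring
  rw [e1, e2, ← sum_sub_distrib]
  have b1 : ∀ w : ZMod Q, ∀ r ∈ range R, ‖c w * e (β w * r) * ∑ y ∈ range K, G w r y - c w * e (β w * r) * ∑ y ∈ range K, G w r (y + (q * r : ℕ))‖ ≤ 2 * (q * R) := by
    intro w r hr
    rw [← mul_sub, norm_mul, norm_sub_rev]
    have h1 := shift_bd (G w r) (fun y => bmul (h0 _) (h2 _)) K (q * r : ℕ)
    have h3 : §r ≤ R := mod_cast (mem_range.mp hr).le
    have h4 : 2 * |(((q * r : ℕ) : ℤ) : ℝ)| ≤ 2 * (q * R) := by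
      rw [Int.cast_natCast, abs_of_nonneg (by positivity)]; push_cast; gcongr
    exact (mul_le_of_le_one_left (norm_nonneg _) (bmul (hc w) (norm_e _).le)).trans (h1.trans h4)
  have := norm_sum_le_card (univ : Finset (ZMod Q)) (fun w => ∑ r ∈ range R, c w * e (β w * r) * ∑ y ∈ range K, G w r y
    - ∑ r ∈ range R, c w * e (β w * r) * ∑ y ∈ range K, G w r (y + (q * r : ℕ))) (R * (2 * (q * R))) (fun w _ => by
      rw [← sum_sub_distrib]
      simpa using norm_sum_le_card (range R) _ _ (b1 w))
  rw [cardZ] at this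
  exact this.trans (le_of_eq (by ring))

end

set_option maxHeartbeats 1000000 in
open Classical in
lemma EP : ∃ C : ℕ, 2 ≤ C ∧ ∀ (δ : ℝ), 0 < δ → δ ≤ 1 / 2 → ∀ (Q : ℕ) [NeZero Q] (K R q : ℕ)
    (f0 f2 : ZMod Q → ℂ) (_ : Bd f0) (_ : Bd f2) (β : ZMod Q → ℝ) (W : Finset (ZMod Q)),
    0 < q → δ * q ≤ 1 → δ ^ 3 * K ≤ R → 8 * (q * R : ℝ) ≤ δ * K → 1 ≤ δ ^ C * K → §K ^ 2 ≤ Q → §Q ≤ 16 * K ^ 2 →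
    δ * Q * R ≤ ∑ w ∈ W, ‖∑ r ∈ range R, Dn f0 f2 K (w + ¶q * ¶r) * e (β w * r)‖ →
    δ / 4 * Q ≤ #(W.filter fun w => Mj (δ ^ C) K (β w) ∧ δ / 4 * R ≤ ‖∑ r ∈ range R, Dn f0 f2 K (w + ¶q * ¶r) * e (β w * r)‖) := by
  obtain ⟨C, hC2, hC⟩ := EN
  refine ⟨3 * C, by omega, fun δ hδ hδ2 Q _ K R q f0 f2 h0 h2 β W hq hδq hKR hqR hbig hKQ hQK h => ?_⟩
  have hK := Kpos hbig
  have hR : 0 < §R := lt_of_lt_of_le (by positivity) hKR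
  have hQ : 0 < §Q := Qpos
  set win : ZMod Q → ℂ := fun w => ∑ r ∈ range R, Dn f0 f2 K (w + ¶q * ¶r) * e (β w * r) with hwin
  have hwb : ∀ w, ‖win w‖ ≤ R := fun w => by
    simpa using norm_sum_le_card (range R) (fun r : ℕ => Dn f0 f2 K (w + (q : ZMod Q) * (r : ZMod Q)) * e (β w * r)) 1
      (fun r _ => bmul (Dn_norm f0 f2 h0 h2 K _) (norm_e _).le)
  by_contra hcon
  push Not at hcon
  set S := W.filter fun w => Mj (δ ^ (3 * C)) K (β w) ∧ δ / 4 * R ≤ ‖win w‖ with hS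
  set W' := W.filter fun w => ¬ Mj (δ ^ (3 * C)) K (β w) with hW'
  have hsum : ∑ w ∈ W, ‖win w‖ ≤ ∑ w ∈ W', ‖win w‖ + #S * R + δ / 4 * R * Q := by
    have h1 : ∀ w ∈ W, ‖win w‖ ≤ (if ¬ Mj (δ ^ (3 * C)) K (β w) then ‖win w‖ else 0) +
        (if Mj (δ ^ (3 * C)) K (β w) ∧ δ / 4 * R ≤ ‖win w‖ then §R else 0) + δ / 4 * R := by
      intro w _
      have := hwb w
      have h4 : 0 ≤ δ / 4 * R := by positivity
      by_cases hm : Mj (δ ^ (3 * C)) K (β w) <;> by_cases hl : δ / 4 * R ≤ ‖win w‖ <;> simp [hm, hl] <;> linarith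
    refine (sum_le_sum h1).trans ?_
    rw [sum_add_distrib, sum_add_distrib, ← sum_filter, ← sum_filter, sum_const, sum_const, nsmul_eq_mul, nsmul_eq_mul]
    have : (#W : ℝ) ≤ Q := cardle W
    have := mul_le_mul_of_nonneg_right this (show 0 ≤ δ / 4 * R by positivity)
    linarith
  let c : ZMod Q → ℂ := fun w => if w ∈ W' then ph (win w) else 0
  have hc : ∀ s, ‖c s‖ ≤ 1 := fun s => by
    simp only [c]; split_ifs
    · exact (ph_norm _).le
    · simp
  have hcw : ∑ w, c w * win w = ((∑ w ∈ W', ‖win w‖ : ℝ) : ℂ) := by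
    simp only [c, ite_mul, zero_mul, sum_ite_mem, univ_inter, ph_mul]
    push_cast; rfl
  have hlow : δ / 2 * Q * R ≤ ‖∑ w, c w * win w‖ := by
    rw [hcw, Complex.norm_real, Real.norm_of_nonneg (by positivity)]
    have := mul_le_mul_of_nonneg_right hcon.le hR.le
    linarith
  have hd := Dn_DD f0 f2 c h0 h2 hc β K R q (mod_cast hK)
  have h3 := norm_sub_norm_le (K * ∑ w, c w * win w) (∑ z, DD f0 c β q K R z * f2 z)
  rw [norm_mul, Complex.norm_natCast] at h3
  have h4 := mul_le_mul_of_nonneg_left hlow hK.le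
  have h5 := mul_le_mul_of_nonneg_left hqR (show 0 ≤ §Q * R / 4 by positivity)
  have hδ3 := powc hδ hδ2 2 (c := 4) (n := 3) (m := 1) (by norm_num) (by norm_num)
  have hδ1 : δ ^ 3 ≤ δ := by simpa using pown hδ hδ2 (show 1 ≤ 3 by norm_num)
  obtain ⟨w, hw, hw2⟩ := hC (δ ^ 3) (by positivity) (hδ1.trans hδ2) Q K R q f0 c f2 h0 hc h2 β hq (le_trans (by gcongr) hδq) hKR
    (by rwa [← pow_mul]) hKQ hQK (by
      have := mul_le_mul_of_nonneg_right hδ3 (show 0 ≤ §Q * K * R by positivity)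
      rw [pow_one] at this
      have h6 := h3.trans hd
      linarith)
  rw [← pow_mul] at hw2
  have : w ∈ W' := by
    by_contra h'; exact hw (by simp [c, h'])
  exact (mem_filter.mp this).2 hw2
end

section
lemma SW {ι : Type*} (X : Finset ι) (G : ι → ℤ → ℂ) (hG : ∀ x r, ‖G x r‖ ≤ 1) (β : ι → ℝ) (ε η : ℝ) (hε : 0 < ε) (hη : 0 < η) (hε1 : ε ≤ 1)
    (K R J : ℕ) (hR : 0 < R) (hβ : ∀ x ∈ X, Mj ε K (β x)) (h28 : 28 * §J ≤ η * ε * K) (h4 : 4 * §J ≤ η * ε * R)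
    (h : ∀ x ∈ X, η * R ≤ ‖∑ r ∈ range R, G x r * e (β x * r)‖) :
    ∃ q' : ℕ, 0 < q' ∧ ε * q' ≤ 1 ∧ ∃ r0 < R, ε * η / 4 * #X * J ≤ ∑ x ∈ X, ‖∑ j ∈ range J, G x (r0 + (q' * j : ℕ))‖ := by
  classical
  rcases X.eq_empty_or_nonempty with rfl | hX
  · exact ⟨1, one_pos, by simpa using hε1, 0, hR, by simp⟩
  choose! p hp0 hp1 k hk using hβ
  have hne : (X.image p).Nonempty := hX.image p
  obtain ⟨b, hb, hb2⟩ := pigeon hne (fun b => (#{a ∈ X | p a = b} : ℝ)) (ε * #X) (by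
    have h1 : (#X : ℝ) = ∑ b ∈ X.image p, (#{a ∈ X | p a = b} : ℝ) := mod_cast card_eq_sum_card_image p X
    rw [← h1]
    have h2 : X.image p ⊆ Icc 1 ⌊1 / ε⌋₊ := by
      intro b hb
      obtain ⟨x, hx, rfl⟩ := mem_image.mp hb
      rw [mem_Icc]
      refine ⟨hp0 x hx, Nat.le_floor ?_⟩
      rw [le_div_iff₀ hε]; linarith [hp1 x hx]
    have h3 : (#(X.image p) : ℝ) ≤ 1 / ε := by
      have := card_le_card h2
      rw [Nat.card_Icc, Nat.add_sub_cancel] at this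
      exact (Nat.cast_le.mpr this).trans (Nat.floor_le (by positivity))
    rw [le_div_iff₀ hε] at h3
    rw [← mul_assoc]
    exact mul_le_of_le_one_left (Nat.cast_nonneg _) h3)
  set X' := X.filter (fun a => p a = b) with hX'
  obtain ⟨x0, hx0, rfl⟩ := mem_image.mp hb
  have hq1 := hp1 x0 hx0
  obtain ⟨r0, hr0, hs⟩ := subwin X' (fun x r => G x r * e (β x * r)) (fun x r => bmul (hG _ _) (norm_e _).le) R (p x0) J hR η (by
      calc 4 * ((p x0 : ℝ) * J) = p x0 * (4 * J) := by ring
        _ ≤ p x0 * (η * ε * R) := by gcongr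
        _ = (ε * p x0) * (η * R) := by ring
        _ ≤ 1 * (η * R) := by gcongr
        _ = _ := by ring)
    (by
      have := card_nsmul_le_sum X' (fun x => ‖∑ r ∈ range R, G x r * e (β x * r)‖) (η * R) (fun x hx => h x (mem_filter.mp hx).1)
      rw [nsmul_eq_mul] at this
      simp only [Int.cast_natCast]
      linarith)
  refine ⟨p x0, hp0 x0 hx0, hq1, r0, hr0, ?_⟩
  have hterm : ∀ x ∈ X', ‖∑ j ∈ range J, G x (r0 + (p x0 * j : ℕ)) * e (β x * ((r0 + (p x0 * j : ℕ) : ℤ) : ℝ))‖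
      ≤ ‖∑ j ∈ range J, G x (r0 + (p x0 * j : ℕ))‖ + J * (η / 4) := by
    intro x hx
    obtain ⟨hxX, hpx⟩ := mem_filter.mp hx
    have hkx := hk x hxX
    rw [hpx] at hkx
    set t := (p x0 : ℝ) * β x - k x with ht
    have e1 : ∀ j : ℕ, e (β x * ((r0 + (p x0 * j : ℕ) : ℤ) : ℝ)) = e (β x * r0) * e (t * j) := by
      intro j
      rw [← e_add, ← e_sub_int _ (k x * j)]
      congr 1; rw [ht]; push_cast; ring
    have e2 : ∑ j ∈ range J, G x (r0 + (p x0 * j : ℕ)) * e (β x * ((r0 + (p x0 * j : ℕ) : ℤ) : ℝ)) =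
        e (β x * r0) * (∑ j ∈ range J, G x (r0 + (p x0 * j : ℕ)) + ∑ j ∈ range J, G x (r0 + (p x0 * j : ℕ)) * (e (t * j) - 1)) := by
      rw [← sum_add_distrib, mul_sum]
      refine sc fun j _ => ?_
      rw [e1]; ring
    rw [e2, norm_mul, norm_e, one_mul]
    refine (norm_add_le _ _).trans (add_le_add le_rfl ?_)
    refine (norm_sum_le_card _ _ (η / 4) fun j hj => ?_).trans (by rw [card_range])
    rw [norm_mul]
    refine (mul_le_of_le_one_left (norm_nonneg _) (hG _ _)).trans ?_
    have h1 := e_sub_norm (t * j) 0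
    rw [e_zero, sub_zero, abs_mul, Nat.abs_cast] at h1
    have hj' : §j ≤ J := mod_cast (mem_range.mp hj).le
    have h5 : |t| * j ≤ |t| * J := by gcongr
    have h6 := mul_le_mul_of_nonneg_right h28 (abs_nonneg t)
    have h7 := mul_le_mul_of_nonneg_left hkx hη.le
    linarith
  have h8 := hs.trans (sum_le_sum hterm)
  rw [sum_add_distrib, sum_const, nsmul_eq_mul] at h8
  have h9 : ∑ x ∈ X', ‖∑ j ∈ range J, G x (r0 + (p x0 * j : ℕ))‖ ≤ ∑ x ∈ X, ‖∑ j ∈ range J, G x (r0 + (p x0 * j : ℕ))‖ :=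
    sum_le_sum_of_subset_of_nonneg (filter_subset _ _) fun _ _ _ => norm_nonneg _
  have h10 := mul_le_mul_of_nonneg_right hb2 (show 0 ≤ η / 4 * J by positivity)
  linarith

section
variable {Q : ℕ} [NeZero Q]

noncomputable def lam (f0 f1 f2 : ZMod Q → ℂ) (K : ℕ) : ℂ :=
  ∑ x, ∑ y ∈ range K, f0 x * f1 (x + ¶y) * f2 (x + ¶y ^ 2)

lemma lam_Dn (f0 f1 f2 : ZMod Q → ℂ) (K : ℕ) (hK : 0 < K) : lam f0 f1 f2 K = K * ∑ w, f1 w * Dn f0 f2 K w := by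
  have hK' : (K : ℂ) ≠ 0 := mod_cast hK.ne'
  unfold lam Dn
  have h1 : ∀ w, (K : ℂ) * (f1 w * ((∑ y ∈ range K, f0 (w - y) * f2 (w - y + (y : ZMod Q) ^ 2)) / K)) = ∑ y ∈ range K, f1 w * (f0 (w - y) * f2 (w - y + (y : ZMod Q) ^ 2)) := by
    intro w; rw [← mul_sum]; field_simp
  rw [sum_comm, mul_sum]
  simp_rw [h1]
  rw [sum_comm (s := univ)]
  refine sc fun (y : ℕ) _ => ?_
  conv_rhs => rw [← sum_translate (E := ℂ) (y : ZMod Q)]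
  refine sc fun x _ => ?_
  rw [add_sub_cancel_right]; ring

lemma selfdual (D g : ZMod Q → ℂ) (hg : Bd g) (δ : ℝ) (hδ : 0 ≤ δ) (h : δ * Q ≤ ‖∑ w, g w * D w‖) :
    δ ^ 2 * Q ≤ ‖∑ w, conj (D w) * D w‖ := by
  have hQ : 0 < §Q := Qpos
  have h1 := cs_bdd univ g D (fun x _ => hg x)
  rw [cardZ] at h1
  have h2 := (pow_le_pow_left₀ (by positivity) h 2).trans h1
  have h3 : ∑ w, conj (D w) * D w = ((∑ w, ‖D w‖ ^ 2 : ℝ) : ℂ) := by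
    push_cast
    exact sc fun w _ => Complex.conj_mul' _
  rw [h3, Complex.norm_real, Real.norm_of_nonneg (by positivity)]
  refine le_of_mul_le_mul_left (le_trans (le_of_eq ?_) h2) hQ
  ring

lemma exH (δ : ℝ) (hδ : 0 < δ) (hδ2 : δ ≤ 1 / 2) : ∃ H : ℕ, 16 ≤ δ ^ 4 * H ∧ δ ^ 9 * H ≤ 1 := by
  refine ⟨⌈16 / δ ^ 4⌉₊, ?_, ?_⟩
  · have := Nat.le_ceil (16 / δ ^ 4)
    rw [div_le_iff₀ (by positivity)] at this; linarith
  · have h1 : (⌈16 / δ ^ 4⌉₊ : ℝ) ≤ 16 / δ ^ 4 + 1 := (Nat.ceil_lt_add_one (by positivity)).le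
    have h3 : δ ^ 4 ≤ 1 := pow_le_one₀ hδ.le (by linarith)
    have h4 : 17 * δ ^ 5 ≤ δ ^ 0 := powc hδ hδ2 5 (by norm_num) (by norm_num)
    calc δ ^ 9 * ⌈16 / δ ^ 4⌉₊ ≤ δ ^ 9 * (16 / δ ^ 4 + 1) := by gcongr
      _ = δ ^ 5 * (16 + δ ^ 4) := by field_simp
      _ ≤ δ ^ 5 * 17 := by gcongr; linarith
      _ ≤ 1 := by simpa [mul_comm] using h4

set_option maxHeartbeats 1000000 in
lemma partA (δ : ℝ) (hδ : 0 < δ) (hδ2 : δ ≤ 1 / 2) (K : ℕ) (f0 f1 f2 : ZMod Q → ℂ) (h0 : Bd f0) (h1 : Bd f1) (h2 : Bd f2)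
    (hbig : 1 ≤ δ ^ 30 * K) (h : δ * Q * K ≤ ‖lam f0 f1 f2 K‖) : ∃ q : ℕ, 0 < q ∧ δ ^ 30 * q ≤ 1 ∧ ∀ T : ℕ, 0 < T → T ≤ δ ^ 30 * K →
      ∃ (d : ZMod Q) (κ : ZMod Q → ℕ → ℝ), δ ^ 30 * Q * T ^ 2 ≤ ∑ x : ZMod Q, ∑ s ∈ range T,
        ‖∑ t ∈ range (2 * T), Dn f0 f2 K (x + (q : ZMod Q) * t) * conj (Dn f0 f2 K (x + d + (q : ZMod Q) * (s + t))) * e (κ x s * t)‖ := by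
  have hK := Kpos hbig
  have hK0 : 0 < K := mod_cast hK
  have hQ : 0 < §Q := Qpos
  have hDb := Dn_norm f0 f2 h0 h2 K
  set D := Dn f0 f2 K with hD
  rw [lam_Dn f0 f1 f2 K hK0, norm_mul, Complex.norm_natCast] at h
  have hs := selfdual D f1 h1 δ hδ.le (by
    refine le_of_mul_le_mul_left (le_trans (le_of_eq ?_) h) hK; ring)
  let g : ZMod Q → ℂ := fun w => conj (D w)
  have hg : Bd g := fun x => bconj (hDb x)
  have hl : δ ^ 2 * Q * K ≤ ‖lam f0 g f2 K‖ := by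
    rw [lam_Dn f0 g f2 K hK0, norm_mul, Complex.norm_natCast]
    have := mul_le_mul_of_nonneg_left hs hK.le
    exact le_trans (le_of_eq (by ring)) this
  let G : ZMod Q → ℤ → ℂ := fun z y => f0 (z - (y : ZMod Q) ^ 2) * g (z - (y : ZMod Q) ^ 2 + y)
  have hGl : lam f0 g f2 K = ∑ z, f2 z * ∑ y ∈ range K, G z y := by
    unfold lam
    simp_rw [mul_sum]
    rw [sum_comm, sum_comm (s := univ)]
    refine sc fun (y : ℕ) _ => ?_
    conv_rhs => rw [← sum_translate (E := ℂ) (¶y ^ 2)]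
    refine sc fun x _ => ?_
    simp only [G, Int.cast_natCast]
    rw [add_sub_cancel_right]; ring
  obtain ⟨H, hH1, hH2⟩ := exH δ hδ hδ2
  have hGb : ∀ x r, ‖G x r‖ ≤ 1 := fun x r => bmul (h0 _) (hg _)
  obtain ⟨j, l, hj, hl1, hl2, hv⟩ := vdc univ G hGb (δ ^ 2) (by positivity) (pow_le_one₀ hδ.le (by linarith)) K 1 H
    (by
      calc 8 * (§1 * H) ≤ 8 * H * (δ ^ 30 * K) := by
            rw [Nat.cast_one, one_mul]; exact le_mul_of_one_le_right (by positivity) hbig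
        _ = 8 * δ ^ 21 * (δ ^ 9 * H) * K := by ring
        _ ≤ δ ^ 2 * 1 * K := by gcongr; exact powc hδ hδ2 3 (by norm_num) (by norm_num)
        _ = _ := by ring)
    (le_trans hH1 (le_of_eq (by ring))) (by
      rw [cardZ]
      refine hl.trans ?_
      rw [hGl]
      exact norm_sum_le_of_le _ fun z _ => by rw [norm_mul]; exact mul_le_of_le_one_left (norm_nonneg _) (h2 z))
  rw [cardZ] at hv
  have hlr : (l : ℝ) ≤ H := mod_cast hl2.le
  have hlr1 : (1 : ℝ) ≤ l := mod_cast hl1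
  have hδl : δ ^ 9 * l ≤ 1 := le_trans (by gcongr) hH2
  have hσb : δ ^ 21 * (2 * l * (2 * l + 1)) ≤ 1 := by
    have := powc hδ hδ2 3 (c := 6) (n := 3) (m := 0) (by norm_num) (by norm_num)
    calc δ ^ 21 * (2 * l * (2 * l + 1)) ≤ δ ^ 21 * (2 * l * (2 * l + l)) := by gcongr
      _ = (6 * δ ^ 3) * (δ ^ 9 * l) ^ 2 := by ring
      _ ≤ δ ^ 0 * 1 ^ 2 := by gcongr
      _ = 1 := by simp
  refine ⟨2 * l * (2 * l + 1), by positivity, ?_, fun T hT hT2 => ?_⟩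
  · push_cast
    exact le_trans (by gcongr ?_ * _; exact pown hδ hδ2 (by norm_num)) hσb
  have hη : δ ^ 5 ≤ (δ ^ 2) ^ 2 / 2 := by
    have := powc hδ hδ2 1 (c := 2) (n := 5) (m := 4) (by norm_num) (by norm_num); rw [← pow_mul]; linarith
  let c1 : ZMod Q := -(2 * l * j) - l ^ 2
  obtain ⟨d, κ, hfin⟩ := l4 f0 (fun x => conj (f0 (x + c1))) (fun x => conj (g (x + (c1 + j + l)))) (fun x => g (x + j)) h0 (fun x => bconj (h0 _))
    (fun x => bconj (hg _)) (fun x => hg _) (-(2 * l)) (1 - 2 * l) 1 (2 * l * (2 * l + 1)) (2 * l) (2 * l + 1) (2 * l * (2 * l + 1))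
    (by ring) (by ring) (by ring) K T hK0 hT (δ ^ 5) (by positivity) (by
      push_cast
      rw [abs_of_nonneg (by positivity), abs_of_nonneg (by positivity), abs_of_nonneg (by positivity)]
      have a1 : (2 * l * (2 * l + 1) + 2 * l + (2 * l + 1) : ℝ) ≤ 3 * (2 * l * (2 * l + 1)) := by nlinarith
      calc 4 * (T * (2 * l * (2 * l + 1) + 2 * l + (2 * l + 1) : ℝ)) ≤ 4 * (δ ^ 30 * K * (3 * (2 * l * (2 * l + 1)))) := by gcongr
        _ = 12 * δ ^ 9 * K * (δ ^ 21 * (2 * l * (2 * l + 1))) := by ring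
        _ ≤ δ ^ 5 * K * 1 := by gcongr; exact powc hδ hδ2 4 (by norm_num) (by norm_num)
        _ = _ := by ring)
    (by
      refine le_trans (by rw [mul_assoc, mul_assoc ((δ ^ 2) ^ 2 / 2)]; gcongr) (hv.trans (le_of_eq ?_))
      congr 1
      rw [sum_comm, sum_comm (s := univ)]
      refine sc fun (r : ℕ) _ => ?_
      conv_lhs => rw [← sum_translate (E := ℂ) ((¶r + ¶j) ^ 2)]
      refine sc fun x _ => ?_
      have hh : ∀ {a b c d a' b' c' d' : ZMod Q}, a = a' → b = b' → c = c' → d = d' → f0 a * g b * conj (f0 c * g d) = f0 a' * conj (f0 c') * conj (g d') * g b' := by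
        rintro a b c d _ _ _ _ rfl rfl rfl rfl; rw [map_mul]; ring
      refine hh ?_ ?_ ?_ ?_ <;> (try simp only [c1]) <;> push_cast <;> ring)
  refine ⟨d, fun x s => -κ (x - j) s, ?_⟩
  refine le_trans ?_ (hfin.trans (le_of_eq ?_))
  · have := powc hδ hδ2 2 (c := 4) (n := 30) (m := 10) (by norm_num) (by norm_num)
    rw [mul_assoc, mul_assoc]
    gcongr
    rw [← pow_mul]; linarith
  · conv_rhs => rw [← sum_translate (E := ℝ) (j : ZMod Q)]
    refine sc fun x _ => sc fun s _ => ?_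
    rw [← RCLike.norm_conj, map_sum]
    congr 1
    refine sc fun t _ => ?_
    simp only [g, map_mul, Complex.conj_conj, e_conj, add_sub_cancel_right, neg_mul]
    have hh : ∀ {a b a' b' : ZMod Q} (w : ℂ), a = a' → b = b' → D a * conj (D b) * w = D a' * conj (D b') * w := by
      rintro a b _ _ w rfl rfl; rfl
    refine hh _ ?_ ?_ <;> push_cast <;> ring
end
end

noncomputable def Iw {Q : ℕ} (D : ZMod Q → ℂ) (q T : ℕ) (d : ZMod Q) (κ : ZMod Q → ℕ → ℝ) (x : ZMod Q) (s : ℕ) : ℂ :=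
  ∑ t ∈ range (2 * T), D (x + ¶q * (t : ZMod Q)) * conj (D (x + d + ¶q * (¶s + (t : ZMod Q)))) * e (κ x s * t)

noncomputable def tw {Q : ℕ} (f : ZMod Q → ℂ) (a b x : ZMod Q) : ℂ := conj (f (x + a)) * f (x + b)

lemma B1a {Q : ℕ} [NeZero Q] (η : ℝ) (hη : 0 < η) (K T q : ℕ) (hK : 0 < K) (hT : 0 < T) (f0 f2 : ZMod Q → ℂ) (h0 : Bd f0) (h2 : Bd f2)
    (d : ZMod Q) (κ : ZMod Q → ℕ → ℝ) (γ : ZMod Q → ℕ → ℂ)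
    (h : η * Q * T ^ 2 ≤ ‖∑ w, ∑ s ∈ range T, γ w s * Iw (Dn f0 f2 K) q T d κ w s‖) :
    ∃ s' < T, η ^ 2 / 2 * Q * T ^ 2 ≤ ∑ s ∈ range T, ‖∑ w, γ w s * conj (γ w s') * ∑ r ∈ range (2 * T),
      Dn (tw f0 (d + ¶q * ¶s) (d + ¶q * (s' : ZMod Q))) (tw f2 (d + ¶q * ¶s) (d + ¶q * (s' : ZMod Q))) K
        (w + ¶q * ¶r) * e ((κ w s - κ w s') * r)‖ := by
  have hKr : 0 < §K := mod_cast hK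
  have hTr : 0 < §T := mod_cast hT
  have hQ : 0 < §Q := Qpos
  have hK' : (K : ℂ) ≠ 0 := mod_cast hK.ne'
  have hDb := Dn_norm f0 f2 h0 h2 K
  let F : ℕ → ZMod Q → ℂ := fun y w => f0 (w - y) * f2 (w - y + (y : ZMod Q) ^ 2)
  have hDF : ∀ w, (K : ℂ) * conj (Dn f0 f2 K w) = ∑ y ∈ range K, conj (F y w) := by
    intro w
    have : (K : ℂ) * Dn f0 f2 K w = ∑ y ∈ range K, F y w := by simp only [Dn, F]; field_simp
    rw [← map_sum, ← this, map_mul, Complex.conj_natCast]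
  set D := Dn f0 f2 K with hD
  let H : ZMod Q × ℕ × ℕ → ℕ → ℂ := fun p s => γ p.1 s * conj (F p.2.2 (p.1 + d + ¶q * (¶s + (p.2.1 : ZMod Q)))) * e (κ p.1 s * p.2.1)
  let X : Finset (ZMod Q × ℕ × ℕ) := univ ×ˢ (range (2 * T) ×ˢ range K)
  have hX : (#X : ℝ) = Q * (2 * T * K) := by
    simp only [X, card_product, card_range]; push_cast; rw [cardZ]
  have e1 : K * ∑ w, ∑ s ∈ range T, γ w s * Iw D q T d κ w s = ∑ p ∈ X, D (p.1 + ¶q * (p.2.1 : ZMod Q)) * ∑ s ∈ range T, H p s := by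
    simp only [X, sum_product, H, Iw]
    rw [mul_sum]
    refine sc fun w _ => ?_
    simp_rw [mul_sum]
    rw [sum_comm]
    refine sc fun r _ => ?_
    rw [sum_comm (s := range K)]
    refine sc fun s _ => ?_
    calc (K : ℂ) * (γ w s * (D (w + ¶q * ¶r) * conj (D (w + d + ¶q * (¶s + ¶r))) * e (κ w s * r)))
        = D (w + ¶q * ¶r) * (γ w s * e (κ w s * r)) * (K * conj (D (w + d + ¶q * (¶s + ¶r)))) := by ring
      _ = _ := by
        rw [hDF, mul_sum]
        exact sc fun y _ => by ring
  have h1 := cs_bdd X (fun p => D (p.1 + ¶q * (p.2.1 : ZMod Q))) (fun p => ∑ s ∈ range T, H p s) (fun p _ => hDb _)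
  rw [← e1, norm_mul, Complex.norm_natCast, hX] at h1
  have h3 := sumsq_le X (range T) H
  have h4 : η ^ 2 / 2 * Q * T ^ 3 * K ≤ ∑ i ∈ range T, ∑ j ∈ range T, ‖∑ x ∈ X, H x i * conj (H x j)‖ := by
    refine le_trans ?_ h3
    have h5 : (K * (η * Q * T ^ 2)) ^ 2 ≤ (K * ‖∑ w, ∑ s ∈ range T, γ w s * Iw D q T d κ w s‖) ^ 2 := by gcongr
    have h6 := h5.trans h1
    refine le_of_mul_le_mul_left (le_trans (le_of_eq ?_) h6) (show 0 < Q * (2 * T * K : ℝ) by positivity)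
    ring
  rw [sum_comm] at h4
  obtain ⟨s', hs', h7⟩ := pigeonR hT (fun j => ∑ i ∈ range T, ‖∑ x ∈ X, H x i * conj (H x j)‖) (K * (η ^ 2 / 2 * Q * T ^ 2)) (le_trans (le_of_eq (by ring)) h4)
  refine ⟨s', hs', ?_⟩
  refine le_of_mul_le_mul_left (h7.trans (le_of_eq ?_)) hKr
  rw [mul_sum]
  refine sc fun s _ => ?_
  rw [← Complex.norm_natCast, ← norm_mul]
  congr 1
  simp only [X, sum_product, H]
  rw [mul_sum]
  refine sc fun w _ => ?_
  rw [mul_sum, mul_sum]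
  refine sc fun r _ => ?_
  rw [sub_mul, sub_eq_add_neg, e_add, ← e_conj (κ w s' * r), Dn]
  have h9 : ∀ a b c S : ℂ, K * (a * b * (S / K * c)) = a * b * c * S := fun a b c S => by field_simp
  rw [h9, mul_sum]
  refine sc fun y _ => ?_
  simp only [F, tw, map_mul, Complex.conj_conj]
  have hh : ∀ {a b c d a' b' c' d' : ZMod Q} (x1 x2 x3 x4 : ℂ), a = a' → b = b' → c = c' → d = d' →
      x1 * (conj (f0 a) * conj (f2 b)) * x2 * (x3 * (f0 c * f2 d) * x4) = x1 * x3 * x2 * x4 * (conj (f0 a') * f0 c' * (conj (f2 b') * f2 d')) := by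
    rintro a b c d _ _ _ _ x1 x2 x3 x4 rfl rfl rfl rfl; ring
  refine (hh _ _ _ _ (a' := w + q * r - y + (d + q * s)) (b' := w + q * r - y + (y : ZMod Q) ^ 2 + (d + q * s)) (c' := w + q * r - y + (d + q * s')) (d' := w + q * r - y + (y : ZMod Q) ^ 2 + (d + q * s')) ?_ ?_ ?_ ?_).trans ?_
  · ring
  · ring
  · ring
  · ring
  · ring

set_option maxHeartbeats 1000000 in
lemma B1 : ∃ C : ℕ, 2 ≤ C ∧ ∀ (η : ℝ), 0 < η → η ≤ 1 / 2 → ∀ (Q : ℕ) [NeZero Q] (K T q : ℕ)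
    (f0 f2 : ZMod Q → ℂ) (_ : Bd f0) (_ : Bd f2) (d : ZMod Q) (κ : ZMod Q → ℕ → ℝ),
    0 < q → η * q ≤ 1 → 0 < T → η ^ 24 * K ≤ T → 16 * (q * T : ℝ) ≤ η ^ 8 * K → 1 ≤ η ^ C * K → §K ^ 2 ≤ Q → §Q ≤ 16 * K ^ 2 →
    η * Q * T ^ 2 ≤ ∑ w : ZMod Q, ∑ s ∈ range T, ‖Iw (Dn f0 f2 K) q T d κ w s‖ →
    ∃ (κ' : ZMod Q → ℝ) (X : Finset (Σ _ : ℕ, ZMod Q)), (∀ p ∈ X, p.1 < T) ∧ η ^ C * Q * T ≤ #X ∧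
      ∀ p ∈ X, Mj (η ^ C) K (κ p.2 p.1 - κ' p.2) ∧ η / 2 * T ≤ ‖Iw (Dn f0 f2 K) q T d κ p.2 p.1‖ := by
  classical
  obtain ⟨C, hC2, hC⟩ := EP
  refine ⟨8 * C + 18, by omega, fun η hη hη2 Q _ K T q f0 f2 h0 h2 d κ hq hηq hT hKT hqT hbig hKQ hQK h => ?_⟩
  have hK := Kpos hbig
  have hK0 : 0 < K := mod_cast hK
  have hTr : 0 < §T := mod_cast hT
  have hQ : 0 < §Q := Qpos
  set I := Iw (Dn f0 f2 K) q T d κ with hI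
  let γ : ZMod Q → ℕ → ℂ := fun w s => if η / 2 * T ≤ ‖I w s‖ then ph (I w s) else 0
  have hγb : ∀ w s, ‖γ w s‖ ≤ 1 := fun w s => by
    simp only [γ]; split_ifs
    · exact (ph_norm _).le
    · simp
  have h3 : η / 2 * Q * T ^ 2 ≤ ‖∑ w, ∑ s ∈ range T, γ w s * I w s‖ := by
    have hg : ∀ w s, ‖I w s‖ ≤ (γ w s * I w s).re + η / 2 * T := fun w s => by
      simp only [γ]; split_ifs with hc
      · rw [ph_mul, Complex.ofReal_re]; linarith [show 0 ≤ η / 2 * T by positivity]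
      · push Not at hc; simp; linarith
    have h5 : ∑ w : ZMod Q, ∑ s ∈ range T, ‖I w s‖ ≤ ∑ w : ZMod Q, ∑ s ∈ range T, ((γ w s * I w s).re + η / 2 * T) :=
      sum_le_sum fun w _ => sum_le_sum fun s _ => hg w s
    simp only [sum_add_distrib, sum_const, card_range, nsmul_eq_mul] at h5
    rw [cardZ] at h5
    have h6 := Complex.re_le_norm (∑ w, ∑ s ∈ range T, γ w s * I w s)
    simp only [Complex.re_sum] at h6
    linarith
  obtain ⟨s', hs', h4⟩ := B1a (η / 2) (by positivity) K T q hK0 hT f0 f2 h0 h2 d κ γ h3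
  let a : ℕ → ZMod Q := fun s => d + ¶q * ¶s
  let wn : ℕ → ZMod Q → ℂ := fun s w => ∑ r ∈ range (2 * T),
      Dn (tw f0 (a s) (a s')) (tw f2 (a s) (a s')) K (w + ¶q * ¶r) * e ((κ w s - κ w s') * r)
  have htw : ∀ f : ZMod Q → ℂ, (Bd f) → ∀ b c x, ‖tw f b c x‖ ≤ 1 := fun f hf b c x => bmul (bconj (hf _)) (hf _)
  have hwnb : ∀ s w, ‖wn s w‖ ≤ 2 * T := fun s w => by
    have := norm_sum_le_card (range (2 * T)) (fun r : ℕ => Dn (tw f0 (a s) (a s')) (tw f2 (a s) (a s')) K (w + ¶q * ¶r) * e ((κ w s - κ w s') * r)) 1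
      (fun r _ => bmul (Dn_norm _ _ (htw f0 h0 _ _) (htw f2 h2 _ _) _ _) (norm_e _).le)
    simpa using this
  let P : ℕ → Finset (ZMod Q) := fun s => univ.filter fun w => η / 2 * T ≤ ‖I w s‖
  let g : ℕ → ℝ := fun s => ∑ w ∈ P s, ‖wn s w‖
  have h5 : (η / 2) ^ 2 / 2 * Q * T ^ 2 ≤ ∑ s ∈ range T, g s := by
    refine h4.trans (sum_le_sum fun s _ => ?_)
    simp only [g, P]
    rw [sum_filter]
    refine norm_sum_le_of_le _ fun w _ => ?_
    simp only [γ]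
    split_ifs with hc hd
    · rw [norm_mul]
      exact mul_le_of_le_one_left (norm_nonneg _) (bmul (ph_norm _).le (bconj (ph_norm _).le))
    · rw [map_zero, mul_zero, zero_mul, norm_zero]; exact norm_nonneg _
    · simp
    · simp
  have hgb : ∀ s ∈ range T, g s ≤ Q * (2 * T) := fun s _ => by
    have := sum_le_card_nsmul (P s) (fun w => ‖wn s w‖) (2 * T) (fun w _ => hwnb s w)
    rw [nsmul_eq_mul] at this
    exact this.trans (mul_le_mul_of_nonneg_right (cardle _) (by positivity))
  have hp := popular (range T) g (η ^ 2 / 16) (Q * (2 * T)) (by positivity) (by positivity) hgb (by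
    rw [card_range]; refine le_trans (le_of_eq ?_) h5; ring)
  set S := (range T).filter (fun s => η ^ 2 / 16 / 2 * (Q * (2 * T)) ≤ g s) with hS
  have hη8 : η ^ 8 ≤ η ^ 2 / 16 / 2 := by
    have := powc hη hη2 5 (c := 32) (n := 8) (m := 2) (by norm_num) (by norm_num); linarith
  have hY : ∀ s ∈ S, ∃ Y : Finset (ZMod Q), Y ⊆ P s ∧ η ^ 8 / 4 * Q ≤ #Y ∧ ∀ w ∈ Y, Mj ((η ^ 8) ^ C) K (κ w s - κ w s') := by
    intro s hs
    have hs2 := (mem_filter.mp hs).2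
    have := hC (η ^ 8) (by positivity) ((pown hη hη2 (m := 1) (by norm_num)).trans (by simpa using hη2)) Q K (2 * T) q (tw f0 (a s) (a s')) (tw f2 (a s) (a s'))
      (htw f0 h0 _ _) (htw f2 h2 _ _) (fun w => κ w s - κ w s') (P s) hq
      (le_trans (by gcongr; simpa using pown hη hη2 (m := 1) (n := 8) (by norm_num)) hηq)
      (by push_cast; rw [← pow_mul]; norm_num; linarith) (by push_cast; linarith)
      (by rw [← pow_mul]; exact bigmono hη hη2 hbig (by omega)) hKQ hQK
      (by push_cast; refine le_trans ?_ hs2; rw [mul_assoc]; gcongr)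
    exact ⟨_, filter_subset _ _, this, fun w hw => (mem_filter.mp hw).2.1⟩
  choose! Y hY1 hY2 hY3 using hY
  refine ⟨fun w => κ w s', S.sigma Y, ?_, ?_, ?_⟩
  · rintro ⟨s, w⟩ hp'
    exact mem_range.mp (mem_filter.mp (mem_sigma.mp hp').1).1
  · rw [card_sigma]; push_cast
    have h7 := card_nsmul_le_sum S (fun s => (#(Y s) : ℝ)) (η ^ 8 / 4 * Q) hY2
    rw [nsmul_eq_mul] at h7
    refine le_trans ?_ h7
    rw [card_range] at hp
    have h8 : η ^ (8 * C + 18) ≤ η ^ 8 * (η ^ 8 / 4) := by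
      have := powc hη hη2 2 (c := 4) (n := 8 * C + 18) (m := 16) (by norm_num) (by omega)
      have e : η ^ 8 * (η ^ 8 / 4) = η ^ 16 / 4 := by ring
      rw [e]; linarith
    calc η ^ (8 * C + 18) * Q * T ≤ η ^ 8 * (η ^ 8 / 4) * Q * T := by gcongr
      _ = η ^ 8 * T * (η ^ 8 / 4 * Q) := by ring
      _ ≤ _ := by gcongr; exact le_trans (by gcongr) hp
  · rintro ⟨s, w⟩ hp'
    obtain ⟨a1, a2⟩ := mem_sigma.mp hp'
    refine ⟨(hY3 s a1 w a2).mono ?_, (mem_filter.mp (hY1 s a1 a2)).2⟩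
    rw [← pow_mul]; exact pown hη hη2 (by omega)

set_option maxHeartbeats 1000000 in
lemma B2 {Q : ℕ} [NeZero Q] (D : ZMod Q → ℂ) (hD : Bd D) (ε η : ℝ) (hε : 0 < ε) (hη : 0 < η) (hε1 : ε ≤ 1) (K T J q : ℕ) (hT : 0 < T) (hJ : 0 < J)
    (d : ZMod Q) (κ : ZMod Q → ℕ → ℝ) (κ' : ZMod Q → ℝ) (X : Finset (Σ _ : ℕ, ZMod Q)) (hXT : ∀ p ∈ X, p.1 < T) (hXc : ε * Q * T ≤ #X)
    (hX : ∀ p ∈ X, Mj ε K (κ p.2 p.1 - κ' p.2) ∧ η / 2 * T ≤ ‖Iw D q T d κ p.2 p.1‖)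
    (h28 : 28 * §J ≤ η / 4 * ε * K) (h64 : 64 * §J ≤ ε ^ 3 * η * T) :
    ∃ q' : ℕ, 0 < q' ∧ ε * q' ≤ 1 ∧ ∃ κ2 : ZMod Q → ℝ,
      ε ^ 2 * η / 32 * Q * J ≤ ∑ w : ZMod Q, ‖∑ t ∈ range (2 * J), D (w + ¶(q * q') * (t : ZMod Q)) * e (κ2 w * t)‖ := by
  have hQ : 0 < §Q := Qpos
  have hTr : 0 < §T := mod_cast hT
  have hJr : 0 < §J := mod_cast hJ
  let G : (Σ _ : ℕ, ZMod Q) → ℤ → ℂ := fun p r => D (p.2 + (q : ZMod Q) * (r : ZMod Q)) * conj (D (p.2 + d + (q : ZMod Q) * ((p.1 : ZMod Q) + (r : ZMod Q)))) * e (κ' p.2 * r)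
  obtain ⟨q', hq', hεq', r0, hr0, hs⟩ := SW X G (fun p r => bmul (bmul (hD _) (bconj (hD _))) (norm_e _).le) (fun p => κ p.2 p.1 - κ' p.2) ε (η / 4) hε (by positivity) hε1 K (2 * T) J
    (by omega) (fun p hp => (hX p hp).1) h28 (by
      push_cast
      have : ε ^ 3 * η * T ≤ ε * η * T := by
        gcongr; exact pow_le_of_le_one hε.le hε1 (by norm_num)
      have h0 : 0 ≤ ε * η * T := by positivity
      linarith) (fun p hp => by
      refine le_trans (le_trans (le_of_eq ?_) (hX p hp).2) (le_of_eq ?_)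
      · push_cast; ring
      · congr 1
        refine sc fun t _ => ?_
        simp only [G, Int.cast_natCast]
        rw [mul_assoc _ (e (κ' p.2 * t)), ← e_add]
        congr 2; ring)
  refine ⟨q', hq', hεq', ?_⟩
  let A : ZMod Q → ℤ → ℂ := fun w s => ∑ j ∈ range J, D (w + ¶q * ((r0 : ZMod Q) + ¶q' * ¶j)) *
    conj (D (w + d + (q : ZMod Q) * ((s : ZMod Q) + ((r0 : ZMod Q) + (q' : ZMod Q) * (j : ZMod Q))))) * e (κ' w * (r0 + q' * j))
  have hAb : ∀ w s, ‖A w s‖ ≤ J := fun w s => by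
    have := norm_sum_le_card (range J) (fun j : ℕ => D (w + ¶q * ((r0 : ZMod Q) + ¶q' * ¶j)) *
      conj (D (w + d + (q : ZMod Q) * ((s : ZMod Q) + ((r0 : ZMod Q) + (q' : ZMod Q) * (j : ZMod Q))))) * e (κ' w * (r0 + q' * j))) 1
      (fun r _ => bmul (bmul (hD _) (bconj (hD _))) (norm_e _).le)
    simpa using this
  set θ := ε ^ 2 * η / 16 with hθ
  have h1 : θ * Q * T * J ≤ ∑ w : ZMod Q, ∑ s ∈ range T, ‖A w s‖ := by
    have a1 : ∑ x ∈ X, ‖∑ j ∈ range J, G x (r0 + (q' * j : ℕ))‖ ≤ ∑ x ∈ (range T).sigma (fun _ => (univ : Finset (ZMod Q))), ‖A x.2 x.1‖ := by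
      have : ∀ x : (Σ _ : ℕ, ZMod Q), ∑ j ∈ range J, G x (r0 + (q' * j : ℕ)) = A x.2 x.1 := fun x => by
        simp only [G, A]; push_cast; rfl
      simp only [this]
      refine sum_le_sum_of_subset_of_nonneg (fun p hp => ?_) fun _ _ _ => norm_nonneg _
      exact mem_sigma.mpr ⟨mem_range.mpr (hXT p hp), mem_univ _⟩
    rw [sum_sigma, sum_comm] at a1
    refine le_trans ?_ (hs.trans a1)
    calc θ * Q * T * J = ε * (η / 4) / 4 * (ε * Q * T) * J := by rw [hθ]; ring
      _ ≤ _ := by gcongr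
  let B : ZMod Q → ℤ → ℂ := fun w s => ((‖A w s‖ / J : ℝ) : ℂ)
  have hBs : ∀ (w : ZMod Q) (n : ℕ) (g : ℕ → ℤ), ‖∑ s ∈ range n, B w (g s)‖ = (∑ s ∈ range n, ‖A w (g s)‖) / J := fun w n g => by
    simp only [B]
    rw [← Complex.ofReal_sum, Complex.norm_real, ← sum_div, Real.norm_of_nonneg]
    positivity
  obtain ⟨s0, hs0, h2⟩ := subwin univ B (fun w s => by
      simp only [B]; rw [Complex.norm_real, Real.norm_of_nonneg (by positivity)]
      exact div_le_one_of_le₀ (hAb w s) hJr.le) T q' J hT θ (by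
      refine le_of_mul_le_mul_left ?_ hε
      calc ε * (4 * (q' * J)) = (ε * q') * (4 * J) := by ring
        _ ≤ 1 * (4 * J) := by gcongr
        _ ≤ ε ^ 3 * η * T / 16 := by linarith
        _ = _ := by rw [hθ]; ring) (by
      simp only [hBs]
      rw [← sum_div, le_div_iff₀ hJr, cardZ]
      exact h1)
  simp only [hBs] at h2
  rw [← sum_div, le_div_iff₀ hJr, cardZ] at h2
  let a : ZMod Q := d + ¶q * ((s0 : ZMod Q) + (r0 : ZMod Q))
  have h3 : ∀ w : ZMod Q, ∃ k : ℝ, ∑ i ∈ range J, ‖A w (s0 + (q' * i : ℕ))‖ ≤ J * ‖∑ t ∈ range (2 * J), D (w + a + ¶(q * q') * (t : ZMod Q)) * e (-k * t)‖ := by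
    intro w
    obtain ⟨k, hk⟩ := wlem1 J (fun t => conj (D (w + a + ¶(q * q') * (t : ZMod Q))))
      (fun i => ph (A w (s0 + (q' * i : ℕ)))) (fun j => D (w + ¶q * ((r0 : ZMod Q) + ¶q' * ¶j)) * e (κ' w * (r0 + q' * j)))
      (fun i => (ph_norm _).le) (fun j => bmul (hD _) (norm_e _).le)
    refine ⟨k, ?_⟩
    rw [← sum_norm_eq]
    refine le_trans (le_of_eq ?_) (hk.trans (le_of_eq ?_))
    · congr 1
      refine sc fun i _ => ?_
      simp only [A]
      rw [mul_sum]
      refine sc fun j _ => ?_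
      have hh : ∀ {b b' : ZMod Q} (p x y : ℂ), b = b' → p * (x * conj (D b) * y) = conj (D b') * p * (x * y) := by
        rintro b _ p x y rfl; ring
      refine hh _ _ _ ?_
      simp only [a]; push_cast; ring
    · congr 1
      rw [← RCLike.norm_conj, map_sum]
      congr 1
      refine sc fun t _ => ?_
      rw [map_mul, Complex.conj_conj, e_conj]
      congr 2; ring
  choose k hk using h3
  refine ⟨fun w => -k (w - a), ?_⟩
  have h4 := h2.trans (sum_le_sum fun w _ => hk w)
  rw [← mul_sum] at h4
  have h5 : θ / 2 * Q * J ≤ ∑ w : ZMod Q, ‖∑ t ∈ range (2 * J), D (w + a + ¶(q * q') * (t : ZMod Q)) * e (-k w * t)‖ :=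
    le_of_mul_le_mul_left (le_trans (le_of_eq (by ring)) h4) hJr
  refine le_trans (le_of_eq (by rw [hθ]; ring)) (h5.trans (le_of_eq ?_))
  conv_rhs => rw [← sum_translate (E := ℝ) a]
  simp only [add_sub_cancel_right]

def LB {Q : ℕ} [NeZero Q] (f : ZMod Q → ℂ) (K : ℕ) (δ : ℝ) : Prop :=
  ∃ q R : ℕ, 0 < q ∧ 0 < R ∧ δ * q ≤ 1 ∧ δ * K ≤ R ∧ (q * R : ℝ) ≤ K ∧
    δ * Q * R ≤ ∑ x : ZMod Q, ‖∑ r ∈ range R, f (x + ¶q * ¶r)‖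

set_option maxHeartbeats 1000000 in
lemma B3 : ∃ C : ℕ, 2 ≤ C ∧ ∀ (η : ℝ), 0 < η → η ≤ 1 / 2 → ∀ (Q : ℕ) [NeZero Q] (K R q : ℕ)
    (f0 f2 : ZMod Q → ℂ) (_ : ∀ x, ‖f0 x‖ ≤ 1) (_ : ∀ x, ‖f2 x‖ ≤ 1) (β : ZMod Q → ℝ),
    0 < q → η * q ≤ 1 → η ^ 3 * K ≤ R → 8 * (q * R : ℝ) ≤ η * K → 1 ≤ η ^ C * K → (K : ℝ) ^ 2 ≤ Q → (Q : ℝ) ≤ 16 * K ^ 2 →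
    η * Q * R ≤ ∑ w, ‖∑ r ∈ range R, Dn f0 f2 K (w + (q : ZMod Q) * (r : ZMod Q)) * e (β w * r)‖ →
    LB (Dn f0 f2 K) K (η ^ C) := by
  classical
  obtain ⟨C, hC2, hC⟩ := EP
  refine ⟨C + 20, by omega, fun η hη hη2 Q _ K R q f0 f2 h0 h2 β hq hηq hKR hqR hbig hKQ hQK h => ?_⟩
  have hK := Kpos hbig
  have hQ : (0 : ℝ) < Q := Qpos
  have hRr : (0 : ℝ) < R := lt_of_lt_of_le (by positivity) hKR
  have hR : 0 < R := by exact_mod_cast hRr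
  have hD := Dn_norm f0 f2 h0 h2 K
  have h3 := hC η hη hη2 Q K R q f0 f2 h0 h2 β Finset.univ hq hηq hKR hqR (bigmono hη hη2 hbig (by omega)) hKQ hQK h
  obtain ⟨X, hXc, hX⟩ : ∃ X : Finset (ZMod Q), η / 4 * Q ≤ #X ∧ ∀ w ∈ X, Mj (η ^ C) K (β w) ∧ η / 4 * R ≤ ‖∑ r ∈ range R, Dn f0 f2 K (w + (q : ZMod Q) * (r : ZMod Q)) * e (β w * r)‖ :=
    ⟨_, h3, fun w hw => (Finset.mem_filter.mp hw).2⟩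
  obtain ⟨J, hJ, hJ1, hJ2⟩ := exR hη hη2 (C + 10) K (bigmono hη hη2 hbig (by omega))
  set D := Dn f0 f2 K with hDD
  let G : ZMod Q → ℤ → ℂ := fun w r => D (w + (q : ZMod Q) * (r : ZMod Q))
  obtain ⟨q', hq', hεq', r0, hr0, hs⟩ := SW X G (fun w r => hD _) β (η ^ C) (η / 4) (by positivity) (by positivity) (pow_le_one₀ hη.le (by linarith)) K R J hR
    (fun w hw => (hX w hw).1) (by
      have := powc hη hη2 7 (c := 112) (n := C + 10) (m := C + 1) (by norm_num) (by omega)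
      have h5 := mul_le_mul_of_nonneg_right this hK.le
      rw [pow_succ η C] at h5
      linarith) (by
      have := powc hη hη2 4 (c := 16) (n := C + 10) (m := C + 4) (by norm_num) (by omega)
      have h5 := mul_le_mul_of_nonneg_right this hK.le
      have h6 := mul_le_mul_of_nonneg_left hKR (show 0 ≤ η ^ (C + 1) by positivity)
      have e1 : η ^ (C + 4) = η ^ (C + 1) * η ^ 3 := by ring
      rw [e1] at h5
      rw [pow_succ η C] at h5 h6
      linarith) (fun w hw => by
      refine (hX w hw).2.trans (le_of_eq ?_)
      simp only [G, Int.cast_natCast])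
  have hJr : (0 : ℝ) < J := by exact_mod_cast hJ
  have hqq : η ^ (C + 1) * ((q * q' : ℕ) : ℝ) ≤ 1 := by
    calc η ^ (C + 1) * ((q * q' : ℕ) : ℝ) = (η * q) * (η ^ C * q') := by push_cast; ring
      _ ≤ 1 := mul_le_one₀ hηq (by positivity) hεq'
  refine ⟨q * q', J, by positivity, hJ, ?_, ?_, ?_, ?_⟩
  · exact le_trans (by gcongr ?_ * _; exact pown hη hη2 (by omega)) hqq
  · exact le_trans (by gcongr ?_ * _; exact pown hη hη2 (by omega)) hJ1
  · calc ((q * q' : ℕ) : ℝ) * J ≤ ((q * q' : ℕ) : ℝ) * (η ^ (C + 10) * K) := by gcongr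
      _ ≤ ((q * q' : ℕ) : ℝ) * (η ^ (C + 1) * K) := by gcongr ?_ * (?_ * _); exact pown hη hη2 (by omega)
      _ = (η ^ (C + 1) * ((q * q' : ℕ) : ℝ)) * K := by ring
      _ ≤ 1 * K := by gcongr
      _ = K := one_mul _
  · have h7 : η ^ (C + 20) ≤ η ^ C * (η / 4) / 4 * (η / 4) := by
      have := powc hη hη2 6 (c := 64) (n := C + 20) (m := C + 2) (by norm_num) (by omega)
      have e1 : η ^ C * (η / 4) / 4 * (η / 4) = η ^ (C + 2) / 64 := by ring
      rw [e1]; linarith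
    calc η ^ (C + 20) * Q * J ≤ η ^ C * (η / 4) / 4 * (η / 4) * Q * J := by gcongr
      _ = η ^ C * (η / 4) / 4 * (η / 4 * Q) * J := by ring
      _ ≤ η ^ C * (η / 4) / 4 * #X * J := by gcongr
      _ ≤ _ := hs
      _ ≤ ∑ x : ZMod Q, ‖∑ j ∈ range J, G x (r0 + (q' * j : ℕ))‖ := Finset.sum_le_sum_of_subset_of_nonneg (Finset.subset_univ _) fun _ _ _ => norm_nonneg _
      _ = _ := by
        conv_rhs => rw [← sum_translate (E := ℝ) ((q : ZMod Q) * (r0 : ZMod Q))]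
        refine Finset.sum_congr rfl fun x _ => ?_
        congr 1
        refine Finset.sum_congr rfl fun j _ => ?_
        simp only [G]
        congr 1; push_cast; ring

set_option maxHeartbeats 1000000 in
lemma PB : ∃ C : ℕ, 2 ≤ C ∧ ∀ (δ : ℝ), 0 < δ → δ ≤ 1 / 2 → ∀ (Q : ℕ) [NeZero Q] (K : ℕ)
    (f0 f1 f2 : ZMod Q → ℂ) (_ : ∀ x, ‖f0 x‖ ≤ 1) (_ : ∀ x, ‖f1 x‖ ≤ 1) (_ : ∀ x, ‖f2 x‖ ≤ 1),
    1 ≤ δ ^ C * K → (K : ℝ) ^ 2 ≤ Q → (Q : ℝ) ≤ 16 * K ^ 2 → δ * Q * K ≤ ‖lam f0 f1 f2 K‖ → LB (Dn f0 f2 K) K (δ ^ C) := by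
  obtain ⟨C1, hC1, H1⟩ := B1
  obtain ⟨C3, hC3, H3⟩ := B3
  set b := 2 * C1 + 10 with hb
  refine ⟨30 * (b * C3 + 3 * C1 + 30), by omega, fun δ hδ hδ2 Q _ K f0 f1 f2 h0 h1 h2 hbig hKQ hQK h => ?_⟩
  have hK := Kpos hbig
  have hQ : (0 : ℝ) < Q := Qpos
  have hD := Dn_norm f0 f2 h0 h2 K
  obtain ⟨q, hq, hηq, hA⟩ := partA δ hδ hδ2 K f0 f1 f2 h0 h1 h2 (bigmono hδ hδ2 hbig (by omega)) h
  rw [pow_mul] at hbig ⊢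
  have hη : 0 < δ ^ 30 := by positivity
  have hη2 : δ ^ 30 ≤ 1 / 2 := (pown hδ hδ2 (m := 1) (n := 30) (by norm_num)).trans (by simpa using hδ2)
  generalize δ ^ 30 = η at *
  obtain ⟨T, hT, hT1, hT2⟩ := exR hη hη2 13 K (bigmono hη hη2 hbig (by omega))
  obtain ⟨d, κ, hA2⟩ := hA T hT (hT2.trans (by gcongr ?_ * _; simpa using pown hη hη2 (m := 1) (n := 13) (by norm_num)))
  have hTr : (0 : ℝ) < T := by exact_mod_cast hT
  have hηq0 : 0 ≤ η * q := by positivity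
  obtain ⟨κ', X, hXT, hXc, hX⟩ := H1 η hη hη2 Q K T q f0 f2 h0 h2 d κ hq hηq hT (le_trans (by gcongr ?_ * _; exact pown hη hη2 (by norm_num)) hT1)
    (by
      have := powc hη hη2 4 (c := 16) (n := 12) (m := 8) (by norm_num) (by norm_num)
      calc 16 * (q * T : ℝ) ≤ 16 * (q * (η ^ 13 * K)) := by gcongr
        _ = 16 * η ^ 12 * K * (η * q) := by ring
        _ ≤ η ^ 8 * K * 1 := by gcongr
        _ = _ := mul_one _)
    (bigmono hη hη2 hbig (by nlinarith)) hKQ hQK hA2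
  obtain ⟨J, hJ, hJ1, hJ2⟩ := exR hη hη2 (3 * C1 + 25) K (bigmono hη hη2 hbig (by nlinarith))
  have hJr : (0 : ℝ) < J := by exact_mod_cast hJ
  obtain ⟨q', hq', hεq', κ2, hB⟩ := B2 (Dn f0 f2 K) hD (η ^ C1) η (by positivity) hη (pow_le_one₀ hη.le (by linarith)) K T J q hT hJ d κ κ' X hXT hXc hX
    (by
      have := powc hη hη2 7 (c := 112) (n := 3 * C1 + 25) (m := C1 + 1) (by norm_num) (by omega)
      have h5 := mul_le_mul_of_nonneg_right this hK.le
      rw [pow_succ η C1] at h5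
      linarith) (by
      have := powc hη hη2 6 (c := 64) (n := 3 * C1 + 25) (m := 3 * C1 + 1 + 14) (by norm_num) (by omega)
      have h5 := mul_le_mul_of_nonneg_right this hK.le
      have h6 := mul_le_mul_of_nonneg_left hT1 (show 0 ≤ η ^ (3 * C1 + 1) by positivity)
      rw [← mul_assoc, ← pow_add] at h6
      have e1 : (η ^ C1) ^ 3 * η = η ^ (3 * C1 + 1) := by ring
      rw [e1]
      linarith)
  have hqq : η ^ (C1 + 1) * ((q * q' : ℕ) : ℝ) ≤ 1 := by
    calc η ^ (C1 + 1) * ((q * q' : ℕ) : ℝ) = (η * q) * (η ^ C1 * q') := by push_cast; ring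
      _ ≤ 1 := mul_le_one₀ hηq (by positivity) hεq'
  have hfin := H3 (η ^ b) (by positivity) ((pown hη hη2 (m := 1) (by omega)).trans (by simpa using hη2)) Q K (2 * J) (q * q') f0 f2 h0 h2 κ2 (by positivity)
    (le_trans (by gcongr ?_ * _; exact pown hη hη2 (by omega)) hqq)
    (by
      rw [← pow_mul]; push_cast
      have : η ^ (b * 3) * K ≤ η ^ (3 * C1 + 25 + 1) * K := by gcongr ?_ * _; exact pown hη hη2 (by omega)
      linarith)
    (by
      have := powc hη hη2 4 (c := 16) (n := 2 * C1 + 24) (m := b) (by norm_num) (by omega)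
      calc 8 * (((q * q' : ℕ) : ℝ) * (2 * J : ℕ)) ≤ 8 * (((q * q' : ℕ) : ℝ) * (2 * (η ^ (3 * C1 + 25) * K))) := by push_cast; gcongr
        _ = 16 * η ^ (2 * C1 + 24) * K * (η ^ (C1 + 1) * ((q * q' : ℕ) : ℝ)) := by ring
        _ ≤ η ^ b * K * 1 := by gcongr
        _ = _ := mul_one _)
    (by rw [← pow_mul]; exact bigmono hη hη2 hbig (by omega)) hKQ hQK
    (by
      refine le_trans ?_ hB
      have := powc hη hη2 6 (c := 64) (n := b) (m := 2 * C1 + 1) (by norm_num) (by omega)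
      have e1 : (η ^ C1) ^ 2 * η / 32 = η ^ (2 * C1 + 1) / 32 := by ring
      rw [e1]; push_cast
      calc η ^ b * Q * (2 * J) = (2 * η ^ b) * Q * J := by ring
        _ ≤ η ^ (2 * C1 + 1) / 32 * Q * J := by gcongr; linarith)
  obtain ⟨q3, R3, a1, a2, a3, a4, a5, a6⟩ := hfin
  rw [← pow_mul] at a3 a4 a6
  have hle : η ^ (b * C3 + 3 * C1 + 30) ≤ η ^ (b * C3) := pown hη hη2 (by omega)
  exact ⟨q3, R3, a1, a2, le_trans (by gcongr) a3, le_trans (by gcongr) a4, a5, le_trans (by gcongr) a6⟩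

section
structure Hyp (δ : ℝ) (Q K C : ℕ) : Prop where
  pos : 0 < δ
  le : δ ≤ 1 / 2
  big : 1 ≤ δ ^ C * K
  lo : §K ^ 2 ≤ Q
  hi : §Q ≤ 16 * K ^ 2

lemma Hyp.mono {δ : ℝ} {Q K C C' : ℕ} (h : Hyp δ Q K C) (hC : C' ≤ C) : Hyp δ Q K C' :=
  ⟨h.pos, h.le, bigmono h.pos h.le h.big hC, h.lo, h.hi⟩

lemma Hyp.pow {δ : ℝ} {Q K C : ℕ} (a : ℕ) {C' : ℕ} (h : Hyp δ Q K C) (ha : 1 ≤ a) (hC : a * C' ≤ C) : Hyp (δ ^ a) Q K C' := by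
  have hp := h.pos
  have hl := h.le
  refine ⟨by positivity, (pown hp hl (m := 1) ha).trans (by simpa using hl), ?_, h.lo, h.hi⟩
  rw [← pow_mul]; exact bigmono hp hl h.big hC

section
variable {Q : ℕ} [NeZero Q]

lemma LB.mono {f : ZMod Q → ℂ} {K : ℕ} {δ δ' : ℝ} (h : LB f K δ) (hd : δ' ≤ δ) : LB f K δ' := by
  obtain ⟨q, R, h1, h2, h3, h4, h5, h6⟩ := h
  exact ⟨q, R, h1, h2, le_trans (by gcongr) h3, le_trans (by gcongr) h4, h5, le_trans (by gcongr) h6⟩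

lemma LB.conj {f : ZMod Q → ℂ} {K : ℕ} {δ : ℝ} (h : LB (fun x => conj (f x)) K δ) : LB f K δ := by
  obtain ⟨q, R, h1, h2, h3, h4, h5, h6⟩ := h
  refine ⟨q, R, h1, h2, h3, h4, h5, h6.trans (le_of_eq ?_)⟩
  refine sc fun x _ => ?_
  rw [← map_sum, RCLike.norm_conj]

def Co (φ : ZMod Q → ℂ) (K : ℕ) (δ : ℝ) : Prop :=
  (Bd φ) ∧ ∃ q : ℕ, 0 < q ∧ δ * q ≤ 1 ∧ ∀ (x : ZMod Q) (j : ℕ), δ * K * ‖φ (x + ¶q * ¶j) - φ x‖ ≤ 2 * j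

lemma Co.mono {f : ZMod Q → ℂ} {K : ℕ} {δ δ' : ℝ} (h : Co f K δ) (hd : δ' ≤ δ) : Co f K δ' := by
  obtain ⟨h1, q, h2, h3, h4⟩ := h
  exact ⟨h1, q, h2, le_trans (by gcongr) h3, fun x j => le_trans (by gcongr) (h4 x j)⟩

lemma transfer {D : ZMod Q → ℂ} {K : ℕ} {δ : ℝ} (h : LB D K δ) : ∃ φ, Co φ K δ ∧ δ * Q ≤ ‖∑ w, φ w * D w‖ := by
  obtain ⟨q, R, h1, h2, h3, h4, h5, h6⟩ := h
  have hR : 0 < §R := mod_cast h2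
  have hR' : (R : ℂ) ≠ 0 := mod_cast h2.ne'
  let γ : ZMod Q → ℂ := fun x => ph (∑ r ∈ range R, D (x + ¶q * ¶r))
  have hγ : Bd γ := fun x => (ph_norm _).le
  let S : ZMod Q → ℂ := fun x => ∑ r ∈ range R, γ (x - ¶q * ¶r)
  refine ⟨fun x => S x / R, ⟨fun x => ?_, q, h1, h3, fun x j => ?_⟩, ?_⟩
  · rw [norm_div, Complex.norm_natCast]
    refine div_le_one_of_le₀ ?_ hR.le
    simpa using norm_sum_le_card (range R) (fun r : ℕ => γ (x - (q : ZMod Q) * (r : ZMod Q))) 1 (fun r _ => hγ _)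
  · rw [← sub_div, norm_div, Complex.norm_natCast]
    have h7 := shift_bd (fun r : ℤ => γ (x - (q : ZMod Q) * (r : ZMod Q))) (fun r => hγ _) R (-(j : ℤ))
    have e1 : ∑ r ∈ range R, γ (x - ¶q * (((r : ℤ) + -(j : ℤ) : ℤ) : ZMod Q)) = S (x + ¶q * ¶j) := by
      refine sc fun r _ => ?_
      congr 1; push_cast; ring
    have e2 : ∑ r ∈ range R, γ (x - ¶q * ((r : ℤ) : ZMod Q)) = S x := by
      refine sc fun r _ => ?_
      congr 1; push_cast; ring
    rw [e1, e2] at h7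
    have e3 : |((-(j : ℤ) : ℤ) : ℝ)| = j := by push_cast; rw [abs_neg, Nat.abs_cast]
    rw [e3] at h7
    calc δ * K * (‖S (x + ¶q * ¶j) - S x‖ / R) ≤ R * (2 * j / R) := by gcongr
      _ = 2 * j := by field_simp
  · have e1 : (R : ℂ) * ∑ w, S w / R * D w = ∑ x, ph (∑ r ∈ range R, D (x + ¶q * ¶r)) * ∑ r ∈ range R, D (x + ¶q * ¶r) := by
      have : ∀ w, (R : ℂ) * (S w / R * D w) = ∑ r ∈ range R, γ (w - ¶q * ¶r) * D w := fun w => by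
        rw [← sum_mul]; field_simp; exact mul_comm _ _
      rw [mul_sum]
      simp_rw [this, mul_sum]
      rw [sum_comm, sum_comm (s := univ)]
      refine sc fun r _ => ?_
      rw [← sum_translate (E := ℂ) (¶q * ¶r)]
      simp only [add_sub_cancel_right, γ]
    have e2 := sum_norm_eq univ (fun x => ∑ r ∈ range R, D (x + ¶q * ¶r))
    rw [← e1, norm_mul, Complex.norm_natCast] at e2
    rw [← e2] at h6
    exact le_of_mul_le_mul_left (le_trans (le_of_eq (by ring)) h6) hR

lemma dualg (f g : ZMod Q → ℂ) (hf : Bd f) (hg : Bd g) (K : ℕ) (hK : 0 < K) (a b c : ℕ → ZMod Q) :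
    ∃ D : ZMod Q → ℂ, (Bd D) ∧ ∀ h : ZMod Q → ℂ, ∑ x, ∑ y ∈ range K, h (x + a y) * f (x + b y) * g (x + c y) = K * ∑ w, h w * D w := by
  have hK' : (K : ℂ) ≠ 0 := mod_cast hK.ne'
  refine ⟨fun w => (∑ y ∈ range K, f (w - a y + b y) * g (w - a y + c y)) / K, fun w => ?_, fun h => ?_⟩
  · rw [norm_div, Complex.norm_natCast]
    refine div_le_one_of_le₀ ?_ (Nat.cast_nonneg _)
    simpa using norm_sum_le_card (range K) (fun y : ℕ => f (w - a y + b y) * g (w - a y + c y)) 1 (fun y _ => bmul (hf _) (hg _))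
  · have h1 : ∀ w, (K : ℂ) * (h w * ((∑ y ∈ range K, f (w - a y + b y) * g (w - a y + c y)) / K)) = ∑ y ∈ range K, h w * (f (w - a y + b y) * g (w - a y + c y)) := by
      intro w; rw [← mul_sum]; field_simp
    rw [mul_sum]
    simp_rw [h1]
    rw [sum_comm, sum_comm (s := univ)]
    refine sc fun y _ => ?_
    conv_rhs => rw [← sum_translate (E := ℂ) (a y)]
    refine sc fun x _ => ?_
    rw [add_sub_cancel_right]; ring

lemma lam2 (f0 f1 f2 : ZMod Q → ℂ) (K : ℕ) : lam f0 f1 f2 K = ∑ x, ∑ y ∈ range K, f2 (x + ¶y ^ 2) * f0 (x + 0) * f1 (x + ¶y) := by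
  unfold lam; refine sc fun x _ => sc fun y _ => ?_
  rw [add_zero]; ring

lemma lam0 (f0 f1 f2 : ZMod Q → ℂ) (K : ℕ) : lam f0 f1 f2 K = ∑ x, ∑ y ∈ range K, f0 (x + 0) * f1 (x + ¶y) * f2 (x + ¶y ^ 2) := by
  unfold lam; refine sc fun x _ => sc fun y _ => ?_
  rw [add_zero]

lemma lam1 (f0 f1 f2 : ZMod Q → ℂ) (K : ℕ) : lam f0 f1 f2 K = ∑ x, ∑ y ∈ range K, f1 (x + ¶y) * f0 (x + 0) * f2 (x + ¶y ^ 2) := by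
  unfold lam; refine sc fun x _ => sc fun y _ => ?_
  rw [add_zero]; ring

lemma up (L : (ZMod Q → ℂ) → ℂ) (K : ℕ) (hK : 0 < K) (hL : ∃ D : ZMod Q → ℂ, (∀ x, ‖D x‖ ≤ 1) ∧ ∀ h : ZMod Q → ℂ, L h = K * ∑ w, h w * D w) (δ ε : ℝ) (hδ : 0 ≤ δ)
    (ctrl : ∀ g : ZMod Q → ℂ, (Bd g) → δ ^ 2 * Q * K ≤ ‖L g‖ → LB g K ε)
    (f : ZMod Q → ℂ) (hf : Bd f) (h : δ * Q * K ≤ ‖L f‖) : ∃ φ, Co φ K ε ∧ ε * Q * K ≤ ‖L φ‖ := by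
  obtain ⟨D, hD, hLD⟩ := hL
  have hKr : 0 < §K := mod_cast hK
  rw [hLD, norm_mul, Complex.norm_natCast] at h
  have hs := selfdual D f hf δ hδ (le_of_mul_le_mul_left (le_trans (le_of_eq (by ring)) h) hKr)
  have h1 := ctrl (fun w => conj (D w)) (fun w => bconj (hD w)) (by
    rw [hLD, norm_mul, Complex.norm_natCast]
    exact le_trans (le_of_eq (by ring)) (mul_le_mul_of_nonneg_left hs hKr.le))
  obtain ⟨φ, hφ, h2⟩ := transfer h1.conj
  refine ⟨φ, hφ, ?_⟩
  rw [hLD, norm_mul, Complex.norm_natCast]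
  exact le_trans (le_of_eq (by ring)) (mul_le_mul_of_nonneg_left h2 hKr.le)

end
end

section
section
variable {Q : ℕ} [NeZero Q]

set_option maxHeartbeats 1000000 in
lemma C2 {δ : ℝ} {K : ℕ} (hyp : Hyp δ Q K 60) (f0 f1 f2 : ZMod Q → ℂ) (h0 : Bd f0) (h1 : Co f1 K δ) (h2 : Bd f2)
    (h : δ * Q * K ≤ ‖lam f0 f1 f2 K‖) : LB f2 K (δ ^ 60) := by
  obtain ⟨hδ, hδ2, hbig, hKQ, hQK⟩ := hyp
  have hK := Kpos hbig
  have hK0 : 0 < K := mod_cast hK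
  have hQ : 0 < §Q := Qpos
  obtain ⟨h1b, q, hq, hδq, hlip⟩ := h1
  obtain ⟨J, hJ, hJ1, hJ2⟩ := exR hδ hδ2 24 K (bigmono hδ hδ2 hbig (by omega))
  have hJr : 0 < §J := mod_cast hJ
  obtain ⟨H, hH1, hH2⟩ := exH (δ ^ 2) (by positivity) ((pown hδ hδ2 (m := 1) (by norm_num)).trans (by simpa using hδ2))
  rw [← pow_mul] at hH1 hH2
  norm_num at hH1 hH2
  let G : ZMod Q → ℤ → ℂ := fun x y => f1 (x + (y : ZMod Q)) * f2 (x + (y : ZMod Q) ^ 2)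
  have hG : ∀ x y, ‖G x y‖ ≤ 1 := fun x y => bmul (h1b _) (h2 _)
  obtain ⟨y0, hy0, h3⟩ := subwin univ G hG K q J hK0 δ (by
      have := powc hδ hδ2 2 (c := 4) (n := 23) (m := 1) (by norm_num) (by omega)
      calc 4 * (§q * J) ≤ 4 * (q * (δ ^ 24 * K)) := by gcongr
        _ = 4 * δ ^ 23 * K * (δ * q) := by ring
        _ ≤ δ ^ 1 * K * 1 := by gcongr
        _ = _ := by ring) (by
      rw [cardZ]; refine h.trans ?_
      unfold lam
      refine norm_sum_le_of_le _ fun x _ => ?_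
      have : ∑ y ∈ range K, f0 x * f1 (x + (y : ZMod Q)) * f2 (x + (y : ZMod Q) ^ 2) = f0 x * ∑ y ∈ range K, G x y := by
        rw [mul_sum]; refine sc fun y _ => ?_
        simp only [G, Int.cast_natCast]; ring
      rw [this, norm_mul]
      exact mul_le_of_le_one_left (norm_nonneg _) (h0 x))
  rw [cardZ] at h3
  let P : ZMod Q → ℤ → ℂ := fun x j => f2 (x + ((y0 : ZMod Q) + (q : ZMod Q) * (j : ZMod Q)) ^ 2)
  have h4 : ∀ x : ZMod Q, ‖∑ j ∈ range J, G x (y0 + (q * j : ℕ))‖ ≤ ‖∑ j ∈ range J, P x j‖ + J * (δ / 4) := by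
    intro x
    have e1 : ∑ j ∈ range J, G x (y0 + (q * j : ℕ)) = f1 (x + (y0 : ZMod Q)) * ∑ j ∈ range J, P x j +
        ∑ j ∈ range J, (f1 (x + (y0 : ZMod Q) + (q : ZMod Q) * (j : ZMod Q)) - f1 (x + (y0 : ZMod Q))) * P x j := by
      rw [mul_sum, ← sum_add_distrib]
      refine sc fun j _ => ?_
      have hh : ∀ {a b a' b' : ZMod Q} (z : ℂ), a = a' → b = b' → f1 a * f2 b = z * f2 b' + (f1 a' - z) * f2 b' := by
        rintro a b _ _ z rfl rfl; ring
      refine hh _ ?_ ?_ <;> push_cast <;> ring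
    rw [e1]
    refine (norm_add_le _ _).trans (add_le_add ?_ ?_)
    · rw [norm_mul]; exact mul_le_of_le_one_left (norm_nonneg _) (h1b _)
    · refine (norm_sum_le_card _ _ (δ / 4) fun j hj => ?_).trans (by rw [card_range])
      rw [norm_mul]
      refine (mul_le_of_le_one_right (norm_nonneg _) (h2 _)).trans ?_
      have h5 := hlip (x + (y0 : ZMod Q)) j
      have hj' : §j ≤ J := mod_cast (mem_range.mp hj).le
      have := powc hδ hδ2 3 (c := 8) (n := 24) (m := 2) (by norm_num) (by omega)
      refine le_of_mul_le_mul_left (h5.trans ?_) (show 0 < δ * K by positivity)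
      have h6 := mul_le_mul_of_nonneg_right this hK.le
      have e3 : δ * K * (δ / 4) = δ ^ 2 * K / 4 := by ring
      rw [e3]; linarith
  have h5 : δ ^ 3 * Q * J ≤ ∑ x : ZMod Q, ‖∑ j ∈ range J, P x j‖ := by
    have h6 := h3.trans (sum_le_sum fun x _ => h4 x)
    rw [sum_add_distrib, sum_const, nsmul_eq_mul, cardZ] at h6
    have := powc hδ hδ2 2 (c := 4) (n := 3) (m := 1) (by norm_num) (by omega)
    have h7 : δ ^ 3 * (Q * J) ≤ δ ^ 1 / 4 * (Q * J) := by gcongr; linarith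
    rw [pow_one] at h7
    linarith
  obtain ⟨i, l, hi, hl1, hl2, hv⟩ := vdc univ P (fun x j => h2 _) (δ ^ 3) (by positivity) (pow_le_one₀ hδ.le (by linarith)) J 1 H
    (by
      have := powc hδ hδ2 3 (c := 8) (n := 60) (m := 46) (by norm_num) (by omega)
      rw [Nat.cast_one, one_mul]
      calc 8 * §H ≤ 8 * H * (δ ^ 60 * K) := le_mul_of_one_le_right (by positivity) hbig
        _ = (8 * δ ^ 60) * H * K := by ring
        _ ≤ δ ^ 46 * H * K := by gcongr
        _ = (δ ^ 3) * (δ ^ 25 * K) * (δ ^ 18 * H) := by ring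
        _ ≤ δ ^ 3 * J * 1 := by gcongr
        _ = _ := mul_one _)
    (by rw [← pow_mul]; exact le_trans hH1 (by gcongr ?_ * _; exact pown hδ hδ2 (by norm_num))) (by rw [cardZ]; exact h5)
  have hlr : (l : ℝ) ≤ H := mod_cast hl2.le
  have hδl : δ ^ 18 * l ≤ 1 := le_trans (by gcongr) hH2
  have hqq : δ ^ 21 * §(2 * q ^ 2 * l) ≤ 1 := by
    push_cast
    calc δ ^ 21 * (2 * §q ^ 2 * l) = (2 * δ) * (δ * q) ^ 2 * (δ ^ 18 * l) := by ring
      _ ≤ 1 * 1 ^ 2 * 1 := by gcongr; linarith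
      _ = 1 := by norm_num
  refine ⟨2 * q ^ 2 * l, J, by positivity, hJ, ?_, ?_, ?_, ?_⟩
  · exact le_trans (by gcongr ?_ * _; exact pown hδ hδ2 (by omega)) hqq
  · exact le_trans (by gcongr ?_ * _; exact pown hδ hδ2 (by omega)) hJ1
  · calc §(2 * q ^ 2 * l) * J ≤ §(2 * q ^ 2 * l) * (δ ^ 24 * K) := by gcongr
      _ = δ ^ 3 * K * (δ ^ 21 * §(2 * q ^ 2 * l)) := by ring
      _ ≤ 1 * K * 1 := by gcongr; exact pow_le_one₀ hδ.le (by linarith)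
      _ = K := by ring
  rw [cardZ] at hv
  have h8 : δ ^ 60 ≤ (δ ^ 3) ^ 2 / 2 := by
    have := powc hδ hδ2 1 (c := 2) (n := 60) (m := 6) (by norm_num) (by omega)
    rw [← pow_mul]; linarith
  have h9 : δ ^ 60 * Q * J ≤ (δ ^ 3) ^ 2 / 2 * Q * J := by gcongr
  refine h9.trans (hv.trans ?_)
  let c : ZMod Q := (q : ZMod Q) * l * (2 * y0 + 2 * q * i + q * l)
  have e1 : ∑ x : ZMod Q, ∑ r ∈ range J, P x (r + (1 * i : ℕ)) * conj (P x (r + (1 * i : ℕ) + (1 * l : ℕ))) =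
      ∑ x : ZMod Q, f2 x * conj (∑ r ∈ range J, f2 (x + c + ¶(2 * q ^ 2 * l) * ¶r)) := by
    simp_rw [map_sum, mul_sum]
    rw [sum_comm, sum_comm (s := univ)]
    refine sc fun r _ => ?_
    conv_rhs => rw [← sum_translate (E := ℂ) (((y0 : ZMod Q) + ¶q * (¶r + ¶i)) ^ 2)]
    refine sc fun x _ => ?_
    have hh : ∀ {a b a' b' : ZMod Q}, a = a' → b = b' → f2 a * conj (f2 b) = f2 a' * conj (f2 b') := by
      rintro a b _ _ rfl rfl; rfl
    simp only [P]
    refine hh ?_ ?_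
    · push_cast; ring
    · simp only [c]; push_cast; ring
  rw [e1]
  conv_rhs => rw [← sum_translate (E := ℝ) c]
  refine norm_sum_le_of_le _ fun x _ => ?_
  rw [norm_mul, RCLike.norm_conj]
  exact mul_le_of_le_one_left (norm_nonneg _) (h2 x)

set_option maxHeartbeats 1000000 in
lemma CS {δ : ℝ} {K : ℕ} (hyp : Hyp δ Q K 20) (f u v : ZMod Q → ℂ) (hf : Bd f) (hu : Co u K δ) (hv : Co v K δ) (a b c : ℕ → ZMod Q)
    (h : δ * Q * K ≤ ‖∑ x, ∑ y ∈ range K, f (x + a y) * u (x + b y) * v (x + c y)‖) : LB f K (δ ^ 20) := by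
  obtain ⟨hδ, hδ2, hbig, hKQ, hQK⟩ := hyp
  have hK := Kpos hbig
  have hQ : 0 < §Q := Qpos
  obtain ⟨hub, q1, hq1, hδq1, hl1⟩ := hu
  obtain ⟨hvb, q2, hq2, hδq2, hl2⟩ := hv
  obtain ⟨R, hR, hR1, hR2⟩ := exR hδ hδ2 8 K (bigmono hδ hδ2 hbig (by omega))
  have hRr : 0 < §R := mod_cast hR
  have hqq : δ ^ 2 * §(q1 * q2) ≤ 1 := by
    push_cast
    calc δ ^ 2 * ((q1 : ℝ) * q2) = (δ * q1) * (δ * q2) := by ring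
      _ ≤ 1 := mul_le_one₀ hδq1 (by positivity) hδq2
  refine ⟨q1 * q2, R, by positivity, hR, ?_, ?_, ?_, ?_⟩
  · exact le_trans (by gcongr ?_ * _; exact pown hδ hδ2 (by omega)) hqq
  · exact le_trans (by gcongr ?_ * _; exact pown hδ hδ2 (by omega)) hR1
  · calc §(q1 * q2) * R ≤ §(q1 * q2) * (δ ^ 8 * K) := by gcongr
      _ = δ ^ 6 * K * (δ ^ 2 * §(q1 * q2)) := by ring
      _ ≤ 1 * K * 1 := by gcongr; exact pow_le_one₀ hδ.le (by linarith)
      _ = K := by ring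
  let S : ZMod Q → ℂ := fun x => ∑ r ∈ range R, f (x + ¶(q1 * q2) * ¶r)
  change δ ^ 20 * Q * R ≤ ∑ x, ‖S x‖
  have hsm : ∀ (u : ZMod Q → ℂ) (q q' : ℕ), δ * q' ≤ 1 → (∀ (x : ZMod Q) (j : ℕ), δ * K * ‖u (x + ¶q * ¶j) - u x‖ ≤ 2 * j) →
      ∀ (x : ZMod Q) (r : ℕ), r < R → ‖u (x + ¶(q * q') * ¶r) - u x‖ ≤ δ / 4 := by
    intro u q q' hq' hl x r hr
    have h5 := hl x (q' * r)
    have e1 : x + ¶q * ¶(q' * r) = x + ¶(q * q') * ¶r := by push_cast; ring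
    rw [e1] at h5
    have hr' : §r ≤ R := mod_cast hr.le
    have := powc hδ hδ2 3 (c := 8) (n := 7) (m := 2) (by norm_num) (by omega)
    refine le_of_mul_le_mul_left (h5.trans ?_) (show 0 < δ * K by positivity)
    push_cast
    calc 2 * (§q' * r) ≤ 2 * (q' * (δ ^ 8 * K)) := by gcongr; linarith
      _ = (8 * δ ^ 7) / 4 * K * (δ * q') := by ring
      _ ≤ δ ^ 2 / 4 * K * 1 := by gcongr
      _ = _ := by ring
  have h3 : ∀ r ∈ range R, ‖(∑ x, ∑ y ∈ range K, f (x + a y) * u (x + b y) * v (x + c y)) -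
      ∑ x, ∑ y ∈ range K, f (x + a y + ¶(q1 * q2) * ¶r) * u (x + b y) * v (x + c y)‖ ≤ Q * (K * (δ / 2)) := by
    intro r hr
    rw [← sum_translate (E := ℂ) (¶(q1 * q2) * ¶r) (fun x => ∑ y ∈ range K, f (x + a y) * u (x + b y) * v (x + c y)), ← sum_sub_distrib]
    have := norm_sum_le_card (univ : Finset (ZMod Q)) (fun x => ∑ y ∈ range K, f (x + ¶(q1 * q2) * ¶r + a y) *
      u (x + ¶(q1 * q2) * ¶r + b y) * v (x + ¶(q1 * q2) * ¶r + c y) -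
        ∑ y ∈ range K, f (x + a y + ¶(q1 * q2) * ¶r) * u (x + b y) * v (x + c y)) (K * (δ / 2)) (fun x _ => by
      rw [← sum_sub_distrib]
      refine (norm_sum_le_card (range K) _ (δ / 2) fun y _ => ?_).trans (by rw [card_range])
      set t := ((q1 * q2 : ℕ) : ZMod Q) * (r : ZMod Q) with ht
      have b1 := hsm u q1 q2 hδq2 hl1 (x + b y) r (mem_range.mp hr)
      have b2 := hsm v q2 q1 hδq1 hl2 (x + c y) r (mem_range.mp hr)
      rw [← ht] at b1
      rw [mul_comm q2 q1, ← ht] at b2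
      rw [add_right_comm x t, add_right_comm x t, add_right_comm x t]
      have e2 : f (x + a y + t) * u (x + b y + t) * v (x + c y + t) - f (x + a y + t) * u (x + b y) * v (x + c y)
        = f (x + a y + t) * (u (x + b y + t) - u (x + b y)) * v (x + c y + t) + f (x + a y + t) * u (x + b y) * (v (x + c y + t) - v (x + c y)) := by ring
      rw [e2]
      refine (norm_add_le _ _).trans ?_
      rw [norm_mul, norm_mul, norm_mul (f (x + a y + t) * u (x + b y))]
      have c1 : ‖f (x + a y + t)‖ * ‖u (x + b y + t) - u (x + b y)‖ * ‖v (x + c y + t)‖ ≤ δ / 4 :=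
        (mul_le_of_le_one_right (by positivity) (hvb _)).trans ((mul_le_of_le_one_left (norm_nonneg _) (hf _)).trans b1)
      have c2 : ‖f (x + a y + t) * u (x + b y)‖ * ‖v (x + c y + t) - v (x + c y)‖ ≤ δ / 4 :=
        (mul_le_of_le_one_left (norm_nonneg _) (bmul (hf _) (hub _))).trans b2
      linarith)
    rwa [cardZ] at this
  have h4 := norm_sum_le_card (range R) _ _ h3
  rw [sum_sub_distrib, sum_const, card_range, nsmul_eq_mul] at h4
  have e3 : ∑ r ∈ range R, ∑ x, ∑ y ∈ range K, f (x + a y + ¶(q1 * q2) * ¶r) * u (x + b y) * v (x + c y)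
      = ∑ y ∈ range K, ∑ x, S (x + a y) * (u (x + b y) * v (x + c y)) := by
    conv_rhs => rw [sum_comm]
    rw [sum_comm]
    refine sc fun x _ => ?_
    rw [sum_comm]
    refine sc fun y _ => ?_
    simp only [S]
    rw [sum_mul]
    refine sc fun r _ => by ring
  rw [e3] at h4
  have h5 : ‖∑ y ∈ range K, ∑ x, S (x + a y) * (u (x + b y) * v (x + c y))‖ ≤ K * ∑ x, ‖S x‖ := by
    refine (norm_sum_le_card (range K) _ (∑ x, ‖S x‖) fun y _ => ?_).trans (by rw [card_range])
    rw [← sum_translate (E := ℝ) (a y)]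
    refine norm_sum_le_of_le _ fun x _ => ?_
    rw [norm_mul]
    exact mul_le_of_le_one_right (norm_nonneg _) (bmul (hub _) (hvb _))
  have h6 := norm_sub_norm_le (R * ∑ x, ∑ y ∈ range K, f (x + a y) * u (x + b y) * v (x + c y)) (∑ y ∈ range K, ∑ x, S (x + a y) * (u (x + b y) * v (x + c y)))
  rw [norm_mul, Complex.norm_natCast] at h6
  have h7 := mul_le_mul_of_nonneg_left h hRr.le
  have h8 : K * (δ / 2 * Q * R) ≤ K * ∑ x, ‖S x‖ := by linarith
  refine le_trans ?_ (le_of_mul_le_mul_left h8 hK)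
  have := powc hδ hδ2 1 (c := 2) (n := 20) (m := 1) (by norm_num) (by omega)
  gcongr
  linarith [pow_one δ]

end
end

def Ctl (i : ℕ) (C : ℕ) : Prop := ∀ (δ : ℝ) (Q : ℕ) [NeZero Q] (K : ℕ) (_ : Hyp δ Q K C)
    (f0 f1 f2 : ZMod Q → ℂ) (_ : Bd f0) (_ : Bd f1) (_ : Bd f2),
    δ * Q * K ≤ ‖lam f0 f1 f2 K‖ → LB (if i = 0 then f0 else if i = 1 then f1 else f2) K (δ ^ C)

lemma PC1 : ∃ C : ℕ, 2 ≤ C ∧ ∀ (δ : ℝ) (Q : ℕ) [NeZero Q] (K : ℕ) (_ : Hyp δ Q K C)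
    (f0 f1 f2 : ZMod Q → ℂ) (_ : Bd f0) (_ : Bd f1) (_ : Bd f2),
    δ * Q * K ≤ ‖lam f0 f1 f2 K‖ → ∃ φ, Co φ K (δ ^ C) ∧ δ ^ C * Q * K ≤ ‖lam f0 φ f2 K‖ := by
  obtain ⟨C, hC, H⟩ := PB
  refine ⟨C, hC, fun δ Q _ K hyp f0 f1 f2 h0 h1 h2 h => ?_⟩
  have hK := Kpos hyp.big
  obtain ⟨φ, hφ, h3⟩ := transfer (H δ hyp.pos hyp.le Q K f0 f1 f2 h0 h1 h2 hyp.big hyp.lo hyp.hi h)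
  refine ⟨φ, hφ, ?_⟩
  rw [lam_Dn f0 φ f2 K (mod_cast hK), norm_mul, Complex.norm_natCast]
  exact le_trans (le_of_eq (by ring)) (mul_le_mul_of_nonneg_left h3 hK.le)

lemma F2 : ∃ C : ℕ, 2 ≤ C ∧ Ctl 2 C := by
  obtain ⟨C, hC, H⟩ := PC1
  refine ⟨C * 60, by omega, fun δ Q _ K hyp f0 f1 f2 h0 h1 h2 h => ?_⟩
  obtain ⟨φ, hφ, h3⟩ := H δ Q K (hyp.mono (by omega)) f0 f1 f2 h0 h1 h2 h
  have := C2 (hyp.pow C (C' := 60) (by omega) le_rfl) f0 φ f2 h0 hφ h2 h3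
  rw [← pow_mul] at this
  exact this

lemma up2 : ∃ C : ℕ, 2 ≤ C ∧ ∀ (δ : ℝ) (Q : ℕ) [NeZero Q] (K : ℕ) (_ : Hyp δ Q K C)
    (f0 f1 f2 : ZMod Q → ℂ) (_ : Bd f0) (_ : Bd f1) (_ : Bd f2),
    δ * Q * K ≤ ‖lam f0 f1 f2 K‖ → ∃ φ, Co φ K (δ ^ C) ∧ δ ^ C * Q * K ≤ ‖lam f0 f1 φ K‖ := by
  obtain ⟨C, hC, H⟩ := F2
  refine ⟨2 * C, by omega, fun δ Q _ K hyp f0 f1 f2 h0 h1 h2 h => ?_⟩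
  have hK : 0 < K := mod_cast Kpos hyp.big
  refine up (fun g => lam f0 f1 g K) K hK ?_ δ _ hyp.pos.le (fun g hg hgl => ?_) f2 h2 h
  · obtain ⟨D, hD, hDD⟩ := dualg f0 f1 h0 h1 K hK (fun y => ¶y ^ 2) (fun _ => 0) (fun y => ¶y)
    exact ⟨D, hD, fun g => by rw [lam2]; exact hDD g⟩
  · have := H (δ ^ 2) Q K (hyp.pow 2 (by omega) le_rfl) f0 f1 g h0 h1 hg hgl
    rw [← pow_mul] at this
    exact this

lemma F0 : ∃ C : ℕ, 2 ≤ C ∧ Ctl 0 C := by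
  obtain ⟨C, hC, H⟩ := PC1
  obtain ⟨C', hC', H'⟩ := up2
  have hCC : C * 1 ≤ C * C' := Nat.mul_le_mul_left _ (by omega)
  refine ⟨C * C' * 20, by omega, fun δ Q _ K hyp f0 f1 f2 h0 h1 h2 h => ?_⟩
  obtain ⟨φ, hφ, h3⟩ := H δ Q K (hyp.mono (by omega)) f0 f1 f2 h0 h1 h2 h
  obtain ⟨ψ, hψ, h4⟩ := H' (δ ^ C) Q K (hyp.pow C (by omega) (by omega)) f0 φ f2 h0 hφ.1 h2 h3
  rw [← pow_mul] at hψ h4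
  rw [lam0] at h4
  have := CS (hyp.pow (C * C') (C' := 20) (by omega) le_rfl) f0 φ ψ h0 (hφ.mono (pown hyp.pos hyp.le (by omega))) hψ (fun _ => 0) (fun y => (y : ZMod Q)) (fun y => (y : ZMod Q) ^ 2) h4
  rw [← pow_mul] at this
  exact this

lemma F1 : ∃ C : ℕ, 2 ≤ C ∧ Ctl 1 C := by
  obtain ⟨C, hC, H⟩ := F0
  obtain ⟨C', hC', H'⟩ := up2
  have hCC : 2 * C * 1 ≤ 2 * C * C' := Nat.mul_le_mul_left _ (by omega)
  refine ⟨2 * C * C' * 20, by omega, fun δ Q _ K hyp f0 f1 f2 h0 h1 h2 h => ?_⟩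
  have hK : 0 < K := by exact_mod_cast Kpos hyp.big
  obtain ⟨φ, hφ, h3⟩ := up (fun g => lam g f1 f2 K) K hK (by
      obtain ⟨D, hD, hDD⟩ := dualg f1 f2 h1 h2 K hK (fun _ => 0) (fun y => (y : ZMod Q)) (fun y => (y : ZMod Q) ^ 2)
      exact ⟨D, hD, fun g => by rw [lam0]; exact hDD g⟩) δ (δ ^ (2 * C)) hyp.pos.le (fun g hg hgl => by
      have := H (δ ^ 2) Q K (hyp.pow 2 (by omega) (by omega)) g f1 f2 hg h1 h2 hgl
      rw [← pow_mul] at this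
      exact this) f0 h0 h
  obtain ⟨ψ, hψ, h4⟩ := H' (δ ^ (2 * C)) Q K (hyp.pow (2 * C) (by omega) (by omega)) φ f1 f2 hφ.1 h1 h2 h3
  rw [← pow_mul] at hψ h4
  rw [lam1] at h4
  have := CS (hyp.pow (2 * C * C') (C' := 20) (by omega) le_rfl) f1 φ ψ h1 (hφ.mono (pown hyp.pos hyp.le (by omega))) hψ (fun y => (y : ZMod Q)) (fun _ => 0) (fun y => (y : ZMod Q) ^ 2) h4
  rw [← pow_mul] at this
  exact this

lemma Ctl.mono {i C C' : ℕ} (h : Ctl i C) (hC : C ≤ C') : Ctl i C' := fun δ Q _ K hyp f0 f1 f2 h0 h1 h2 hl =>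
  (h δ Q K (hyp.mono hC) f0 f1 f2 h0 h1 h2 hl).mono (pown hyp.pos hyp.le hC)

lemma FF : ∃ C : ℕ, 2 ≤ C ∧ Ctl 0 C ∧ Ctl 1 C ∧ Ctl 2 C := by
  obtain ⟨C0, hC0, H0⟩ := F0
  obtain ⟨C1, hC1, H1⟩ := F1
  obtain ⟨C2, hC2, H2⟩ := F2
  exact ⟨C0 + C1 + C2, by omega, H0.mono (by omega), H1.mono (by omega), H2.mono (by omega)⟩

lemma sum_div_range (q R : ℕ) (hq : 0 < q) (g : ℕ → ℂ) : ∑ u ∈ range (q * R), g (u / q) = q * ∑ i ∈ range R, g i := by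
  induction R with
  | zero => simp
  | succ R ih =>
    rw [Nat.mul_succ, sum_range_add, ih, sum_range_succ, mul_add]
    congr 1
    rw [sum_congr rfl (g := fun _ => g R), sum_const, card_range, nsmul_eq_mul]
    intro v hv
    rw [Nat.mul_add_div hq, Nat.div_eq_of_lt (mem_range.mp hv), add_zero]

lemma sum_emod (M : ℕ) (hM : 0 < M) (x : ℤ) (g : ℕ → ℂ) : ∑ r ∈ range M, g ((x - r) % (M : ℤ)).toNat = ∑ u ∈ range M, g u := by
  have hM' : (M : ℤ) ≠ 0 := mod_cast hM.ne'
  have hpos : (0 : ℤ) < M := mod_cast hM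
  have key : ∀ r ∈ range M, ((x - (((x - r) % (M : ℤ)).toNat : ℤ)) % (M : ℤ)).toNat = r := by
    intro r hr
    have hr' : (r : ℤ) < M := mod_cast mem_range.mp hr
    rw [Int.toNat_of_nonneg (Int.emod_nonneg _ hM')]
    have : (x - (x - r) % (M : ℤ)) % (M : ℤ) = r := by
      rw [Int.sub_emod, Int.emod_emod, ← Int.sub_emod, sub_sub_cancel, Int.emod_eq_of_lt (by omega) hr']
    rw [this]; rfl
  have mem : ∀ r ∈ range M, ((x - r) % (M : ℤ)).toNat ∈ range M := fun r _ => by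
    rw [mem_range]
    have := Int.emod_lt_of_pos (x - r) hpos
    have := Int.emod_nonneg (x - r) hM'
    omega
  exact sum_nbij' (fun r => ((x - (r : ℕ)) % (M : ℤ)).toNat) (fun r => ((x - (r : ℕ)) % (M : ℤ)).toNat) mem mem key key (fun _ _ => rfl)

lemma floor_nat (z : ℤ) (M : ℕ) : ⌊(z : ℝ) / §M⌋ = z / (M : ℤ) := by
  have := Rat.floor_intCast_div_natCast z M
  rw [← this, ← Rat.floor_cast (α := ℝ)]; push_cast; rfl

lemma conv1 (f : ℤ → ℂ) (N q R : ℕ) (hq : 0 < q) (hR : 0 < R) (hqR : q * R ≤ N) (hs : ∀ x, f x ≠ 0 → x ∈ Icc (1 : ℤ) (N : ℤ)) (A : ℝ)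
    (h : A * R ≤ ∑ z ∈ Ico (-(N : ℤ)) (3 * N), ‖∑ r ∈ range R, f (z + q * r)‖) :
    ∃ φ : ℤ → ℂ, (Bd φ) ∧ IsLocalFunction φ §(q * R) q ∧ A ≤ ‖∑ x ∈ Icc (1 : ℤ) (N : ℤ), f x * φ x‖ := by
  let W : ℤ → ℂ := fun z => ∑ r ∈ range R, f (z + q * r)
  have hM : 0 < q * R := by positivity
  have hMz : ((q * R : ℕ) : ℤ) ≠ 0 := mod_cast hM.ne'
  let b : ℕ → ℤ → ℤ := fun r0 x => r0 + ((q * R : ℕ) : ℤ) * ((x - r0) / ((q * R : ℕ) : ℤ)) + (x - r0) % (q : ℤ)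
  have hb : ∀ r0 x, b r0 x = x - q * (((x - r0) % ((q * R : ℕ) : ℤ)).toNat / q : ℕ) := by
    intro r0 x
    have h1 := Int.mul_ediv_add_emod (x - r0) ((q * R : ℕ) : ℤ)
    set u := (x - r0) % ((q * R : ℕ) : ℤ) with hu
    have h0 : 0 ≤ u := Int.emod_nonneg _ hMz
    have h2 : u % (q : ℤ) = (x - r0) % (q : ℤ) := Int.emod_emod_of_dvd _ ⟨(R : ℤ), by push_cast; ring⟩
    have h3 := Int.mul_ediv_add_emod u (q : ℤ)
    have h4 : ((u.toNat / q : ℕ) : ℤ) = u / q := by rw [Int.natCast_div, Int.toNat_of_nonneg h0]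
    simp only [b]
    rw [h4, ← h2]; linarith
  have hMr : (0 : ℝ) < §(q * R) := mod_cast hM
  have e1 : ∑ r0 ∈ range (q * R), ∑ x ∈ Icc (1 : ℤ) (N : ℤ), f x * ph (W (b r0 x)) = q * ((∑ z ∈ Ico (-(N : ℤ)) (3 * N), ‖W z‖ : ℝ) : ℂ) := by
    have a1 : ∀ x : ℤ, ∑ r0 ∈ range (q * R), f x * ph (W (b r0 x)) = q * ∑ i ∈ range R, f x * ph (W (x - q * (i : ℕ))) := by
      intro x
      simp only [hb]
      rw [← mul_sum, ← mul_sum, sum_emod (q * R) hM x (fun u => ph (W (x - q * (u / q : ℕ)))), sum_div_range q R hq (fun i => ph (W (x - q * (i : ℕ))))]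
      ring
    rw [sum_comm]
    simp only [a1]
    rw [← mul_sum]
    congr 1
    push_cast
    have a2 : ∀ z, (‖W z‖ : ℂ) = ∑ i ∈ range R, f (z + q * i) * ph (W z) := fun z => by
      rw [← ph_mul, ← sum_mul]; exact mul_comm _ _
    simp only [a2]
    rw [sum_comm, sum_comm (s := Ico (-(N : ℤ)) (3 * N))]
    refine sc fun i hi => ?_
    have hi' : q * i ≤ N := (Nat.mul_le_mul_left q (mem_range.mp hi).le).trans hqR
    have hi2 : (q : ℤ) * i ≤ N := mod_cast hi'
    have hi3 : 0 ≤ (q : ℤ) * i := by positivity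
    refine sum_of_injOn (fun x => x - q * i) (fun x _ y _ hxy => by simpa using hxy) ?_ ?_ ?_
    · intro x hx
      rw [mem_coe, mem_Icc] at hx
      rw [mem_coe, mem_Ico]
      constructor <;> dsimp only <;> linarith
    · intro z _ hz
      by_cases h0 : f (z + q * i) = 0
      · rw [h0, zero_mul]
      · exact absurd ⟨z + q * i, mem_coe.mpr (hs _ h0), by simp⟩ hz
    · intro x _
      rw [sub_add_cancel]
  have h2 : §(q * R) * A ≤ ∑ r0 ∈ range (q * R), ‖∑ x ∈ Icc (1 : ℤ) (N : ℤ), f x * ph (W (b r0 x))‖ := by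
    refine le_trans ?_ (norm_sum_le _ _)
    rw [e1, norm_mul, Complex.norm_natCast, Complex.norm_real, Real.norm_of_nonneg (by positivity)]
    push_cast
    calc §q * R * A = q * (A * R) := by ring
      _ ≤ _ := by gcongr
  obtain ⟨r0, hr0, h3⟩ := pigeonR hM (fun r0 => ‖∑ x ∈ Icc (1 : ℤ) (N : ℤ), f x * ph (W (b r0 x))‖) A h2
  refine ⟨fun x => ph (W (b r0 x)), fun x => (ph_norm _).le, ⟨r0, fun x y hxy hm => ?_⟩, h3⟩
  have c1 : ∀ x : ℤ, (x : ℝ) - r0 = ((x - r0 : ℤ) : ℝ) := fun x => by push_cast; ring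
  rw [c1, c1, floor_nat, floor_nat] at hxy
  have c2 : (x - r0) % (q : ℤ) = (y - r0) % (q : ℤ) := Int.ModEq.sub_right _ hm
  simp only [b, hxy, c2]

lemma sum_Ico_zmod (Q : ℕ) [NeZero Q] (a : ℤ) {E : Type*} [AddCommMonoid E] (F : ZMod Q → E) : ∑ z ∈ Ico a (a + Q), F (z : ZMod Q) = ∑ x, F x := by
  have hQ : (Q : ℤ) ≠ 0 := mod_cast NeZero.ne Q
  have hQp : (0 : ℤ) < Q := by have := Nat.pos_of_ne_zero (NeZero.ne Q); exact_mod_cast this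
  refine sum_nbij (fun z : ℤ => (z : ZMod Q)) (fun _ _ => mem_univ _) ?_ ?_ (fun _ _ => rfl)
  · intro z hz w hw hzw
    rw [mem_coe, mem_Ico] at hz hw
    have := (ZMod.intCast_eq_intCast_iff_dvd_sub z w Q).mp hzw
    have := Int.eq_zero_of_abs_lt_dvd this (by rw [abs_lt]; constructor <;> omega)
    omega
  · intro x _
    refine ⟨a + ((x.val : ℤ) - a) % (Q : ℤ), ?_, ?_⟩
    · rw [mem_coe, mem_Ico]
      have := Int.emod_nonneg ((x.val : ℤ) - a) hQ
      have := Int.emod_lt_of_pos ((x.val : ℤ) - a) hQp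
      constructor <;> omega
    · dsimp only
      push_cast
      rw [ZMod.natCast_zmod_val]; ring

lemma tl (f : ℤ → ℂ) (N : ℕ) [NeZero (4 * N)] (hs : ∀ x, f x ≠ 0 → x ∈ Icc (1 : ℤ) (N : ℤ)) (m : ℤ) (h1 : -(N : ℤ) ≤ m) (h2 : m < 4 * N) :
    f (((m : ZMod (4 * N)).val : ℕ) : ℤ) = f m := by
  have hN : 0 < 4 * N := Nat.pos_of_ne_zero (NeZero.ne _)
  rw [ZMod.val_intCast]
  push_cast
  have z0 : ∀ x : ℤ, ¬ (1 ≤ x ∧ x ≤ N) → f x = 0 := fun x hx => by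
    by_contra h; exact hx (mem_Icc.mp (hs x h))
  rcases le_or_gt 0 m with h | h
  · rw [Int.emod_eq_of_lt h (mod_cast h2)]
  · have : m % (4 * (N : ℤ)) = m + 4 * N := by
      rw [← Int.add_emod_right, Int.emod_eq_of_lt (by omega) (by omega)]
    rw [this, z0 _ (by omega), z0 _ (by omega)]

def til (f : ℤ → ℂ) (N : ℕ) (x : ZMod (4 * N)) : ℂ := f ((x.val : ℕ) : ℤ)

lemma conv2 (f : ℤ → ℂ) (N K : ℕ) [NeZero (4 * N)] (hs : ∀ x, f x ≠ 0 → x ∈ Icc (1 : ℤ) (N : ℤ)) (hK : K ≤ N) (η : ℝ)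
    (h : LB (til f N) K η) : ∃ (φ : ℤ → ℂ) (M : ℝ) (q : ℕ), (Bd φ) ∧ 0 < q ∧ IsLocalFunction φ M q ∧ η * K ≤ M ∧
      η * q ≤ 1 ∧ η * (4 * N) ≤ ‖∑ x ∈ Icc (1 : ℤ) (N : ℤ), f x * φ x‖ := by
  obtain ⟨q, R, hq, hR, h1, h2, h3, h4⟩ := h
  have h3' : q * R ≤ K := mod_cast h3
  have h5 := sum_Ico_zmod (4 * N) (-(N : ℤ)) (fun x => ‖∑ r ∈ range R, til f N (x + (q : ZMod (4 * N)) * (r : ZMod (4 * N)))‖)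
  have h6 : -(N : ℤ) + ((4 * N : ℕ) : ℤ) = 3 * N := by push_cast; ring
  rw [h6] at h5
  rw [← h5] at h4
  obtain ⟨φ, a, b, c⟩ := conv1 f N q R hq hR (h3'.trans hK) hs (η * (4 * N)) (by
    push_cast at h4
    refine h4.trans (le_of_eq ?_)
    refine sc fun z hz => ?_
    congr 1
    refine sc fun r hr => ?_
    have hr' := mem_range.mp hr
    have h7 : q * r ≤ N := (Nat.mul_le_mul_left q hr'.le).trans (h3'.trans hK)
    have h7' : (q : ℤ) * r ≤ N := mod_cast h7
    have h8 : (0 : ℤ) ≤ (q : ℤ) * r := by positivity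
    rw [mem_Ico] at hz
    have h9 : ((z : ZMod (4 * N)) + (q : ZMod (4 * N)) * (r : ZMod (4 * N))) = ((z + q * r : ℤ) : ZMod (4 * N)) := by push_cast; rfl
    rw [h9, til, tl f N hs _ (by linarith) (by linarith)])
  refine ⟨φ, _, q, a, hq, b, ?_, h1, c⟩
  refine h2.trans ?_
  have : R ≤ q * R := Nat.le_mul_of_pos_left _ hq
  exact_mod_cast this

lemma conv3 (f1 f2 f3 : ℤ → ℂ) (N : ℕ) [NeZero (4 * N)] (b1 : Bd f1) (b2 : Bd f2) (b3 : Bd f3)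
    (s1 : ∀ x, f1 x ≠ 0 → x ∈ Icc (1 : ℤ) (N : ℤ)) (s2 : ∀ x, f2 x ≠ 0 → x ∈ Icc (1 : ℤ) (N : ℤ))
    (s3 : ∀ x, f3 x ≠ 0 → x ∈ Icc (1 : ℤ) (N : ℤ)) :
    ‖∑ x ∈ Icc (1 : ℤ) (N : ℤ), ∑ y ∈ Icc (1 : ℤ) (N : ℤ), f1 x * f2 (x + y) * f3 (x + y ^ 2)‖
      ≤ ‖lam (til f1 N) (til f2 N) (til f3 N) (Nat.sqrt N)‖ + 2 * N ∧
    ‖∑ x ∈ Icc (1 : ℤ) (N : ℤ), ∑ y ∈ Icc (1 : ℤ) (N : ℤ), f1 x * f2 (x + y) * f3 (x + y ^ 2)‖ ≤ N * (Nat.sqrt N : ℝ) := by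
  set K := Nat.sqrt N with hKd
  have hK1 : K * K ≤ N := Nat.sqrt_le N
  have hK2 : N < (K + 1) * (K + 1) := Nat.lt_succ_sqrt N
  have hKN : K ≤ N := Nat.sqrt_le_self N
  let G : ℤ → ℤ → ℂ := fun x y => f1 x * f2 (x + y) * f3 (x + y ^ 2)
  have bG : ∀ x y, ‖G x y‖ ≤ 1 := fun x y => by
    simp only [G, norm_mul]
    exact mul_le_one₀ (mul_le_one₀ (b1 _) (norm_nonneg _) (b2 _)) (norm_nonneg _) (b3 _)
  have z3 : ∀ x : ℤ, ¬ (1 ≤ x ∧ x ≤ N) → f3 x = 0 := fun x hx => by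
    by_contra h; exact hx (mem_Icc.mp (s3 x h))
  have inner : ∀ x ∈ Icc (1 : ℤ) (N : ℤ), ∑ y ∈ Icc (1 : ℤ) (N : ℤ), G x y = ∑ j ∈ range K, G x (j + 1) := by
    intro x hx
    rw [mem_Icc] at hx
    have e1 : ∑ y ∈ Icc (1 : ℤ) (N : ℤ), G x y = ∑ j ∈ range N, G x (j + 1) := by
      refine (sum_nbij' (fun j : ℕ => (j : ℤ) + 1) (fun y : ℤ => (y - 1).toNat) ?_ ?_ ?_ ?_ ?_).symm
      · intro j hj
        have := mem_range.mp hj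
        rw [mem_Icc]; constructor <;> omega
      · intro y hy
        rw [mem_Icc] at hy
        rw [mem_range]; omega
      · intro j hj; simp
      · intro y hy
        rw [mem_Icc] at hy
        omega
      · intro j hj; rfl
    rw [e1]
    refine (sum_subset (range_mono hKN) ?_).symm
    intro j _ hj
    rw [mem_range, not_lt] at hj
    have : f3 (x + ((j : ℤ) + 1) ^ 2) = 0 := by
      apply z3
      have h1 : ((K + 1) * (K + 1) : ℤ) ≤ ((j : ℤ) + 1) ^ 2 := by
        have : (K : ℤ) ≤ j := mod_cast hj
        nlinarith
      have h2 : (N : ℤ) < (K + 1) * (K + 1) := mod_cast hK2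
      intro h; linarith [h.2, hx.1]
    simp only [G, this, mul_zero]
  have hS : ∑ x ∈ Icc (1 : ℤ) (N : ℤ), ∑ y ∈ Icc (1 : ℤ) (N : ℤ), f1 x * f2 (x + y) * f3 (x + y ^ 2)
      = ∑ x ∈ Icc (1 : ℤ) (N : ℤ), ∑ j ∈ range K, G x (j + 1) := sum_congr rfl inner
  have hL : lam (til f1 N) (til f2 N) (til f3 N) K = ∑ x ∈ Icc (1 : ℤ) (N : ℤ), ∑ j ∈ range K, G x j := by
    unfold lam
    rw [← sum_Ico_zmod (4 * N) (-(N : ℤ))]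
    have h6 : -(N : ℤ) + ((4 * N : ℕ) : ℤ) = 3 * N := by push_cast; ring
    rw [h6]
    have e2 : ∑ x ∈ Icc (1 : ℤ) (N : ℤ), ∑ j ∈ range K, G x j = ∑ x ∈ Ico (-(N : ℤ)) (3 * N), ∑ j ∈ range K, G x j := by
      refine sum_subset ?_ ?_
      · intro x hx
        rw [mem_Icc] at hx
        rw [mem_Ico]; constructor <;> omega
      · intro x _ hx
        have : f1 x = 0 := by by_contra h; exact hx (s1 x h)
        simp only [G, this, zero_mul, sum_const_zero]
    rw [e2]
    refine sc fun z hz => sc fun j hj => ?_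
    rw [mem_Ico] at hz
    have hj' := mem_range.mp hj
    have h1 : j ≤ N := hj'.le.trans hKN
    have h1' : (j : ℤ) ≤ N := mod_cast h1
    have h2 : j * j ≤ N := (Nat.mul_le_mul hj'.le hj'.le).trans hK1
    have h2' : (j : ℤ) ^ 2 ≤ N := by rw [sq]; exact_mod_cast h2
    have h3 : (0 : ℤ) ≤ (j : ℤ) ^ 2 := by positivity
    have g1 : ((z : ZMod (4 * N)) + (j : ZMod (4 * N))) = ((z + j : ℤ) : ZMod (4 * N)) := by push_cast; rfl
    have g2 : ((z : ZMod (4 * N)) + (j : ZMod (4 * N)) ^ 2) = ((z + j ^ 2 : ℤ) : ZMod (4 * N)) := by push_cast; rfl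
    rw [g1, g2]
    simp only [til, G]
    rw [tl f1 N s1 _ (by linarith) (by linarith), tl f2 N s2 _ (by linarith) (by linarith), tl f3 N s3 _ (by linarith) (by linarith)]
  have card : (#(Icc (1 : ℤ) (N : ℤ)) : ℝ) = N := by simp
  rw [hS, hL]
  constructor
  · have : ‖∑ x ∈ Icc (1 : ℤ) (N : ℤ), (∑ j ∈ range K, G x (j + 1) - ∑ j ∈ range K, G x j)‖ ≤ #(Icc (1 : ℤ) (N : ℤ)) * (2 : ℝ) := by
      refine norm_sum_le_card _ _ _ fun x _ => ?_
      have := shift_bd (G x) (bG x) K 1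
      simpa using this
    rw [sum_sub_distrib, card] at this
    have h2 := norm_sub_norm_le (∑ x ∈ Icc (1 : ℤ) (N : ℤ), ∑ j ∈ range K, G x (j + 1)) (∑ x ∈ Icc (1 : ℤ) (N : ℤ), ∑ j ∈ range K, G x j)
    linarith
  · have : ‖∑ x ∈ Icc (1 : ℤ) (N : ℤ), ∑ j ∈ range K, G x (j + 1)‖ ≤ #(Icc (1 : ℤ) (N : ℤ)) * §K := by
      refine norm_sum_le_card _ _ _ fun x _ => ?_
      have := norm_sum_le_card (range K) (fun j => G x (j + 1)) 1 fun j _ => bG x _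
      simpa using this
    rwa [card] at this

end NLR

/-- **Local control of all terms.**  Since `f₁`, `f₂`, `f₃` are supported in
`[N] = {1, …, N}`, the double sum `∑_{x ∈ ℤ} ∑_{y ∈ ℕ} f₁(x) f₂(x+y) f₃(x+y²)` equals the
finite sum over `x ∈ [N]`, `y ∈ [N]` below. -/
theorem local_control_of_all_terms :
    ∃ C c : ℝ, 0 < C ∧ 0 < c ∧
      ∀ (N : ℕ) (δ : ℝ) (f₁ f₂ f₃ : ℤ → ℂ), 0 < δ →
        (∀ x, ‖f₁ x‖ ≤ 1) → (∀ x, ‖f₂ x‖ ≤ 1) → (∀ x, ‖f₃ x‖ ≤ 1) →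
        (∀ x, f₁ x ≠ 0 → x ∈ Finset.Icc (1 : ℤ) (N : ℤ)) →
        (∀ x, f₂ x ≠ 0 → x ∈ Finset.Icc (1 : ℤ) (N : ℤ)) →
        (∀ x, f₃ x ≠ 0 → x ∈ Finset.Icc (1 : ℤ) (N : ℤ)) →
        δ * (N : ℝ) ^ ((3 : ℝ) / 2) ≤
          ‖∑ x ∈ Finset.Icc (1 : ℤ) (N : ℤ), ∑ y ∈ Finset.Icc (1 : ℤ) (N : ℤ),
              f₁ x * f₂ (x + y) * f₃ (x + y ^ 2)‖ →
        ((N : ℝ) ≤ C * δ ^ (-C) ∨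
          ∀ f : ℤ → ℂ, (f = f₁ ∨ f = f₂ ∨ f = f₃) →
            ∃ (φ : ℤ → ℂ) (M : ℝ) (q : ℕ), (∀ x, ‖φ x‖ ≤ 1) ∧ 0 < q ∧
              IsLocalFunction φ M q ∧
              c * δ ^ C * Real.sqrt N ≤ M ∧ (q : ℝ) ≤ C * δ ^ (-C) ∧
              c * δ ^ C * N ≤ ‖∑ x ∈ Finset.Icc (1 : ℤ) (N : ℤ), f x * φ x‖) := by
  obtain ⟨C0, hC0, k0, k1, k2⟩ := NLR.FF
  have hB : (C0 : ℝ) ≤ 16 ^ C0 := by exact_mod_cast (Nat.lt_pow_self (by norm_num : 1 < 16)).le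
  have hB1 : (1 : ℝ) ≤ 16 ^ C0 := one_le_pow₀ (by norm_num)
  generalize hBd : (16 : ℝ) ^ C0 = B at hB hB1
  have hCB : 4 * B ≤ 4 * B ^ 2 := by nlinarith
  generalize hCd : 4 * B ^ 2 = C at hCB
  have hCpos : 0 < C := by linarith
  refine ⟨C, 1 / (2 * B), hCpos, by positivity, ?_⟩
  intro N δ f₁ f₂ f₃ hδ b1 b2 b3 s1 s2 s3 hS
  have hrneg : δ ^ (-C) = (δ ^ C)⁻¹ := Real.rpow_neg hδ.le C
  have hrpos : 0 < δ ^ C := Real.rpow_pos_of_pos hδ C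
  rcases Nat.eq_zero_or_pos N with hN | hN
  · left; subst hN
    rw [hrneg]
    simp only [Nat.cast_zero]
    positivity
  haveI : NeZero (4 * N) := ⟨by omega⟩
  obtain ⟨c1, c2⟩ := NLR.conv3 f₁ f₂ f₃ N b1 b2 b3 s1 s2 s3
  have hKp : 0 < Nat.sqrt N := Nat.sqrt_pos.mpr hN
  have hK1 : Nat.sqrt N * Nat.sqrt N ≤ N := Nat.sqrt_le N
  have hK2 : N < (Nat.sqrt N + 1) * (Nat.sqrt N + 1) := Nat.lt_succ_sqrt N
  have hKN : Nat.sqrt N ≤ N := Nat.sqrt_le_self N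
  generalize hKd : Nat.sqrt N = K at c1 c2 hKp hK1 hK2 hKN
  have hNr : (0 : ℝ) < N := by exact_mod_cast hN
  have hKr : (1 : ℝ) ≤ K := by exact_mod_cast hKp
  have hK1r : (K : ℝ) * K ≤ N := by exact_mod_cast hK1
  have hK2r : (N : ℝ) ≤ (K + 1) * (K + 1) := by exact_mod_cast hK2.le
  have hK3 : (N : ℝ) ≤ 4 * (K : ℝ) ^ 2 := by nlinarith
  have hs0 : (K : ℝ) ≤ Real.sqrt N := Real.le_sqrt_of_sq_le (by rw [sq]; exact hK1r)
  have hs1 : Real.sqrt N ≤ 2 * K := Real.sqrt_le_iff.mpr ⟨by positivity, by nlinarith⟩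
  have h32 : (N : ℝ) ^ ((3 : ℝ) / 2) = N * Real.sqrt N := by
    rw [show (3 : ℝ) / 2 = 1 + 1 / 2 by norm_num, Real.rpow_add hNr, Real.rpow_one, Real.sqrt_eq_rpow]
  rw [h32] at hS
  have hδ1 : δ ≤ 1 := by
    have h1 : δ * (N * Real.sqrt N) ≤ 1 * (N * Real.sqrt N) := by
      rw [one_mul]; exact hS.trans (c2.trans (by gcongr))
    exact le_of_mul_le_mul_right h1 (mul_pos hNr (by linarith))
  have hp : ∀ n : ℕ, (n : ℝ) ≤ C → δ ^ C ≤ δ ^ n := fun n hn => by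
    rw [← Real.rpow_natCast]
    exact Real.rpow_le_rpow_of_exponent_ge hδ hδ1 hn
  have hpC0 : δ ^ C ≤ δ ^ C0 := hp C0 (by linarith)
  have hη : (δ / 16) ^ C0 = δ ^ C0 / B := by rw [div_pow, hBd]
  have hBp : 0 < B := by linarith
  by_cases hbig : 1 ≤ (δ / 16) ^ C0 * K
  · right
    have hδK : 16 ≤ δ * K := by
      have h1 : (δ / 16) ^ C0 ≤ (δ / 16) ^ 1 := pow_le_pow_of_le_one (by positivity) (by linarith) (by omega)
      rw [pow_one] at h1
      have : (δ / 16) ^ C0 * K ≤ δ / 16 * K := by gcongr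
      linarith
    have hyp : NLR.Hyp (δ / 16) (4 * N) K C0 := ⟨by positivity, by linarith, hbig, by push_cast; nlinarith, by push_cast; nlinarith⟩
    have hlam : δ / 16 * ((4 * N : ℕ) : ℝ) * K ≤ ‖NLR.lam (NLR.til f₁ N) (NLR.til f₂ N) (NLR.til f₃ N) K‖ := by
      push_cast
      have h1 : δ * (N * K) ≤ δ * (N * Real.sqrt N) := by gcongr
      have h2 : (N : ℝ) * 16 ≤ N * (δ * K) := by gcongr
      nlinarith
    have fin : ∀ f : ℤ → ℂ, (∀ x, f x ≠ 0 → x ∈ Finset.Icc (1 : ℤ) (N : ℤ)) → NLR.LB (NLR.til f N) K ((δ / 16) ^ C0) →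
        ∃ (φ : ℤ → ℂ) (M : ℝ) (q : ℕ), (∀ x, ‖φ x‖ ≤ 1) ∧ 0 < q ∧
              IsLocalFunction φ M q ∧
              1 / (2 * B) * δ ^ C * Real.sqrt N ≤ M ∧ (q : ℝ) ≤ C * δ ^ (-C) ∧
              1 / (2 * B) * δ ^ C * N ≤ ‖∑ x ∈ Finset.Icc (1 : ℤ) (N : ℤ), f x * φ x‖ := by
      intro f hs hLB
      obtain ⟨φ, M, q, a1, a2, a3, a4, a5, a6⟩ := NLR.conv2 f N K hs hKN _ hLB
      refine ⟨φ, M, q, a1, a2, a3, ?_, ?_, ?_⟩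
      · refine le_trans ?_ a4
        rw [hη]
        calc 1 / (2 * B) * δ ^ C * Real.sqrt N ≤ 1 / (2 * B) * δ ^ C0 * (2 * K) := by gcongr
          _ = δ ^ C0 / B * K := by field_simp
      · rw [hrneg, ← div_eq_mul_inv, le_div_iff₀ hrpos]
        rw [hη] at a5
        have h1 : δ ^ C0 * q ≤ B := by
          have h2 : δ ^ C0 / B * q = δ ^ C0 * q / B := by ring
          rw [h2, div_le_one hBp] at a5
          exact a5
        calc (q : ℝ) * δ ^ C ≤ q * δ ^ C0 := by gcongr
          _ ≤ B := by rw [mul_comm]; exact h1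
          _ ≤ C := by linarith
      · refine le_trans ?_ a6
        rw [hη]
        calc 1 / (2 * B) * δ ^ C * N ≤ 1 / (2 * B) * δ ^ C0 * (8 * N) := by gcongr; linarith
          _ = δ ^ C0 / B * (4 * N) := by field_simp; ring
    have t1 : ∀ x, ‖NLR.til f₁ N x‖ ≤ 1 := fun x => b1 _
    have t2 : ∀ x, ‖NLR.til f₂ N x‖ ≤ 1 := fun x => b2 _
    have t3 : ∀ x, ‖NLR.til f₃ N x‖ ≤ 1 := fun x => b3 _
    intro f hf
    rcases hf with rfl | rfl | rfl
    · exact fin _ s1 (by simpa using k0 _ _ K hyp _ _ _ t1 t2 t3 hlam)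
    · exact fin _ s2 (by simpa using k1 _ _ K hyp _ _ _ t1 t2 t3 hlam)
    · exact fin _ s3 (by simpa using k2 _ _ K hyp _ _ _ t1 t2 t3 hlam)
  · left
    rw [hrneg, ← div_eq_mul_inv, le_div_iff₀ hrpos]
    rw [not_le, hη] at hbig
    have h1 : δ ^ C0 * K ≤ B := by
      have h2 : δ ^ C0 / B * K = δ ^ C0 * K / B := by ring
      rw [h2, div_lt_one hBp] at hbig
      exact hbig.le
    have h3 : δ ^ C ≤ δ ^ (C0 * 2) := hp _ (by push_cast; linarith)
    rw [pow_mul] at h3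
    have h4 : (δ ^ C0 * K) ^ 2 ≤ B ^ 2 := by gcongr
    calc (N : ℝ) * δ ^ C ≤ 4 * (K : ℝ) ^ 2 * (δ ^ C0) ^ 2 := by gcongr
      _ = 4 * (δ ^ C0 * K) ^ 2 := by ring
      _ ≤ C := by rw [← hCd]; linarith
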